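/- Removable singularities for plurisubharmonic functions: Let Ω be an open set in ℝ⁴ equipped with a smooth almost complex structure J, and let E ⊂ Ω be a 2-dimensional C^∞ submanifold which is closed in Ω and totally real for J. Then for every continuous J-plurisubharmonic function u on Ω \ E, the function u* defined by u*(x) = u(x) for x ∈ Ω \ E and u*(x) = limsup_{y → x, y ∈ Ω \ E} u(y) for x ∈ E, is J-plurisubharmonic on Ω. -/

import Mathlib

open Complex Metric Set MeasureTheory Filter Topology Bornology ENNReal

noncomputable section

/-- We identify `ℝ^{2n}` with `ℂⁿ` (with the Euclidean norm). -/
abbrev Cn (n : ℕ) : Type := EuclideanSpace ℂ (Fin n)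

/-- The standard complex structure on `ℂⁿ ≅ ℝ^{2n}`: multiplication by `i`,
viewed as an `ℝ`-linear map. -/
def Jstd (n : ℕ) : Cn n →L[ℝ] Cn n :=
  ContinuousLinearMap.restrictScalars ℝ (Complex.I • ContinuousLinearMap.id ℂ (Cn n))

/-- The standard complex structure on `ℂ ≅ ℝ²`. -/
def JstdC : ℂ →L[ℝ] ℂ :=
  ContinuousLinearMap.restrictScalars ℝ (Complex.I • ContinuousLinearMap.id ℂ ℂ)

/-- `J` is a (smooth) almost complex structure on the set `Ω ⊆ ℂⁿ ≅ ℝ^{2n}`: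
a `C^∞` field of linear automorphisms with `J(x) ∘ J(x) = -Id`. -/
def IsACS {n : ℕ} (Ω : Set (Cn n)) (J : Cn n → Cn n →L[ℝ] Cn n) : Prop :=
  ContDiffOn ℝ (⊤ : ℕ∞) J Ω ∧ ∀ x ∈ Ω, (J x).comp (J x) = -ContinuousLinearMap.id ℝ (Cn n)

/-- The open unit disc `Δ` in `ℂ`. -/
def unitDisc : Set ℂ := Metric.ball 0 1

/-- A map between (subsets of) almost complex spaces is `(J,J')`-holomorphic on `s` if
`df_x ∘ J(x) = J'(f(x)) ∘ df_x` on `s`. -/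
def PseudoHolOn {n m : ℕ} (J : Cn n → Cn n →L[ℝ] Cn n) (J' : Cn m → Cn m →L[ℝ] Cn m)
    (f : Cn n → Cn m) (s : Set (Cn n)) : Prop :=
  ∀ x ∈ s, DifferentiableAt ℝ f x ∧
    (fderiv ℝ f x).comp (J x) = (J' (f x)).comp (fderiv ℝ f x)

/-- A map from an open subset of `ℂ` is `J`-holomorphic on `s` if
`df_ζ ∘ J_st = J(f(ζ)) ∘ df_ζ` on `s`. -/
def JHolOn {n : ℕ} (J : Cn n → Cn n →L[ℝ] Cn n) (f : ℂ → Cn n) (s : Set ℂ) : Prop :=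
  ∀ ζ ∈ s, DifferentiableAt ℝ f ζ ∧
    (fderiv ℝ f ζ).comp JstdC = (J (f ζ)).comp (fderiv ℝ f ζ)

/-- A `J`-holomorphic disc in `D`. -/
def JDisc {n : ℕ} (J : Cn n → Cn n →L[ℝ] Cn n) (D : Set (Cn n)) (f : ℂ → Cn n) : Prop :=
  MapsTo f unitDisc D ∧ JHolOn J f unitDisc

/-- The nonnegative part of an extended real number, as an element of `ℝ≥0∞`. -/
def erealPos (x : EReal) : ℝ≥0∞ := if x = ⊤ then ⊤ else ENNReal.ofReal x.toReal

/-- The integral of an `EReal`-valued function: the (unsigned) integral of the positive part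
minus the integral of the negative part. -/
def erealIntegral {X : Type} [MeasurableSpace X] (μ : Measure X) (g : X → EReal) : EReal :=
  ((∫⁻ x, erealPos (g x) ∂μ : ℝ≥0∞) : EReal) - ((∫⁻ x, erealPos (-(g x)) ∂μ : ℝ≥0∞) : EReal)

/-- `h : ℂ → [-∞,∞)` is subharmonic on `s`: upper semicontinuous and satisfying the
sub-mean-value inequality `h(a) ≤ (2π)⁻¹ ∫₀^{2π} h(a + r e^{iθ}) dθ` whenever the closed disc
of center `a` and radius `r` is contained in `s`. -/
def SubharmonicOnE (h : ℂ → EReal) (s : Set ℂ) : Prop :=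
  UpperSemicontinuousOn h s ∧
  ∀ a : ℂ, ∀ r : ℝ, 0 < r → Metric.closedBall a r ⊆ s →
    h a ≤ (((2 * Real.pi)⁻¹ : ℝ) : EReal) *
      erealIntegral (volume.restrict (Set.Ioc (0 : ℝ) (2 * Real.pi)))
        (fun θ : ℝ => h (a + (r : ℂ) * Complex.exp ((θ : ℂ) * Complex.I)))

/-- `u : Ω → [-∞,∞)` is `J`-plurisubharmonic on `Ω`: upper semicontinuous, and `u ∘ f` is
subharmonic on `Δ` for every `J`-holomorphic disc `f : Δ → Ω`. -/
def JPshOn {n : ℕ} (J : Cn n → Cn n →L[ℝ] Cn n) (Ω : Set (Cn n)) (u : Cn n → EReal) : Prop :=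
  UpperSemicontinuousOn u Ω ∧
  ∀ f : ℂ → Cn n, JDisc J Ω f → SubharmonicOnE (fun ζ => u (f ζ)) unitDisc

/-- Real-valued `J`-plurisubharmonic functions. -/
def JPshOnR {n : ℕ} (J : Cn n → Cn n →L[ℝ] Cn n) (Ω : Set (Cn n)) (u : Cn n → ℝ) : Prop :=
  JPshOn J Ω (fun x => (u x : EReal))

/-- The `1`-form `J*dr : w ↦ dr_x(J(x)w)`. -/
def JStarDr {n : ℕ} (J : Cn n → Cn n →L[ℝ] Cn n) (r : Cn n → ℝ) (x : Cn n) : Cn n →L[ℝ] ℝ :=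
  (fderiv ℝ r x).comp (J x)

/-- The Levi form of a `C²` function `r`:
`L^J_r(p,v) = -d(J*dr)_p(v, J(p)v)` where `dα_p(u,w) = (∂_u α)_p(w) - (∂_w α)_p(u)`. -/
def LeviForm {n : ℕ} (J : Cn n → Cn n →L[ℝ] Cn n) (r : Cn n → ℝ) (p v : Cn n) : ℝ :=
  -((fderiv ℝ (JStarDr J r) p v) (J p v) - (fderiv ℝ (JStarDr J r) p (J p v)) v)

/-- `r` is strictly `J`-plurisubharmonic on `S`: its Levi form is positive definite there. -/
def StrictJPshOn {n : ℕ} (J : Cn n → Cn n →L[ℝ] Cn n) (r : Cn n → ℝ) (S : Set (Cn n)) : Prop :=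
  ∀ p ∈ S, ∀ v : Cn n, v ≠ 0 → 0 < LeviForm J r p v

/-- The Kobayashi–Royden infinitesimal pseudometric of `(D,J)`:
`K(p,v) = inf {α > 0 : ∃ J-holomorphic disc f : Δ → D, f(0) = p, df_0(∂/∂x) = v/α}`. -/
def kobMetric {n : ℕ} (J : Cn n → Cn n →L[ℝ] Cn n) (D : Set (Cn n)) (p v : Cn n) : ℝ :=
  sInf {α : ℝ | 0 < α ∧ ∃ f : ℂ → Cn n, JDisc J D f ∧ f 0 = p ∧ fderiv ℝ f 0 1 = α⁻¹ • v}

/-- A piecewise `C¹` path `γ : [0,1] → ℝ^{2n}`. -/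
def PiecewiseC1On {n : ℕ} (γ : ℝ → Cn n) : Prop :=
  ContinuousOn γ (Set.Icc 0 1) ∧
  ∃ (m : ℕ) (t : ℕ → ℝ), t 0 = 0 ∧ t m = 1 ∧ (∀ i < m, t i < t (i + 1)) ∧
    ∀ i < m, ContDiffOn ℝ 1 γ (Set.Icc (t i) (t (i + 1)))

/-- The (integrated) Kobayashi pseudodistance of `(D,J)`: the infimum of the Kobayashi–Royden
lengths of piecewise `C¹` paths in `D` joining `p` to `q`. -/
def kobDist {n : ℕ} (J : Cn n → Cn n →L[ℝ] Cn n) (D : Set (Cn n)) (p q : Cn n) : ℝ :=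
  sInf {L : ℝ | ∃ γ : ℝ → Cn n, PiecewiseC1On γ ∧ MapsTo γ (Set.Icc 0 1) D ∧
    γ 0 = p ∧ γ 1 = q ∧ L = ∫ t in (0 : ℝ)..1, kobMetric J D (γ t) (deriv γ t)}

/-- The cluster set of `f` (defined on `S`) along `A ⊆ closure S`: all limits of sequences
`f(s_k)` where `s_k ∈ S` converges to a point of `A`. -/
def clusterSet {X Y : Type*} [TopologicalSpace X] [TopologicalSpace Y]
    (f : X → Y) (S A : Set X) : Set Y :=
  {y | ∃ u : ℕ → X, (∀ k, u k ∈ S) ∧ (∃ a ∈ A, Tendsto u atTop (𝓝 a)) ∧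
    Tendsto (fun k => f (u k)) atTop (𝓝 y)}

/-- `N` is a `d`-dimensional `C^∞` submanifold of `ℂⁿ ≅ ℝ^{2n}`: near every point it can be
straightened, by a `C^∞` diffeomorphism onto an open subset of `ℝ^{2n}`, to the coordinate
subspace spanned by the first `d` coordinates. -/
def IsSmoothSubmanifold {n : ℕ} (d : ℕ) (N : Set (Cn n)) : Prop :=
  ∀ p ∈ N, ∃ (U : Set (Cn n)) (V : Set (EuclideanSpace ℝ (Fin (2 * n))))
    (φ : Cn n → EuclideanSpace ℝ (Fin (2 * n))) (ψ : EuclideanSpace ℝ (Fin (2 * n)) → Cn n),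
    IsOpen U ∧ p ∈ U ∧ IsOpen V ∧ ContDiffOn ℝ (⊤ : ℕ∞) φ U ∧ ContDiffOn ℝ (⊤ : ℕ∞) ψ V ∧
    (∀ x ∈ U, ψ (φ x) = x) ∧ (∀ y ∈ V, φ (ψ y) = y) ∧ MapsTo φ U V ∧
    φ '' (N ∩ U) = V ∩ {x | ∀ i : Fin (2 * n), d ≤ (i : ℕ) → x i = 0}

/-- The tangent set of `N ⊆ ℂⁿ` at `p`: velocities at `0` of differentiable curves through `p`
staying in `N` near time `0`. For a `C^∞` submanifold this is the tangent space `T_pN`. -/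
def TangentSet {n : ℕ} (N : Set (Cn n)) (p : Cn n) : Set (Cn n) :=
  {v | ∃ γ : ℝ → Cn n, γ 0 = p ∧ (∀ᶠ t in 𝓝 (0 : ℝ), γ t ∈ N) ∧
    DifferentiableAt ℝ γ 0 ∧ deriv γ 0 = v}

/-- `N` is totally real for `J`: `T_pN ∩ J(p)(T_pN) = {0}` at every `p ∈ N`. -/
def TotallyReal {n : ℕ} (J : Cn n → Cn n →L[ℝ] Cn n) (N : Set (Cn n)) : Prop :=
  ∀ p ∈ N, ∀ v ∈ TangentSet N p, J p v ∈ TangentSet N p → v = 0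

/-- `ρ` is a (global) `C^∞` defining function of `D`, defined on the neighborhood `Ω` of the
closure of `D`, with nonvanishing differential on `∂D`.  (This encodes that `D` has
`C^∞` boundary.) -/
def DefiningFunction {n : ℕ} (D Ω : Set (Cn n)) (ρ : Cn n → ℝ) : Prop :=
  IsOpen Ω ∧ closure D ⊆ Ω ∧ ContDiffOn ℝ (⊤ : ℕ∞) ρ Ω ∧
  D = {x ∈ Ω | ρ x < 0} ∧ ∀ x ∈ frontier D, fderiv ℝ ρ x ≠ 0

/-- `D` is a bounded strictly `J`-pseudoconvex domain with `C^∞` boundary: it admits a smooth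
defining function which is `J`-plurisubharmonic on `D` and strictly `J`-plurisubharmonic on a
neighborhood of `∂D`. -/
def StrictlyPseudoconvexDomain {n : ℕ} (J : Cn n → Cn n →L[ℝ] Cn n) (D : Set (Cn n)) : Prop :=
  IsOpen D ∧ IsConnected D ∧ IsBounded D ∧
  ∃ (Ω : Set (Cn n)) (ρ : Cn n → ℝ), DefiningFunction D Ω ρ ∧
    JPshOnR J D ρ ∧ ∃ W : Set (Cn n), IsOpen W ∧ frontier D ⊆ W ∧ StrictJPshOn J ρ W

end

set_option linter.unusedSectionVars false
set_option linter.unusedSimpArgs false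
set_option linter.deprecated false
set_option linter.unusedVariables false

namespace RS

section P1
variable {V : Type*} [NormedAddCommGroup V] [NormedSpace ℝ V] [CompleteSpace V]

/-- bounded by `M` and 1/2-Hölder with constant `M` -/
def HB {X : Type*} [NormedAddCommGroup X] (g : ℂ → X) (M : ℝ) : Prop :=
  (∀ z, ‖g z‖ ≤ M) ∧ ∀ z z', ‖g z - g z'‖ ≤ M * √‖z - z'‖

theorem HB.continuous {X : Type*} [NormedAddCommGroup X] {g : ℂ → X} {M : ℝ} (h : HB g M) :
    Continuous g := by
  rw [continuous_iff_continuousAt]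
  intro z
  rw [ContinuousAt, tendsto_iff_norm_sub_tendsto_zero]
  have h1 : Tendsto (fun z' : ℂ => M * √‖z' - z‖) (𝓝 z) (𝓝 (M * √‖z - z‖)) := by
    apply Continuous.tendsto
    fun_prop
  simp only [sub_self, norm_zero, Real.sqrt_zero, mul_zero] at h1
  exact squeeze_zero (fun _ => norm_nonneg _) (fun z' => h.2 z' z) h1

theorem HB.nonneg {X : Type*} [NormedAddCommGroup X] {g : ℂ → X} {M : ℝ} (h : HB g M) : 0 ≤ M :=
  (norm_nonneg _).trans (h.1 0)

/-- averaging operator -/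
noncomputable def Av (ψ : ℂ → ℝ) (s : ℝ) (g : ℂ → V) (z : ℂ) : V := ∫ u, ψ u • g (z - s • u)

/-- class of kernels -/
structure Ker (ψ : ℂ → ℝ) (B : ℝ) : Prop where
  smooth : ContDiff ℝ (⊤ : ℕ∞) ψ
  supp : ∀ u, 2 < ‖u‖ → ψ u = 0
  bd : ∀ u, ‖ψ u‖ ≤ B

theorem Ker.hcs {ψ : ℂ → ℝ} {B : ℝ} (h : Ker ψ B) : HasCompactSupport ψ :=
  HasCompactSupport.intro (isCompact_closedBall (0 : ℂ) 2) (fun x hx => h.supp x (by simpa using hx))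

theorem Ker.deriv {ψ : ℂ → ℝ} {B : ℝ} (h : Ker ψ B) :
    ∃ B', 0 ≤ B' ∧ ∀ k, Ker (fun u => fderiv ℝ ψ u k) (B' * ‖k‖) := by
  have hd : Continuous (fderiv ℝ ψ) := h.smooth.continuous_fderiv (by simp)
  have hc : HasCompactSupport (fderiv ℝ ψ) := h.hcs.fderiv ℝ
  obtain ⟨B', hB'⟩ := hd.bounded_above_of_compact_support hc
  refine ⟨B', (norm_nonneg _).trans (hB' 0), fun k => ⟨?_, ?_, ?_⟩⟩
  · exact (h.smooth.fderiv_right (m := (⊤ : ℕ∞)) (by simp)).clm_apply contDiff_const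
  · intro u hu
    have : ψ =ᶠ[𝓝 u] fun _ => 0 := by
      filter_upwards [(isOpen_lt continuous_const continuous_norm).mem_nhds hu] with v hv
      exact h.supp v hv
    rw [this.fderiv_eq]; simp
  · intro u
    exact (ContinuousLinearMap.le_opNorm _ _).trans (by gcongr; exact hB' u)

/-- volume of the closed ball of radius 2 -/
noncomputable def c0 : ℝ := (volume (closedBall (0 : ℂ) 2)).toReal

theorem c0_nonneg : 0 ≤ c0 := ENNReal.toReal_nonneg

theorem ker_int_bound {X : Type*} [NormedAddCommGroup X] [NormedSpace ℝ X] {G : ℂ → X} {C : ℝ}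
    (h1 : ∀ u, 2 < ‖u‖ → G u = 0) (h2 : ∀ u, ‖u‖ ≤ 2 → ‖G u‖ ≤ C) : ‖∫ u, G u‖ ≤ C * c0 := by
  have : ∫ u, G u = ∫ u in closedBall (0 : ℂ) 2, G u := by
    rw [setIntegral_eq_integral_of_forall_compl_eq_zero]
    intro u hu
    exact h1 u (by simpa using hu)
  rw [this]
  exact norm_setIntegral_le_of_norm_le_const (isCompact_closedBall (0 : ℂ) 2).measure_lt_top
    (fun x hx => h2 x (by simpa using hx))

theorem Av_bound {ψ : ℂ → ℝ} {B s M : ℝ} {g : ℂ → V} (h : Ker ψ B) (hg : ∀ z, ‖g z‖ ≤ M) (z : ℂ) :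
    ‖Av ψ s g z‖ ≤ B * M * c0 := by
  apply ker_int_bound
  · intro u hu; simp [h.supp u hu]
  · intro u hu
    rw [norm_smul]
    have := h.bd u
    have := (norm_nonneg _).trans this
    exact mul_le_mul (h.bd u) (hg _) (norm_nonneg _) this

theorem ker_integrable {ψ : ℂ → ℝ} {B s : ℝ} {g : ℂ → V} (h : Ker ψ B) (hg : Continuous g) (z : ℂ) :
    Integrable (fun u => ψ u • g (z - s • u)) := by
  apply Continuous.integrable_of_hasCompactSupport
  · have := h.smooth.continuous
    fun_prop
  · exact h.hcs.smul_right

theorem Av_bound_zero {ψ : ℂ → ℝ} {B s M : ℝ} {g : ℂ → V} (h : Ker ψ B) (hg : HB g M)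
    (hs : 0 ≤ s) (h0 : ∫ u, ψ u = 0) (z : ℂ) :
    ‖Av ψ s g z‖ ≤ B * (M * (2 * √s)) * c0 := by
  have : Av ψ s g z = ∫ u, ψ u • (g (z - s • u) - g z) := by
    simp_rw [smul_sub]
    rw [integral_sub (ker_integrable h hg.continuous z), integral_smul_const, h0]
    · simp [Av]
    · exact (ker_integrable (s := 0) h hg.continuous z).congr (by simp)
  rw [this]
  apply ker_int_bound
  · intro u hu; simp [h.supp u hu]
  · intro u hu
    rw [norm_smul]
    have hB := (norm_nonneg _).trans (h.bd u)
    refine mul_le_mul (h.bd u) ((hg.2 _ _).trans ?_) (norm_nonneg _) hB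
    have := hg.nonneg
    gcongr
    rw [sub_sub_cancel_left, norm_neg, norm_smul, Real.norm_of_nonneg hs]
    rw [show (2:ℝ) * √s = √(4 * s) by rw [Real.sqrt_mul (by norm_num), show (4:ℝ) = 2^2 by norm_num, Real.sqrt_sq (by norm_num)]]
    apply Real.sqrt_le_sqrt
    nlinarith

theorem Av_conv {ψ : ℂ → ℝ} {s : ℝ} {g : ℂ → V} (hs : 0 < s) (z : ℂ) :
    Av ψ s g z = convolution (fun w => g (s • w)) ψ (ContinuousLinearMap.lsmul ℝ ℝ).flip volume (s⁻¹ • z) := by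
  rw [convolution_flip, convolution_def, Av]
  congr 1; ext u
  simp [smul_sub, smul_smul, hs.ne']

theorem Av_deriv {ψ : ℂ → ℝ} {B s : ℝ} {g : ℂ → V} (h : Ker ψ B) (hg : Continuous g)
    (hs : 0 < s) (z : ℂ) :
    DifferentiableAt ℝ (Av ψ s g) z ∧
      ∀ k, fderiv ℝ (Av ψ s g) z k = s⁻¹ • Av (fun u => fderiv ℝ ψ u k) s g z := by
  have hg' : Continuous (fun w => g (s • w)) := by fun_prop
  have h1 := h.hcs.hasFDerivAt_convolution_right (ContinuousLinearMap.lsmul ℝ ℝ).flip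
    (hg'.locallyIntegrable (μ := volume)) (h.smooth.of_le (by simp)) (s⁻¹ • z)
  have h2 : HasFDerivAt (fun z : ℂ => s⁻¹ • z) (s⁻¹ • ContinuousLinearMap.id ℝ ℂ) z :=
    (s⁻¹ • ContinuousLinearMap.id ℝ ℂ).hasFDerivAt
  have h3 := h1.comp z h2
  have h4 : (Av ψ s g) = convolution (fun w => g (s • w)) ψ (ContinuousLinearMap.lsmul ℝ ℝ).flip volume ∘ (fun z : ℂ => s⁻¹ • z) := by
    ext z; exact Av_conv hs z
  rw [← h4] at h3
  refine ⟨h3.differentiableAt, fun k => ?_⟩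
  rw [h3.fderiv]
  simp only [ContinuousLinearMap.comp_apply, ContinuousLinearMap.smul_apply, ContinuousLinearMap.id_apply, map_smul]
  rw [convolution_precompR_apply _ (hg'.locallyIntegrable) (h.hcs.fderiv ℝ) (h.smooth.continuous_fderiv (by simp)),
    Av_conv hs]

theorem int_deriv_zero {ψ : ℂ → ℝ} {B : ℝ} (h : Ker ψ B) (k : ℂ) : ∫ u, fderiv ℝ ψ u k = 0 := by
  have h1 := (Av_deriv (s := 1) (g := fun _ => (1:ℝ)) h continuous_const one_pos 0).2 k
  have h2 : Av ψ 1 (fun _ => (1:ℝ)) = fun _ => ∫ u, ψ u := by ext z; simp [Av]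
  rw [h2] at h1
  simpa [Av] using h1.symm

theorem sum_min {δ : ℝ} (hδ : 0 ≤ δ) (N : ℕ) :
    ∑ j ∈ Finset.range N, min ((2:ℝ)⁻¹ ^ j) (2 ^ j * δ) ≤ 4 * √δ := by
  -- stronger: tail
  rcases eq_or_lt_of_le hδ with rfl | hδ'
  · simp
  set r := √δ with hr
  have hr0 : 0 < r := Real.sqrt_pos.2 hδ'
  have hrr : δ = r * r := (Real.mul_self_sqrt hδ).symm
  rw [hrr]
  have key : ∀ N : ℕ, (2 ^ N * r ≤ 1 → ∑ j ∈ Finset.range N, min ((2:ℝ)⁻¹ ^ j) (2 ^ j * (r*r)) ≤ (2^N * r) * r)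
     ∧ (1 ≤ 2 ^ N * r → ∑ j ∈ Finset.range N, min ((2:ℝ)⁻¹ ^ j) (2 ^ j * (r*r)) ≤ 4 * r - 2 * 2⁻¹ ^ N) := by
    intro N
    induction N with
    | zero => refine ⟨fun _ => by simp; positivity, fun h => by simp at h ⊢; linarith⟩
    | succ n ih =>
      have e : (2:ℝ)⁻¹ ^ n * 2 ^ n = 1 := by rw [← mul_pow]; norm_num
      have p1 : (0:ℝ) < 2 ^ n := by positivity
      have p2 : (0:ℝ) < 2⁻¹ ^ n := by positivity
      have m1 := min_le_left ((2:ℝ)⁻¹ ^ n) (2 ^ n * (r*r))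
      have m2 := min_le_right ((2:ℝ)⁻¹ ^ n) (2 ^ n * (r*r))
      rw [Finset.sum_range_succ]
      constructor
      · intro h
        have := ih.1 (by rw [pow_succ] at h; nlinarith)
        rw [pow_succ]; nlinarith
      · intro h
        rcases le_total 1 (2^n * r) with h' | h'
        · have := ih.2 h'
          rw [pow_succ]; nlinarith
        · have := ih.1 h'
          rw [pow_succ] at h ⊢
          -- 2^n r ∈ [1/2,1]
          have q : (2:ℝ)⁻¹ ^ n ≤ 2 * r := by nlinarith
          have q2 : (2 ^ n * r) * r ≤ r := by nlinarith
          nlinarith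
  rcases le_total (2 ^ N * r) 1 with h | h
  · have := (key N).1 h
    nlinarith
  · have := (key N).2 h
    have : (0:ℝ) < 2⁻¹ ^ N := by positivity
    linarith

end P1
end RS

namespace RS

section P1b
variable {V : Type*} [NormedAddCommGroup V] [NormedSpace ℝ V] [CompleteSpace V]

theorem fderiv_bdd {X Y : Type*} [NormedAddCommGroup X] [NormedSpace ℝ X] [NormedAddCommGroup Y]
    [NormedSpace ℝ Y] {f : X → Y} (h : HasCompactSupport f) (hs1 : ContDiff ℝ (⊤ : ℕ∞) f) :
    ∃ B', ∀ u, ‖fderiv ℝ f u‖ ≤ B' := by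
  have hd : Continuous (fderiv ℝ f) := hs1.continuous_fderiv (by simp)
  have hc1 : HasCompactSupport (fderiv ℝ f) := h.fderiv ℝ
  exact hd.bounded_above_of_compact_support hc1

theorem opNorm2 {X Y Z : Type*} [NormedAddCommGroup X] [NormedSpace ℝ X] [NormedAddCommGroup Y]
    [NormedSpace ℝ Y] [NormedAddCommGroup Z] [NormedSpace ℝ Z] (A : X →L[ℝ] Y →L[ℝ] Z) {B' : ℝ}
    (h : ‖A‖ ≤ B') (l : X) (k : Y) : ‖A l k‖ ≤ B' * ‖l‖ * ‖k‖ := by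
  calc ‖A l k‖ ≤ ‖A l‖ * ‖k‖ := ContinuousLinearMap.le_opNorm _ _
    _ ≤ (‖A‖ * ‖l‖) * ‖k‖ := by gcongr; exact ContinuousLinearMap.le_opNorm _ _
    _ ≤ (B' * ‖l‖) * ‖k‖ := by gcongr

theorem Ker.deriv2_bd {ψ : ℂ → ℝ} {B : ℝ} (h : Ker ψ B) :
    ∃ B', 0 ≤ B' ∧ ∀ k l u, ‖fderiv ℝ (fun v => fderiv ℝ ψ v k) u l‖ ≤ B' * ‖k‖ * ‖l‖ := by
  have hs1 : ContDiff ℝ (⊤ : ℕ∞) (fderiv ℝ ψ) := h.smooth.fderiv_right (m := (⊤ : ℕ∞)) (by simp)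
  have hc1 : HasCompactSupport (fderiv ℝ ψ) := h.hcs.fderiv ℝ
  obtain ⟨B', hB'⟩ := fderiv_bdd hc1 hs1
  refine ⟨B', (norm_nonneg _).trans (hB' 0), fun k l u => ?_⟩
  have h4 : DifferentiableAt ℝ (fderiv ℝ ψ) u := hs1.differentiable (by simp) u
  have h3 := h4.hasFDerivAt.clm_apply (hasFDerivAt_const k u)
  have h5 : fderiv ℝ (fun v => fderiv ℝ ψ v k) u l = (fderiv ℝ (fderiv ℝ ψ) u l) k := by
    rw [h3.fderiv]; simp
  rw [h5]
  exact (opNorm2 _ (hB' u) l k).trans (by ring_nf; rfl)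

theorem Ker.deriv2 {ψ : ℂ → ℝ} {B : ℝ} (h : Ker ψ B) :
    ∃ B', 0 ≤ B' ∧ ∀ k l, Ker (fun u => fderiv ℝ (fun v => fderiv ℝ ψ v k) u l) (B' * ‖k‖ * ‖l‖) := by
  obtain ⟨B', hB', hb⟩ := h.deriv2_bd
  obtain ⟨B1, hB1, h1⟩ := h.deriv
  refine ⟨B', hB', fun k l => ?_⟩
  obtain ⟨B2, hB2, h2⟩ := (h1 k).deriv
  exact ⟨(h2 l).smooth, (h2 l).supp, hb k l⟩

/-- dyadic scale -/
noncomputable def sc (j : ℕ) : ℝ := (4:ℝ)⁻¹ ^ j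

theorem sc_pos (j : ℕ) : 0 < sc j := by unfold sc; positivity

theorem sqrt_sc (j : ℕ) : √(sc j) = 2⁻¹ ^ j := by
  rw [sc, show (4:ℝ)⁻¹ = 2⁻¹ ^ 2 by norm_num, ← pow_mul, mul_comm, pow_mul, Real.sqrt_sq (by positivity)]

theorem sc_inv_sqrt (j : ℕ) : (sc j)⁻¹ * √(sc j) = 2 ^ j := by
  rw [sqrt_sc, sc, ← inv_pow, ← mul_pow]; norm_num

noncomputable def TT (κ : ℂ → ℝ) (g : ℂ → V) (z : ℂ) : V := ∑' j : ℕ, sc j • Av κ (sc j) g z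

theorem summable_sc : Summable sc := summable_geometric_of_lt_one (by norm_num) (by norm_num)

theorem summable_half : Summable (fun j : ℕ => (2:ℝ)⁻¹ ^ j) := summable_geometric_of_lt_one (by norm_num) (by norm_num)

theorem TT_summable {κ : ℂ → ℝ} {B M : ℝ} (hκ : Ker κ B) {g : ℂ → V} (hg : ∀ z, ‖g z‖ ≤ M) (z : ℂ) :
    Summable (fun j : ℕ => sc j • Av κ (sc j) g z) := by
  apply Summable.of_norm_bounded (g := fun j => sc j * (B * M * c0)) (summable_sc.mul_right _)
  intro j
  rw [norm_smul, Real.norm_of_nonneg (sc_pos j).le]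
  exact mul_le_mul_of_nonneg_left (Av_bound hκ hg z) (sc_pos j).le

theorem TT_sub {κ : ℂ → ℝ} {B M M' : ℝ} (hκ : Ker κ B) {g g' : ℂ → V} (hg : HB g M) (hg' : HB g' M') (z : ℂ) :
    TT κ (fun z => g z - g' z) z = TT κ g z - TT κ g' z := by
  unfold TT
  rw [← (TT_summable hκ hg.1 z).tsum_sub (TT_summable hκ hg'.1 z)]
  congr 1; ext j
  rw [← smul_sub]
  congr 1
  unfold Av
  rw [← integral_sub (ker_integrable hκ hg.continuous z) (ker_integrable hκ hg'.continuous z)]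
  simp_rw [smul_sub]

variable (V) in
theorem TT_main {κ : ℂ → ℝ} {B : ℝ} (hκ : Ker κ B) : ∃ C, 0 ≤ C ∧ ∀ (g : ℂ → V) (M : ℝ), HB g M →
    (∀ z, DifferentiableAt ℝ (TT κ g) z) ∧
    (∀ z k, HasSum (fun j => Av (fun u => fderiv ℝ κ u k) (sc j) g z) (fderiv ℝ (TT κ g) z k)) ∧
    (∀ z, ‖TT κ g z‖ ≤ C * M) ∧ HB (fderiv ℝ (TT κ g)) (C * M) := by
  obtain ⟨B1, hB1, h1⟩ := hκ.deriv
  obtain ⟨B2, hB2, h2⟩ := hκ.deriv2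
  have hB : 0 ≤ B := (norm_nonneg _).trans (hκ.bd 0)
  have hc0 := c0_nonneg
  set K1 := 4 * B1 * c0 with hK1
  set K2 := (4 * B1 + 2 * B2) * c0 with hK2
  have hK1' : 0 ≤ K1 := by positivity
  have hK2' : 0 ≤ K2 := by positivity
  refine ⟨2 * B * c0 + K1 + 4 * K2, by positivity, fun g M hg => ?_⟩
  have hM := hg.nonneg
  have hc := hg.continuous
  set f' : ℕ → ℂ → ℂ →L[ℝ] V := fun j z => sc j • fderiv ℝ (Av κ (sc j) g) z with hf'
  have hf1 : ∀ j z, HasFDerivAt (fun z => sc j • Av κ (sc j) g z) (f' j z) z := fun j z =>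
    (Av_deriv hκ hc (sc_pos j) z).1.hasFDerivAt.const_smul _
  have hf2 : ∀ j z k, f' j z k = Av (fun u => fderiv ℝ κ u k) (sc j) g z := fun j z k => by
    simp only [hf', ContinuousLinearMap.smul_apply]
    rw [(Av_deriv hκ hc (sc_pos j) z).2 k, smul_smul, mul_inv_cancel₀ (sc_pos j).ne', one_smul]
  have hf3 : ∀ j z, ‖f' j z‖ ≤ 2 * B1 * c0 * M * 2⁻¹ ^ j := fun j z => by
    apply ContinuousLinearMap.opNorm_le_bound _ (by positivity)
    intro k
    rw [hf2]
    have := Av_bound_zero (h1 k) hg (sc_pos j).le (int_deriv_zero hκ k) z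
    rw [sqrt_sc] at this
    calc _ ≤ _ := this
      _ = _ := by ring
  have hsum3 : Summable (fun j : ℕ => 2 * B1 * c0 * M * (2:ℝ)⁻¹ ^ j) := summable_half.mul_left _
  have hf4 : ∀ j z z', ‖f' j z - f' j z'‖ ≤ 2 * B2 * c0 * M * (2 ^ j * ‖z - z'‖) := fun j z z' => by
    apply ContinuousLinearMap.opNorm_le_bound _ (by positivity)
    intro k
    rw [ContinuousLinearMap.sub_apply, hf2, hf2]
    have hd := fun z => Av_deriv (h1 k) hc (sc_pos j) z
    have hn : ∀ z, ‖fderiv ℝ (Av (fun u => fderiv ℝ κ u k) (sc j) g) z‖ ≤ 2 * B2 * c0 * M * 2 ^ j * ‖k‖ := by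
      intro z
      apply ContinuousLinearMap.opNorm_le_bound _ (by positivity)
      intro l
      rw [(hd z).2 l, norm_smul, norm_inv, Real.norm_of_nonneg (sc_pos j).le]
      have := Av_bound_zero (h2 k l) hg (sc_pos j).le (int_deriv_zero (h1 k) l) z
      calc _ ≤ (sc j)⁻¹ * _ := mul_le_mul_of_nonneg_left this (inv_nonneg.2 (sc_pos j).le)
        _ = ((sc j)⁻¹ * √(sc j)) * (2 * B2 * c0 * M * ‖k‖ * ‖l‖) := by ring
        _ = _ := by rw [sc_inv_sqrt]; ring
    have := Convex.norm_image_sub_le_of_norm_fderiv_le (s := univ) (fun x _ => (hd x).1) (fun x _ => hn x) convex_univ (mem_univ z') (mem_univ z)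
    calc _ ≤ _ := this
      _ = _ := by ring
  have hD := fun z => hasFDerivAt_tsum hsum3 hf1 hf3 (TT_summable hκ hg.1 0) z
  have hD' : ∀ z, fderiv ℝ (TT κ g) z = ∑' j, f' j z := fun z => (hD z).fderiv
  have hsf : ∀ z, Summable (fun j => f' j z) := fun z => Summable.of_norm_bounded hsum3 (fun j => hf3 j z)
  have htwo : ∑' j : ℕ, (2:ℝ)⁻¹ ^ j = 2 := by
    rw [tsum_geometric_of_lt_one (by norm_num) (by norm_num)]; norm_num
  refine ⟨fun z => (hD z).differentiableAt, fun z k => ?_, fun z => ?_, fun z => ?_, fun z z' => ?_⟩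
  · rw [hD' z]
    have := (hsf z).hasSum.mapL (ContinuousLinearMap.apply ℝ V k)
    simpa [hf2] using this
  · have hb : ∀ j, ‖sc j • Av κ (sc j) g z‖ ≤ (B * M * c0) * 2⁻¹ ^ j := fun j => by
      rw [norm_smul, Real.norm_of_nonneg (sc_pos j).le, mul_comm]
      have : sc j ≤ 2⁻¹ ^ j := by unfold sc; gcongr; norm_num
      exact mul_le_mul (Av_bound hκ hg.1 z) this (sc_pos j).le (by positivity)
    calc ‖TT κ g z‖ ≤ ∑' j : ℕ, (B * M * c0) * (2:ℝ)⁻¹ ^ j :=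
        tsum_of_norm_bounded (summable_half.mul_left _).hasSum hb
      _ = (2 * B * c0) * M := by rw [tsum_mul_left, htwo]; ring
      _ ≤ _ := by gcongr; linarith
  · rw [hD' z]
    calc ‖∑' j, f' j z‖ ≤ ∑' j : ℕ, 2 * B1 * c0 * M * (2:ℝ)⁻¹ ^ j :=
        tsum_of_norm_bounded hsum3.hasSum (fun j => hf3 j z)
      _ = K1 * M := by rw [tsum_mul_left, htwo]; ring
      _ ≤ _ := by gcongr; nlinarith [mul_nonneg hB hc0]
  · rw [hD' z, hD' z', ← (hsf z).tsum_sub (hsf z')]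
    have hb : ∀ j, ‖f' j z - f' j z'‖ ≤ (K2 * M) * min ((2:ℝ)⁻¹ ^ j) (2 ^ j * ‖z - z'‖) := fun j => by
      rw [mul_min_of_nonneg _ _ (by positivity)]
      apply le_min
      · calc _ ≤ ‖f' j z‖ + ‖f' j z'‖ := norm_sub_le _ _
          _ ≤ _ := add_le_add (hf3 j z) (hf3 j z')
          _ = (4 * B1 * c0) * M * (2:ℝ)⁻¹ ^ j := by ring
          _ ≤ _ := by gcongr; rw [hK2]; gcongr; linarith
      · refine (hf4 j z z').trans ?_
        gcongr
        rw [hK2]; gcongr; linarith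
    have hsm : Summable (fun j : ℕ => min ((2:ℝ)⁻¹ ^ j) (2 ^ j * ‖z - z'‖)) :=
      Summable.of_nonneg_of_le (fun j => by positivity) (fun j => min_le_left _ _) summable_half
    calc ‖∑' j, (f' j z - f' j z')‖ ≤ ∑' j : ℕ, (K2 * M) * min ((2:ℝ)⁻¹ ^ j) (2 ^ j * ‖z - z'‖) :=
        tsum_of_norm_bounded (hsm.mul_left _).hasSum hb
      _ = (K2 * M) * ∑' j : ℕ, min ((2:ℝ)⁻¹ ^ j) (2 ^ j * ‖z - z'‖) := by rw [tsum_mul_left]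
      _ ≤ (K2 * M) * (4 * √‖z - z'‖) := by
        gcongr
        exact Real.tsum_le_of_sum_range_le (fun j => by positivity) (fun n => sum_min (norm_nonneg _) n)
      _ = (4 * K2) * M * √‖z - z'‖ := by ring
      _ ≤ _ := by gcongr; nlinarith [mul_nonneg hB hc0]

end P1b
end RS

namespace RS

section P1c
variable {V : Type*} [NormedAddCommGroup V] [NormedSpace ℝ V] [CompleteSpace V]

noncomputable def eta (s : ℝ) : ℝ := Real.smoothTransition (2 - s)

theorem eta_smooth : ContDiff ℝ (⊤ : ℕ∞) eta :=
  (Real.smoothTransition.contDiff (n := ⊤)).comp (contDiff_const.sub contDiff_id)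

theorem eta_one {s : ℝ} (h : s ≤ 1) : eta s = 1 := Real.smoothTransition.one_of_one_le (by linarith)
theorem eta_zero {s : ℝ} (h : 2 ≤ s) : eta s = 0 := Real.smoothTransition.zero_of_nonpos (by linarith)

noncomputable def etaB (s : ℝ) : ℝ := (eta s - eta (16 * s)) / s

theorem etaB_mul (s : ℝ) : s * etaB s = eta s - eta (16 * s) := by
  unfold etaB
  rcases eq_or_ne s 0 with rfl | h
  · simp
  · field_simp

theorem etaB_smooth : ContDiff ℝ (⊤ : ℕ∞) etaB := by
  rw [contDiff_iff_contDiffAt]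
  intro s
  rcases lt_or_ge s (1/16) with h | h
  · have : etaB =ᶠ[𝓝 s] fun _ => 0 := by
      filter_upwards [Iio_mem_nhds h] with t ht
      have ht' : t < 1/16 := ht
      rw [etaB, eta_one (by linarith), eta_one (by linarith)]; simp
    exact contDiffAt_const.congr_of_eventuallyEq this
  · apply ContDiffAt.div
    · exact (eta_smooth.sub (eta_smooth.comp (contDiff_const.mul contDiff_id))).contDiffAt
    · exact contDiffAt_id
    · show s ≠ 0
      linarith

theorem etaB_deriv (s : ℝ) : etaB s + s * deriv etaB s = deriv eta s - 16 * deriv eta (16 * s) := by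
  have h1 : HasDerivAt (fun s => s * etaB s) (1 * etaB s + s * deriv etaB s) s :=
    (hasDerivAt_id s).mul (etaB_smooth.differentiable (by simp) s).hasDerivAt
  have hd := eta_smooth.differentiable (by simp)
  have h3 : HasDerivAt (fun s : ℝ => 16 * s) 16 s := by
    simpa using (hasDerivAt_id s).const_mul (16:ℝ)
  have h2 : HasDerivAt (fun s => eta s - eta (16 * s)) (deriv eta s - deriv eta (16 * s) * 16) s :=
    (hd s).hasDerivAt.sub ((hd (16 * s)).hasDerivAt.comp s h3)
  have h4 : (fun s => s * etaB s) = fun s => eta s - eta (16 * s) := funext etaB_mul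
  rw [h4] at h1
  have := h1.unique h2
  linarith

noncomputable def nsq (z : ℂ) : ℝ := z.re * z.re + z.im * z.im

theorem nsq_eq (z : ℂ) : nsq z = ‖z‖ ^ 2 := by
  rw [← Complex.normSq_eq_norm_sq, Complex.normSq_apply]; rfl

theorem nsq_hasFDerivAt (z : ℂ) : HasFDerivAt nsq ((2 * z.re) • Complex.reCLM + (2 * z.im) • Complex.imCLM) z := by
  have h1 := Complex.reCLM.hasFDerivAt (x := z)
  have h2 := Complex.imCLM.hasFDerivAt (x := z)
  have := (h1.mul h1).add (h2.mul h2)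
  refine this.congr_fderiv ?_
  ext h
  simp; ring

theorem nsq_smooth : ContDiff ℝ (⊤ : ℕ∞) nsq :=
  (Complex.reCLM.contDiff.mul Complex.reCLM.contDiff).add (Complex.imCLM.contDiff.mul Complex.imCLM.contDiff)

noncomputable def kap1 (z : ℂ) : ℝ := z.re * etaB (nsq z)
noncomputable def kap2 (z : ℂ) : ℝ := z.im * etaB (nsq z)
noncomputable def muK (z : ℂ) : ℝ := -2 * deriv eta (nsq z)

theorem nsq_gt {u : ℂ} (hu : 2 < ‖u‖) : 2 < nsq u := by rw [nsq_eq]; nlinarith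

theorem kerOf {ψ : ℂ → ℝ} (h1 : ContDiff ℝ (⊤ : ℕ∞) ψ) (h2 : ∀ u, 2 < ‖u‖ → ψ u = 0) : ∃ B, Ker ψ B := by
  have : HasCompactSupport ψ :=
    HasCompactSupport.intro (isCompact_closedBall (0 : ℂ) 2) (fun x hx => h2 x (by simpa using hx))
  obtain ⟨B, hB⟩ := h1.continuous.bounded_above_of_compact_support this
  exact ⟨B, h1, h2, hB⟩

theorem etaB_zero {s : ℝ} (h : 2 < s) : etaB s = 0 := by
  rw [etaB, eta_zero h.le, eta_zero (by linarith)]; simp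

theorem kap1_ker : ∃ B, Ker kap1 B := kerOf (Complex.reCLM.contDiff.mul (etaB_smooth.comp nsq_smooth))
  (fun u hu => by rw [kap1, etaB_zero (nsq_gt hu), mul_zero])
theorem kap2_ker : ∃ B, Ker kap2 B := kerOf (Complex.imCLM.contDiff.mul (etaB_smooth.comp nsq_smooth))
  (fun u hu => by rw [kap2, etaB_zero (nsq_gt hu), mul_zero])

theorem deriv_eta_smooth : ContDiff ℝ (⊤ : ℕ∞) (deriv eta) :=
  (contDiff_infty_iff_deriv.1 eta_smooth).2

theorem deriv_eta_zero {s : ℝ} (h : 2 < s) : deriv eta s = 0 := by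
  have : eta =ᶠ[𝓝 s] fun _ => 0 := by
    filter_upwards [Ioi_mem_nhds h] with t ht
    exact eta_zero (le_of_lt ht)
  rw [this.deriv_eq]; simp

theorem deriv_eta_zero' {s : ℝ} (h : s < 1) : deriv eta s = 0 := by
  have : eta =ᶠ[𝓝 s] fun _ => 1 := by
    filter_upwards [Iio_mem_nhds h] with t ht
    exact eta_one (le_of_lt ht)
  rw [this.deriv_eq]; simp

theorem muK_ker : ∃ B, Ker muK B := kerOf (contDiff_const.mul (deriv_eta_smooth.comp nsq_smooth))
  (fun u hu => by rw [muK, deriv_eta_zero (nsq_gt hu), mul_zero])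

theorem etaBn_deriv (z : ℂ) : HasFDerivAt (fun z => etaB (nsq z))
    (deriv etaB (nsq z) • ((2 * z.re) • Complex.reCLM + (2 * z.im) • Complex.imCLM)) z :=
  (etaB_smooth.differentiable (by simp) (nsq z)).hasDerivAt.comp_hasFDerivAt z (nsq_hasFDerivAt z)

theorem kap1_deriv (z h : ℂ) : fderiv ℝ kap1 z h =
    z.re * (deriv etaB (nsq z) * (2 * z.re * h.re + 2 * z.im * h.im)) + etaB (nsq z) * h.re := by
  have h1 := (Complex.reCLM.hasFDerivAt (x := z)).mul (etaBn_deriv z)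
  have h2 : HasFDerivAt kap1 _ z := h1
  rw [h2.fderiv]; simp; ring

theorem kap2_deriv (z h : ℂ) : fderiv ℝ kap2 z h =
    z.im * (deriv etaB (nsq z) * (2 * z.re * h.re + 2 * z.im * h.im)) + etaB (nsq z) * h.im := by
  have h1 := (Complex.imCLM.hasFDerivAt (x := z)).mul (etaBn_deriv z)
  have h2 : HasFDerivAt kap2 _ z := h1
  rw [h2.fderiv]; simp; ring

theorem kap_div (u : ℂ) : fderiv ℝ kap1 u 1 + fderiv ℝ kap2 u I = 16 * muK ((4:ℝ) • u) - muK u := by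
  rw [kap1_deriv, kap2_deriv, muK, muK]
  have h : nsq ((4:ℝ) • u) = 16 * nsq u := by simp [nsq]; ring
  rw [h]
  have := etaB_deriv (nsq u)
  simp only [one_re, one_im, I_re, I_im]
  have h2 : nsq u = u.re * u.re + u.im * u.im := rfl
  linear_combination 2 * this - 2 * deriv etaB (nsq u) * h2

theorem kap_curl (u : ℂ) : fderiv ℝ kap1 u I = fderiv ℝ kap2 u 1 := by
  rw [kap1_deriv, kap2_deriv]
  simp; ring

noncomputable def cmu : ℝ := ∫ u, muK u

theorem eta_antitone : Antitone eta := fun a b h => Real.smoothTransition.monotone (by linarith)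

theorem cmu_pos : 0 < cmu := by
  obtain ⟨B, hB⟩ := muK_ker
  obtain ⟨s, hs, hs'⟩ := exists_deriv_eq_slope eta (show (1:ℝ) < 2 by norm_num) (eta_smooth.continuous.continuousOn)
    (eta_smooth.differentiable (by simp)).differentiableOn
  rw [eta_one le_rfl, eta_zero le_rfl] at hs'
  apply hB.smooth.continuous.integral_pos_of_hasCompactSupport_nonneg_nonzero hB.hcs (x := ((√s : ℝ) : ℂ))
  · intro u
    have : deriv eta (nsq u) ≤ 0 := eta_antitone.deriv_nonpos
    simp only [muK, Pi.zero_apply]; linarith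
  · have h0 : 0 ≤ s := by linarith [hs.1]
    have : nsq ((√s : ℝ) : ℂ) = s := by simp [nsq, Real.mul_self_sqrt h0]
    rw [muK, this, hs']; norm_num

theorem Av_approx {ψ : ℂ → ℝ} {B s M : ℝ} {g : ℂ → V} (h : Ker ψ B) (hg : HB g M)
    (hs : 0 ≤ s) (z : ℂ) :
    ‖Av ψ s g z - (∫ u, ψ u) • g z‖ ≤ B * (M * (2 * √s)) * c0 := by
  have : Av ψ s g z - (∫ u, ψ u) • g z = ∫ u, ψ u • (g (z - s • u) - g z) := by
    simp_rw [smul_sub]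
    rw [integral_sub (ker_integrable h hg.continuous z), integral_smul_const]
    · simp [Av]
    · exact (ker_integrable (s := 0) h hg.continuous z).congr (by simp)
  rw [this]
  apply ker_int_bound
  · intro u hu; simp [h.supp u hu]
  · intro u hu
    rw [norm_smul]
    have hB := (norm_nonneg _).trans (h.bd u)
    refine mul_le_mul (h.bd u) ((hg.2 _ _).trans ?_) (norm_nonneg _) hB
    have := hg.nonneg
    gcongr
    rw [sub_sub_cancel_left, norm_neg, norm_smul, Real.norm_of_nonneg hs]
    rw [show (2:ℝ) * √s = √(4 * s) by rw [Real.sqrt_mul (by norm_num), show (4:ℝ) = 2^2 by norm_num, Real.sqrt_sq (by norm_num)]]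
    apply Real.sqrt_le_sqrt
    nlinarith

theorem Av_theta {g : ℂ → V} (hg : Continuous g) (s : ℝ) (z : ℂ) :
    Av (fun u => fderiv ℝ kap1 u 1) s g z + Av (fun u => fderiv ℝ kap2 u I) s g z =
      Av muK (s / 4) g z - Av muK s g z := by
  obtain ⟨B1, h1⟩ := kap1_ker
  obtain ⟨B2, h2⟩ := kap2_ker
  obtain ⟨B3, h3⟩ := muK_ker
  obtain ⟨B1', _, h1'⟩ := h1.deriv
  obtain ⟨B2', _, h2'⟩ := h2.deriv
  have e := Measure.integral_comp_smul (volume : Measure ℂ) (fun v => muK v • g (z - (s/4) • v)) 4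
  have e2 : Av muK (s / 4) g z = ∫ u, (16 * muK ((4:ℝ) • u)) • g (z - s • u) := by
    have : ∀ u : ℂ, (s/4) • (4:ℝ) • u = s • u := fun u => by rw [smul_smul]; congr 1; ring
    simp_rw [mul_smul]
    rw [integral_smul]
    simp only [this] at e
    rw [e, smul_smul, finrank_real_complex,
      show (16:ℝ) * |((4:ℝ) ^ 2)⁻¹| = 1 by norm_num, one_smul]
    rfl
  have hinteg : Integrable (fun u => (16 * muK ((4:ℝ) • u)) • g (z - s • u)) := by
    have hi : Integrable (fun u => (fderiv ℝ kap1 u 1) • g (z - s • u) + (fderiv ℝ kap2 u I) • g (z - s • u) + muK u • g (z - s • u)) :=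
      ((ker_integrable (h1' 1) hg z).add (ker_integrable (h2' I) hg z)).add (ker_integrable h3 hg z)
    refine hi.congr (ae_of_all _ fun u => ?_)
    simp only [← add_smul, kap_div]; congr 1; ring
  rw [e2]
  unfold Av
  rw [← integral_add (ker_integrable (h1' 1) hg z) (ker_integrable (h2' I) hg z),
    ← integral_sub hinteg (ker_integrable h3 hg z)]
  congr 1; ext u
  rw [← add_smul, ← sub_smul, kap_div]

theorem sc_succ (j : ℕ) : sc (j+1) = sc j / 4 := by unfold sc; rw [pow_succ]; ring

theorem TT_div {g : ℂ → V} {M : ℝ} (hg : HB g M) (z : ℂ) :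
    fderiv ℝ (TT kap1 g) z 1 + fderiv ℝ (TT kap2 g) z I = cmu • g z - Av muK 1 g z := by
  obtain ⟨B1, h1⟩ := kap1_ker
  obtain ⟨B2, h2⟩ := kap2_ker
  obtain ⟨B3, h3⟩ := muK_ker
  obtain ⟨C1, hC1, H1⟩ := TT_main V h1
  obtain ⟨C2, hC2, H2⟩ := TT_main V h2
  have a1 := ((H1 g M hg).2.1 z 1).add ((H2 g M hg).2.1 z I)
  simp only [Av_theta hg.continuous, ← sc_succ] at a1
  have a2 := a1.tendsto_sum_nat
  simp only [Finset.sum_range_sub (fun j => Av muK (sc j) g z)] at a2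
  have a3 : Tendsto (fun n => Av muK (sc n) g z - Av muK (sc 0) g z) atTop (𝓝 (cmu • g z - Av muK (sc 0) g z)) := by
    apply Tendsto.sub_const
    rw [tendsto_iff_norm_sub_tendsto_zero]
    have hb : Tendsto (fun n : ℕ => B3 * (M * (2 * (2:ℝ)⁻¹ ^ n)) * c0) atTop (𝓝 (B3 * (M * (2 * 0)) * c0)) := by
      have := tendsto_pow_atTop_nhds_zero_of_lt_one (r := (2:ℝ)⁻¹) (by norm_num) (by norm_num)
      exact (((this.const_mul _).const_mul _).const_mul _).mul_const _
    rw [mul_zero, mul_zero, mul_zero, zero_mul] at hb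
    refine squeeze_zero (fun _ => norm_nonneg _) (fun n => ?_) hb
    rw [← sqrt_sc]
    exact Av_approx h3 hg (sc_pos n).le z
  have := tendsto_nhds_unique a2 a3
  simpa [sc] using this

theorem TT_curl {g : ℂ → V} {M : ℝ} (hg : HB g M) (z : ℂ) :
    fderiv ℝ (TT kap1 g) z I = fderiv ℝ (TT kap2 g) z 1 := by
  obtain ⟨B1, h1⟩ := kap1_ker
  obtain ⟨B2, h2⟩ := kap2_ker
  obtain ⟨C1, hC1, H1⟩ := TT_main V h1
  obtain ⟨C2, hC2, H2⟩ := TT_main V h2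
  have a1 := (H1 g M hg).2.1 z I
  have a2 := (H2 g M hg).2.1 z 1
  simp only [kap_curl] at a1
  exact a1.unique a2

theorem Av_mu_zero {g : ℂ → V} (hg : ∀ z, 1/4 < ‖z‖ → g z = 0) {z : ℂ} (hz : ‖z‖ ≤ 1/4) :
    Av muK 1 g z = 0 := by
  unfold Av
  have : ∀ u, muK u • g (z - (1:ℝ) • u) = 0 := by
    intro u
    rcases lt_or_ge (nsq u) 1 with h | h
    · rw [muK, deriv_eta_zero' h]; simp
    · rw [hg, smul_zero]
      rw [nsq_eq] at h
      have : 1 ≤ ‖u‖ := by nlinarith [norm_nonneg u]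
      have := norm_sub_norm_le u z
      rw [one_smul, norm_sub_rev]
      linarith
  simp only [this, integral_zero]

/-- Cauchy operator -/
noncomputable def TC (J0 : V →L[ℝ] V) (g : ℂ → V) (z : ℂ) : V :=
  cmu⁻¹ • (TT kap1 g z - J0 (TT kap2 g z))

variable (V) in
theorem TC_main (L : ℝ) (hL : 0 ≤ L) : ∃ C, 0 ≤ C ∧ ∀ J0 : V →L[ℝ] V, ‖J0‖ ≤ L → (∀ v, J0 (J0 v) = -v) →
    (∀ (g g' : ℂ → V) (M M' : ℝ), HB g M → HB g' M' → ∀ z, TC J0 (fun z => g z - g' z) z = TC J0 g z - TC J0 g' z) ∧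
    ∀ (g : ℂ → V) (M : ℝ), HB g M →
    (∀ z, DifferentiableAt ℝ (TC J0 g) z) ∧ (∀ z, ‖TC J0 g z‖ ≤ C * M) ∧ HB (fderiv ℝ (TC J0 g)) (C * M) ∧
    ((∀ z, 1/4 < ‖z‖ → g z = 0) → ∀ z, ‖z‖ ≤ 1/4 →
      fderiv ℝ (TC J0 g) z 1 + J0 (fderiv ℝ (TC J0 g) z I) = g z) := by
  obtain ⟨B1, h1⟩ := kap1_ker
  obtain ⟨B2, h2⟩ := kap2_ker
  obtain ⟨C1, hC1, H1⟩ := TT_main V h1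
  obtain ⟨C2, hC2, H2⟩ := TT_main V h2
  have hc := cmu_pos
  refine ⟨cmu⁻¹ * (C1 + L * C2), by positivity, fun J0 hJ hJJ => ⟨fun g g' M M' hg hg' z => ?_, fun g M hg => ?_⟩⟩
  · unfold TC
    rw [TT_sub h1 hg hg', TT_sub h2 hg hg', ← smul_sub, map_sub]
    congr 1; abel
  obtain ⟨d1, -, b1, hb1⟩ := H1 g M hg
  obtain ⟨d2, -, b2, hb2⟩ := H2 g M hg
  have hM := hg.nonneg
  have hd : ∀ z, HasFDerivAt (TC J0 g) (cmu⁻¹ • (fderiv ℝ (TT kap1 g) z - J0.comp (fderiv ℝ (TT kap2 g) z))) z :=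
    fun z => ((d1 z).hasFDerivAt.sub (J0.hasFDerivAt.comp z (d2 z).hasFDerivAt)).const_smul _
  have hcn : ‖cmu⁻¹‖ = cmu⁻¹ := Real.norm_of_nonneg (by positivity)
  refine ⟨fun z => (hd z).differentiableAt, fun z => ?_, ⟨fun z => ?_, fun z z' => ?_⟩, fun hs z hz => ?_⟩
  · rw [TC, norm_smul, hcn, mul_assoc]
    gcongr
    calc _ ≤ ‖TT kap1 g z‖ + ‖J0 (TT kap2 g z)‖ := norm_sub_le _ _
      _ ≤ C1 * M + L * (C2 * M) := by
        gcongr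
        · exact b1 z
        · exact (J0.le_opNorm _).trans (mul_le_mul hJ (b2 z) (norm_nonneg _) hL)
      _ = _ := by ring
  · rw [(hd z).fderiv, norm_smul, hcn, mul_assoc]
    gcongr
    calc _ ≤ ‖fderiv ℝ (TT kap1 g) z‖ + ‖J0.comp (fderiv ℝ (TT kap2 g) z)‖ := norm_sub_le _ _
      _ ≤ C1 * M + L * (C2 * M) := by
        gcongr
        · exact hb1.1 z
        · exact (J0.opNorm_comp_le _).trans (mul_le_mul hJ (hb2.1 z) (norm_nonneg _) hL)
      _ = _ := by ring
  · rw [(hd z).fderiv, (hd z').fderiv, ← smul_sub, norm_smul, hcn, mul_assoc, mul_assoc]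
    gcongr
    calc _ = ‖(fderiv ℝ (TT kap1 g) z - fderiv ℝ (TT kap1 g) z') - J0.comp (fderiv ℝ (TT kap2 g) z - fderiv ℝ (TT kap2 g) z')‖ := by
          rw [ContinuousLinearMap.comp_sub]; congr 1; abel
      _ ≤ _ := norm_sub_le _ _
      _ ≤ C1 * M * √‖z - z'‖ + L * (C2 * M * √‖z - z'‖) := by
        gcongr
        · exact hb1.2 z z'
        · exact (J0.opNorm_comp_le _).trans (mul_le_mul hJ (hb2.2 z z') (norm_nonneg _) hL)
      _ = _ := by ring
  · rw [(hd z).fderiv]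
    simp only [ContinuousLinearMap.smul_apply, ContinuousLinearMap.sub_apply, ContinuousLinearMap.comp_apply, map_smul, map_sub, hJJ]
    have e1 := TT_div hg z
    rw [Av_mu_zero hs hz, sub_zero] at e1
    rw [← smul_add, TT_curl hg z]
    have : fderiv ℝ (TT kap1 g) z 1 - J0 (fderiv ℝ (TT kap2 g) z 1) + (J0 (fderiv ℝ (TT kap2 g) z 1) - -fderiv ℝ (TT kap2 g) z I) = cmu • g z := by
      rw [← e1]; abel
    rw [this, smul_smul, inv_mul_cancel₀ hc.ne', one_smul]

end P1c
end RS

namespace RS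

section P2
variable {V : Type*} [NormedAddCommGroup V] [NormedSpace ℝ V] [CompleteSpace V]
variable {X : Type*} [NormedAddCommGroup X] [NormedSpace ℝ X]
variable {Y : Type*} [NormedAddCommGroup Y] [NormedSpace ℝ Y]

theorem HB.mono {g : ℂ → X} {M M' : ℝ} (h : HB g M) (hM : M ≤ M') : HB g M' :=
  ⟨fun z => (h.1 z).trans hM, fun z z' => (h.2 z z').trans (by gcongr)⟩

theorem HB.add {g g' : ℂ → X} {M M' : ℝ} (h : HB g M) (h' : HB g' M') : HB (fun z => g z + g' z) (M + M') := by
  refine ⟨fun z => (norm_add_le _ _).trans (add_le_add (h.1 z) (h'.1 z)), fun z z' => ?_⟩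
  rw [add_sub_add_comm, add_mul]
  exact (norm_add_le _ _).trans (add_le_add (h.2 z z') (h'.2 z z'))

theorem HB.app {Q : ℂ → X →L[ℝ] Y} {v : ℂ → X} {M M' : ℝ} (h : HB Q M) (h' : HB v M') :
    HB (fun z => Q z (v z)) (2 * M * M') := by
  have := h.nonneg
  have := h'.nonneg
  refine ⟨fun z => ?_, fun z z' => ?_⟩
  · refine ((Q z).le_opNorm _).trans ?_
    have := mul_le_mul (h.1 z) (h'.1 z) (norm_nonneg _) h.nonneg
    nlinarith [mul_nonneg h.nonneg h'.nonneg]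
  · have e : Q z (v z) - Q z' (v z') = Q z (v z - v z') + (Q z - Q z') (v z') := by simp
    rw [e]
    calc _ ≤ ‖Q z (v z - v z')‖ + ‖(Q z - Q z') (v z')‖ := norm_add_le _ _
      _ ≤ M * (M' * √‖z - z'‖) + (M * √‖z - z'‖) * M' := by
        gcongr
        · exact ((Q z).le_opNorm _).trans (mul_le_mul (h.1 z) (h'.2 z z') (norm_nonneg _) h.nonneg)
        · exact ((Q z - Q z').le_opNorm _).trans (mul_le_mul (h.2 z z') (h'.1 z') (norm_nonneg _) (by positivity))
      _ = _ := by ring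

theorem HB.smul {q : ℂ → ℝ} {v : ℂ → X} {M M' : ℝ} (h : HB q M) (h' : HB v M') :
    HB (fun z => q z • v z) (2 * M * M') := by
  have := h.nonneg
  have := h'.nonneg
  refine ⟨fun z => ?_, fun z z' => ?_⟩
  · rw [norm_smul]
    have := mul_le_mul (h.1 z) (h'.1 z) (norm_nonneg _) h.nonneg
    nlinarith [mul_nonneg h.nonneg h'.nonneg]
  · have e : q z • (v z) - q z' • (v z') = q z • (v z - v z') + (q z - q z') • (v z') := by
      rw [smul_sub, sub_smul]; abel
    rw [e]
    calc _ ≤ ‖q z • (v z - v z')‖ + ‖(q z - q z') • (v z')‖ := norm_add_le _ _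
      _ ≤ M * (M' * √‖z - z'‖) + (M * √‖z - z'‖) * M' := by
        rw [norm_smul, norm_smul]
        gcongr
        · exact (h.1 z)
        · exact (h'.2 z z')
        · exact (h.2 z z')
        · exact (h'.1 z')
      _ = _ := by ring

theorem HB_of_lip {f : ℂ → X} {S S' : ℝ} (h1 : ∀ z, ‖f z‖ ≤ S) (h2 : ∀ z z', ‖f z - f z'‖ ≤ S' * ‖z - z'‖) (hS' : 0 ≤ S') :
    HB f (2 * S + S') := by
  have hS : 0 ≤ S := (norm_nonneg _).trans (h1 0)
  refine ⟨fun z => (h1 z).trans (by linarith), fun z z' => ?_⟩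
  rcases le_total ‖z - z'‖ 1 with h | h
  · have e : ‖z - z'‖ ≤ √‖z - z'‖ := by
      apply Real.le_sqrt_of_sq_le
      nlinarith [norm_nonneg (z - z')]
    calc _ ≤ S' * ‖z - z'‖ := h2 z z'
      _ ≤ S' * √‖z - z'‖ := by gcongr
      _ ≤ _ := by gcongr; linarith
  · have e : 1 ≤ √‖z - z'‖ := Real.one_le_sqrt.2 h
    calc _ ≤ ‖f z‖ + ‖f z'‖ := norm_sub_le _ _
      _ ≤ (2 * S + S') * 1 := by linarith [h1 z, h1 z']
      _ ≤ _ := by gcongr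

theorem lip_of_fderiv {f : ℂ → X} {K : ℝ} (h1 : ∀ z, DifferentiableAt ℝ f z) (h2 : ∀ z, ‖fderiv ℝ f z‖ ≤ K) (z z' : ℂ) :
    ‖f z - f z'‖ ≤ K * ‖z - z'‖ :=
  Convex.norm_image_sub_le_of_norm_fderiv_le (s := univ) (fun x _ => h1 x) (fun x _ => h2 x) convex_univ (mem_univ z') (mem_univ z)

theorem HB_fixed {M : ℝ} (hM : 0 ≤ M) (Φ : (ℂ → V) → (ℂ → V)) (h1 : ∀ g, HB g M → HB (Φ g) M)
    (h2 : ∀ g g' δ, HB g M → HB g' M → HB (fun z => g z - g' z) δ → HB (fun z => Φ g z - Φ g' z) (δ / 2)) :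
    ∃ g, HB g M ∧ Φ g = g := by
  set G : ℕ → ℂ → V := fun n => Φ^[n] (fun _ => 0) with hG
  have hs : ∀ n, G (n+1) = Φ (G n) := fun n => by simp [hG, Function.iterate_succ_apply']
  have hb : ∀ n, HB (G n) M := by
    intro n
    induction n with
    | zero => exact ⟨fun z => by simpa [hG] using hM, fun z z' => by simp [hG]; positivity⟩
    | succ n ih => rw [hs]; exact h1 _ ih
  have hd : ∀ n, HB (fun z => G (n+1) z - G n z) (M / 2 ^ n) := by
    intro n
    induction n with
    | zero => simpa [hG] using h1 _ (hb 0)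
    | succ n ih =>
      have := h2 _ _ _ (hb (n+1)) (hb n) ih
      rw [← hs, ← hs] at this
      rw [pow_succ, ← div_div]; exact this
  have hd1 : ∀ z n, dist (G n z) (G (n+1) z) ≤ (2 * M) / 2 / 2 ^ n := fun z n => by
    rw [dist_eq_norm, norm_sub_rev, mul_div_cancel_left₀ _ (two_ne_zero)]
    exact (hd n).1 z
  have hlim : ∀ z, ∃ l, Tendsto (fun n => G n z) atTop (𝓝 l) := fun z =>
    cauchySeq_tendsto_of_complete (cauchySeq_of_le_geometric_two (hd1 z))
  choose g hg using hlim
  have hgM : HB g M := by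
    refine ⟨fun z => ?_, fun z z' => ?_⟩
    · exact le_of_tendsto (hg z).norm (Eventually.of_forall fun n => (hb n).1 z)
    · exact le_of_tendsto ((hg z).sub (hg z')).norm (Eventually.of_forall fun n => (hb n).2 z z')
  have hgn : ∀ n, HB (fun z => g z - G n z) (2 * M / 2 ^ n) := by
    intro n
    refine ⟨fun z => ?_, fun z z' => ?_⟩
    · have := dist_le_of_le_geometric_two_of_tendsto (hd1 z) (hg z) n
      rwa [dist_eq_norm, norm_sub_rev] at this
    · have hd2 : ∀ n, dist (G n z - G n z') (G (n+1) z - G (n+1) z') ≤ (2 * M * √‖z - z'‖) / 2 / 2 ^ n := fun n => by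
        have := (hd n).2 z z'
        beta_reduce at this
        rw [dist_eq_norm, norm_sub_rev, show (2 * M * √‖z - z'‖) / 2 / 2 ^ n = M / 2 ^ n * √‖z - z'‖ by ring]
        rw [sub_sub_sub_comm]; exact this
      have := dist_le_of_le_geometric_two_of_tendsto hd2 ((hg z).sub (hg z')) n
      rw [dist_eq_norm, norm_sub_rev] at this
      rw [show 2 * M / 2 ^ n * √‖z - z'‖ = 2 * M * √‖z - z'‖ / 2 ^ n by ring]
      rw [sub_sub_sub_comm]; exact this
  refine ⟨g, hgM, ?_⟩
  ext z
  have t1 : Tendsto (fun n => Φ g z - G (n+1) z) atTop (𝓝 (Φ g z - g z)) :=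
    tendsto_const_nhds.sub ((tendsto_add_atTop_iff_nat 1).2 (hg z))
  have t2 : Tendsto (fun n => Φ g z - G (n+1) z) atTop (𝓝 0) := by
    rw [tendsto_zero_iff_norm_tendsto_zero]
    have t3 : Tendsto (fun n : ℕ => 2 * M / 2 ^ n / 2) atTop (𝓝 (0/2)) := by
      apply Filter.Tendsto.div_const
      have := (tendsto_pow_atTop_nhds_zero_of_lt_one (r := (2:ℝ)⁻¹) (by norm_num) (by norm_num)).const_mul (2 * M)
      simpa [div_eq_mul_inv] using this
    rw [zero_div] at t3
    refine squeeze_zero (fun _ => norm_nonneg _) (fun n => ?_) t3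
    have := (h2 g (G n) _ hgM (hb n) (hgn n)).1 z
    rw [hs]; exact this
  exact sub_eq_zero.1 (tendsto_nhds_unique t1 t2)

/-- globally nice field of endomorphisms -/
structure NiceJ (A : V → V →L[ℝ] V) (L : ℝ) : Prop where
  diff : ∀ x, DifferentiableAt ℝ A x
  bd : ∀ x, ‖A x‖ ≤ L
  bd1 : ∀ x, ‖fderiv ℝ A x‖ ≤ L
  lip1 : ∀ x y, ‖fderiv ℝ A x - fderiv ℝ A y‖ ≤ L * ‖x - y‖

theorem NiceJ.lip {A : V → V →L[ℝ] V} {L : ℝ} (h : NiceJ A L) (x y : V) : ‖A x - A y‖ ≤ L * ‖x - y‖ :=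
  Convex.norm_image_sub_le_of_norm_fderiv_le (s := univ) (fun x _ => h.diff x) (fun x _ => h.bd1 x) convex_univ (mem_univ y) (mem_univ x)

theorem NiceJ.nonneg {A : V → V →L[ℝ] V} {L : ℝ} (h : NiceJ A L) : 0 ≤ L := (norm_nonneg _).trans (h.bd 0)

theorem NiceJ.second {A : V → V →L[ℝ] V} {L : ℝ} (hA : NiceJ A L) (p q p' q' : V) :
    ‖(A p - A q) - (A p' - A q')‖ ≤ L * ‖(p - q) - (p' - q')‖ + L * ‖p - q‖ * ‖q - q'‖ := by
  set h := p - q with hh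
  set h' := p' - q' with hh'
  have e1 : p = q + h := by rw [hh]; abel
  have e2 : p' = q' + h' := by rw [hh']; abel
  have hdiff : ∀ x, HasFDerivAt (fun x => A (x + h) - A x) (fderiv ℝ A (x + h) - fderiv ℝ A x) x := fun x => by
    have := (hA.diff (x + h)).hasFDerivAt.comp x ((hasFDerivAt_id x).add_const h)
    exact this.sub (hA.diff x).hasFDerivAt
  have hb : ∀ x, ‖fderiv ℝ A (x + h) - fderiv ℝ A x‖ ≤ L * ‖h‖ := fun x => by
    have := hA.lip1 (x + h) x
    rwa [add_sub_cancel_left] at this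
  have m1 : ‖(A (q + h) - A q) - (A (q' + h) - A q')‖ ≤ L * ‖h‖ * ‖q - q'‖ :=
    Convex.norm_image_sub_le_of_norm_hasFDerivWithin_le (s := univ) (fun x _ => (hdiff x).hasFDerivWithinAt) (fun x _ => hb x) convex_univ (mem_univ q') (mem_univ q)
  have m2 : ‖A (q' + h) - A (q' + h')‖ ≤ L * ‖h - h'‖ := by
    have := hA.lip (q' + h) (q' + h')
    rwa [add_sub_add_left_eq_sub] at this
  rw [e1, e2]
  have e3 : A (q + h) - A q - (A (q' + h') - A q') = (A (q + h) - A q - (A (q' + h) - A q')) + (A (q' + h) - A (q' + h')) := by abel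
  rw [e3]
  exact (norm_add_le _ _).trans (by linarith)

end P2
end RS

namespace RS

section P2b
variable {V : Type*} [NormedAddCommGroup V] [NormedSpace ℝ V] [CompleteSpace V]

theorem smooth_HB {q : ℂ → ℝ} (h1 : ContDiff ℝ (⊤ : ℕ∞) q) (h2 : HasCompactSupport q) :
    ∃ S, 0 ≤ S ∧ (∀ z, ‖q z‖ ≤ S) ∧ HB q S ∧ HB (fderiv ℝ q) S := by
  obtain ⟨B0, hB0⟩ := h1.continuous.bounded_above_of_compact_support h2
  obtain ⟨B1, hB1⟩ := fderiv_bdd h2 h1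
  have h3 : ContDiff ℝ (⊤ : ℕ∞) (fderiv ℝ q) := h1.fderiv_right (m := (⊤ : ℕ∞)) (by simp)
  have h4 : HasCompactSupport (fderiv ℝ q) := h2.fderiv ℝ
  obtain ⟨B2, hB2⟩ := fderiv_bdd h4 h3
  have p0 : 0 ≤ B0 := (norm_nonneg _).trans (hB0 0)
  have p1 : 0 ≤ B1 := (norm_nonneg _).trans (hB1 0)
  have p2 : 0 ≤ B2 := (norm_nonneg _).trans (hB2 0)
  have a1 : HB q (2 * B0 + B1) := HB_of_lip hB0 (lip_of_fderiv (fun z => h1.differentiable (by simp) z) hB1) p1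
  have a2 : HB (fderiv ℝ q) (2 * B1 + B2) := HB_of_lip hB1 (lip_of_fderiv (fun z => h3.differentiable (by simp) z) hB2) p2
  refine ⟨2 * B0 + 3 * B1 + B2, by positivity, fun z => (hB0 z).trans (by linarith), a1.mono (by linarith), a2.mono (by linarith)⟩

theorem exists_chi : ∃ χ : ℂ → ℝ, ∃ X, 0 ≤ X ∧ HB χ X ∧ (∀ z, ‖z‖ ≤ 1/8 → χ z = 1) ∧ ∀ z, 1/4 < ‖z‖ → χ z = 0 := by
  let f : ContDiffBump (0:ℂ) := ⟨1/8, 1/4, by norm_num, by norm_num⟩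
  obtain ⟨S, hS, -, h, -⟩ := smooth_HB (q := f) f.contDiff f.hasCompactSupport
  refine ⟨f, S, hS, h, fun z hz => f.one_of_mem_closedBall (by simpa [f] using hz), fun z hz => f.zero_of_le_dist (by simpa [f] using hz.le)⟩

theorem exists_cut (φ : ℂ →L[ℝ] ℝ) : ∃ a : ℂ → ℝ, ∃ S, 0 ≤ S ∧ (∀ z, DifferentiableAt ℝ a z) ∧ (∀ z, ‖a z‖ ≤ S) ∧
    HB (fderiv ℝ a) S ∧ ∀ z, ‖z‖ < 1/4 → a z = φ z ∧ fderiv ℝ a z = φ := by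
  let f : ContDiffBump (0:ℂ) := ⟨1/4, 1/2, by norm_num, by norm_num⟩
  have hsm : ContDiff ℝ (⊤ : ℕ∞) (fun z => f z * φ z) := f.contDiff.mul φ.contDiff
  obtain ⟨S, hS, h1, -, h2⟩ := smooth_HB hsm f.hasCompactSupport.mul_right
  refine ⟨fun z => f z * φ z, S, hS, fun z => hsm.differentiable (by simp) z, h1, h2, fun z hz => ?_⟩
  have ev : (fun z => f z * φ z) =ᶠ[𝓝 z] φ := by
    filter_upwards [(isOpen_lt continuous_norm continuous_const).mem_nhds hz] with v hv
    have hv' : ‖v‖ < 1/4 := hv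
    rw [f.one_of_mem_closedBall (by simpa [f] using hv'.le), one_mul]
  exact ⟨ev.self_of_nhds, by rw [ev.fderiv_eq]; exact φ.fderiv⟩

theorem HB_I (p : ℂ → ℂ →L[ℝ] V) (N : ℝ) (hp : HB p N) : HB (fun z => p z I) N := by
  refine ⟨fun z => ?_, fun z z' => ?_⟩
  · have := (p z).le_opNorm I
    rw [Complex.norm_I, mul_one] at this
    exact this.trans (hp.1 z)
  · have := (p z - p z').le_opNorm I
    rw [Complex.norm_I, mul_one] at this
    exact this.trans (hp.2 z z')

theorem HB_sr (p : ℂ → ℂ →L[ℝ] ℝ) (S : ℝ) (v : V) (r : ℝ) (hp : HB p S) (hv : ‖v‖ ≤ r) (hr : 0 ≤ r) :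
    HB (fun z => (p z).smulRight v) (S * r) := by
  have := hp.nonneg
  refine ⟨fun z => ?_, fun z z' => ?_⟩
  · rw [ContinuousLinearMap.norm_smulRight_apply]
    exact mul_le_mul (hp.1 z) hv (norm_nonneg _) hp.nonneg
  · have : (p z).smulRight v - (p z').smulRight v = (p z - p z').smulRight v := by ext; simp [sub_smul]
    rw [this, ContinuousLinearMap.norm_smulRight_apply, mul_right_comm]
    exact mul_le_mul (hp.2 z z') hv (norm_nonneg _) (by positivity)

set_option maxHeartbeats 4000000 in
theorem disc_exists {A : V → V →L[ℝ] V} {L : ℝ} (hA : NiceJ A L) (w : V) {ε : ℝ} (hε : 0 < ε) :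
    ∃ r0 > 0, ∀ y, (∀ v, A y (A y v) = -v) → ∃ k : ℂ → V, k 0 = y ∧
      (∀ τ, ‖τ‖ < r0 → DifferentiableAt ℝ k τ ∧ fderiv ℝ k τ 1 + A (k τ) (fderiv ℝ k τ I) = 0) ∧
      ∀ τ τ', ‖τ‖ < r0 → ‖τ'‖ < r0 →
        ‖k τ - k τ' - ((τ - τ').re • w + (τ - τ').im • A y w)‖ ≤ ε * ‖τ - τ'‖ := by
  obtain ⟨χ, X, hX, hχ, hχ1, hχ0⟩ := exists_chi
  obtain ⟨a, Sa, hSa, ha1, ha2, ha3, ha4⟩ := exists_cut Complex.reCLM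
  obtain ⟨b, Sb, hSb, hb1, hb2, hb3, hb4⟩ := exists_cut Complex.imCLM
  obtain ⟨C, hC, HT⟩ := TC_main V L hA.nonneg
  have hL := hA.nonneg
  set S := (Sa + Sb * L) * ‖w‖ with hSdef
  have hS : 0 ≤ S := by positivity
  set K := S + 2 * C with hK
  have hK0 : 0 ≤ K := by positivity
  -- constants
  set M := min 1 (ε / (C + 1)) with hM
  have hM0 : 0 < M := by positivity
  have hM1 : M ≤ 1 := min_le_left _ _
  have hCM : C * M ≤ ε := by
    calc C * M ≤ C * (ε / (C+1)) := by gcongr; exact min_le_right _ _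
      _ ≤ (C + 1) * (ε / (C+1)) := by gcongr; linarith
      _ = ε := by field_simp
  set Q1 := 2 * X * (2 * (3 * L * K) * K) with hQ1
  set Q2 := 2 * X * (2 * (3 * L * K) * C + 2 * (L * C * (5 + 2 * K)) * K) with hQ2
  have hQ1' : 0 ≤ Q1 := by positivity
  have hQ2' : 0 ≤ Q2 := by positivity
  set t := min 1 (min (M / (Q1 + 1)) (1 / (2 * (Q2 + 1)))) with ht
  have ht0 : 0 < t := by positivity
  have ht1 : t ≤ 1 := min_le_left _ _
  have htQ1 : Q1 * t ≤ M := by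
    calc Q1 * t ≤ (Q1 + 1) * (M / (Q1 + 1)) := by
          gcongr
          · linarith
          · exact (min_le_right _ _).trans (min_le_left _ _)
      _ = M := by field_simp
  have htQ2 : Q2 * t ≤ 1/2 := by
    calc Q2 * t ≤ (Q2 + 1) * (1 / (2 * (Q2 + 1))) := by
          gcongr
          · linarith
          · exact (min_le_right _ _).trans (min_le_right _ _)
      _ = 1/2 := by field_simp
  refine ⟨t / 8, by positivity, fun y hy => ?_⟩
  set J0 := A y with hJ0
  obtain ⟨Tsub, HT⟩ := HT J0 (hA.bd y) hy
  set ℓ : ℂ → V := fun z => a z • w + b z • J0 w with hℓ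
  have hJw : ‖J0 w‖ ≤ L * ‖w‖ := (J0.le_opNorm _).trans (by gcongr; exact hA.bd y)
  have ℓd : ∀ z, HasFDerivAt ℓ ((fderiv ℝ a z).smulRight w + (fderiv ℝ b z).smulRight (J0 w)) z := fun z =>
    ((ha1 z).hasFDerivAt.smul_const w).add ((hb1 z).hasFDerivAt.smul_const (J0 w))
  have ℓb : ∀ z, ‖ℓ z‖ ≤ S := fun z => by
    calc _ ≤ ‖a z • w‖ + ‖b z • J0 w‖ := norm_add_le _ _
      _ ≤ Sa * ‖w‖ + Sb * (L * ‖w‖) := by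
        rw [norm_smul, norm_smul]
        gcongr
        · exact ha2 z
        · exact hb2 z
      _ = S := by rw [hSdef]; ring
  have ℓb1 : HB (fderiv ℝ ℓ) S := by
    have e : fderiv ℝ ℓ = fun z => (fderiv ℝ a z).smulRight w + (fderiv ℝ b z).smulRight (J0 w) := funext fun z => (ℓd z).fderiv
    rw [e]
    have := (HB_sr _ _ w ‖w‖ ha3 le_rfl (norm_nonneg _)).add (HB_sr _ _ (J0 w) (L * ‖w‖) hb3 hJw (by positivity))
    exact this.mono (by rw [hSdef]; apply le_of_eq; ring)
  set F : (ℂ → V) → ℂ → V := fun g z => ℓ z + (TC J0 g z - TC J0 g 0) with hF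
  have Fd : ∀ g, HB g M → ∀ z, HasFDerivAt (F g) (fderiv ℝ ℓ z + fderiv ℝ (TC J0 g) z) z := fun g hg z => by
    have := ((HT g M hg).1 z).hasFDerivAt.sub_const (TC J0 g 0)
    exact (ℓd z).differentiableAt.hasFDerivAt.add this
  have Fb : ∀ g, HB g M → ∀ z, ‖F g z‖ ≤ K := fun g hg z => by
    have h0 := (HT g M hg).2.1
    have : C * M ≤ C := by nlinarith
    calc _ ≤ ‖ℓ z‖ + ‖TC J0 g z - TC J0 g 0‖ := norm_add_le _ _
      _ ≤ ‖ℓ z‖ + (‖TC J0 g z‖ + ‖TC J0 g 0‖) := by gcongr; exact norm_sub_le _ _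
      _ ≤ _ := by linarith [ℓb z, h0 z, h0 0]
  have Fb1 : ∀ g, HB g M → HB (fderiv ℝ (F g)) K := fun g hg => by
    have e : fderiv ℝ (F g) = fun z => fderiv ℝ ℓ z + fderiv ℝ (TC J0 g) z := funext fun z => (Fd g hg z).fderiv
    rw [e]
    have := ℓb1.add (HT g M hg).2.2.1
    have h' : C * M ≤ C := by nlinarith
    exact this.mono (by rw [hK]; linarith)
  have Flip : ∀ g, HB g M → ∀ z z', ‖F g z - F g z'‖ ≤ K * ‖z - z'‖ := fun g hg =>
    lip_of_fderiv (fun z => (Fd g hg z).differentiableAt) (Fb1 g hg).1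
  set Q : (ℂ → V) → ℂ → V →L[ℝ] V := fun g z => J0 - A (y + t • F g z) with hQ
  have Qb : ∀ g, HB g M → HB (Q g) (3 * L * K * t) := fun g hg => by
    have h1 : ∀ z, ‖Q g z‖ ≤ L * K * t := fun z => by
      have := hA.lip y (y + t • F g z)
      rw [sub_add_cancel_left, norm_neg, norm_smul, Real.norm_of_nonneg ht0.le] at this
      refine this.trans ?_
      rw [show L * K * t = L * (t * K) by ring]
      gcongr
      exact Fb g hg z
    have h2 : ∀ z z', ‖Q g z - Q g z'‖ ≤ L * K * t * ‖z - z'‖ := fun z z' => by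
      have := hA.lip (y + t • F g z') (y + t • F g z)
      rw [add_sub_add_left_eq_sub, ← smul_sub, norm_smul, Real.norm_of_nonneg ht0.le] at this
      have e : Q g z - Q g z' = A (y + t • F g z') - A (y + t • F g z) := by simp only [hQ]; abel
      rw [e]
      refine this.trans ?_
      rw [show L * K * t * ‖z - z'‖ = L * (t * (K * ‖z - z'‖)) by ring]
      gcongr
      rw [norm_sub_rev z z']
      exact Flip g hg z' z
    exact (HB_of_lip h1 h2 (by positivity)).mono (by apply le_of_eq; ring)
  set Φ : (ℂ → V) → ℂ → V := fun g z => χ z • Q g z (fderiv ℝ (F g) z I) with hΦ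
  have Φ1 : ∀ g, HB g M → HB (Φ g) M := fun g hg => by
    have := hχ.smul ((Qb g hg).app (HB_I _ _ (Fb1 g hg)))
    refine this.mono (le_trans (le_of_eq ?_) htQ1)
    rw [hQ1]; ring
  have Φ2 : ∀ g g' δ, HB g M → HB g' M → HB (fun z => g z - g' z) δ → HB (fun z => Φ g z - Φ g' z) (δ / 2) := by
    intro g g' δ hg hg' hδ
    have hδ0 := hδ.nonneg
    obtain ⟨D1, D2, D3, -⟩ := HT _ δ hδ
    have eT : TC J0 (fun z => g z - g' z) = fun z => TC J0 g z - TC J0 g' z := funext (Tsub g g' M M hg hg')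
    have eF : ∀ z, F g z - F g' z = TC J0 (fun z => g z - g' z) z - TC J0 (fun z => g z - g' z) 0 := fun z => by
      rw [eT]; simp only [hF]; abel
    have edF : ∀ z, fderiv ℝ (F g) z - fderiv ℝ (F g') z = fderiv ℝ (TC J0 (fun z => g z - g' z)) z := fun z => by
      rw [(Fd g hg z).fderiv, (Fd g' hg' z).fderiv, eT]
      have := ((HT g M hg).1 z).hasFDerivAt.sub ((HT g' M hg').1 z).hasFDerivAt
      have e2 := HasFDerivAt.fderiv this
      rw [show (fun z => TC J0 g z - TC J0 g' z) = TC J0 g - TC J0 g' from rfl, e2]; abel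
    have dFb : ∀ z, ‖F g' z - F g z‖ ≤ 2 * C * δ := fun z => by
      rw [norm_sub_rev, eF]
      refine (norm_sub_le _ _).trans ?_
      linarith [D2 z, D2 0]
    have dFl : ∀ z z', ‖(F g' z - F g z) - (F g' z' - F g z')‖ ≤ C * δ * ‖z - z'‖ := fun z z' => by
      have := lip_of_fderiv D1 D3.1 z z'
      rw [← norm_neg]
      have e1 := eF z
      have e2 := eF z'
      have e3 : -((F g' z - F g z) - (F g' z' - F g z')) = TC J0 (fun z => g z - g' z) z - TC J0 (fun z => g z - g' z) z' := by
        calc -((F g' z - F g z) - (F g' z' - F g z')) = (F g z - F g' z) - (F g z' - F g' z') := by abel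
          _ = _ := by rw [e1, e2]; abel
      rw [e3]; exact this
    set R : ℂ → V →L[ℝ] V := fun z => A (y + t • F g' z) - A (y + t • F g z) with hR
    have Rb : HB R (L * C * (5 + 2 * K) * t * δ) := by
      have h1 : ∀ z, ‖R z‖ ≤ L * (t * (2 * C * δ)) := fun z => by
        have := hA.lip (y + t • F g' z) (y + t • F g z)
        rw [add_sub_add_left_eq_sub, ← smul_sub, norm_smul, Real.norm_of_nonneg ht0.le] at this
        exact this.trans (by gcongr; exact dFb z)
      have h2 : ∀ z z', ‖R z - R z'‖ ≤ (L * (t * (C * δ)) + L * (t * (2 * C * δ)) * (t * K)) * ‖z - z'‖ := fun z z' => by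
        have := hA.second (y + t • F g' z) (y + t • F g z) (y + t • F g' z') (y + t • F g z')
        simp only [add_sub_add_left_eq_sub, ← smul_sub, norm_smul, Real.norm_of_nonneg ht0.le] at this
        refine this.trans ?_
        rw [add_mul]
        apply add_le_add
        · rw [mul_assoc L, mul_assoc t]
          gcongr
          exact dFl z z'
        · rw [mul_assoc _ (t * K), mul_assoc t K]
          gcongr
          · exact dFb z
          · exact Flip g hg z z'
      refine (HB_of_lip h1 h2 (by positivity)).mono ?_
      have : L * (t * (2 * C * δ)) * (t * K) ≤ L * (1 * (2 * C * δ)) * (t * K) := by gcongr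
      nlinarith
    have e : (fun z => Φ g z - Φ g' z) = fun z => χ z • (Q g z (fderiv ℝ (TC J0 (fun z => g z - g' z)) z I) + R z (fderiv ℝ (F g') z I)) := by
      ext z
      rw [← edF]
      simp only [hΦ, ← smul_sub, hQ, hR, ContinuousLinearMap.sub_apply, map_sub]
      congr 1; abel
    rw [e]
    have := hχ.smul (((Qb g hg).app (HB_I _ _ D3)).add (Rb.app (HB_I _ _ (Fb1 g' hg'))))
    refine this.mono ?_
    calc _ = (Q2 * t) * δ := by rw [hQ2]; ring
      _ ≤ (1/2) * δ := by gcongr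
      _ = δ / 2 := by ring
  obtain ⟨g, hg, hfix⟩ := HB_fixed hM0.le Φ Φ1 Φ2
  have hsupp : ∀ z, 1/4 < ‖z‖ → g z = 0 := fun z hz => by
    rw [← hfix]; simp [hΦ, hχ0 z hz]
  have hzn : ∀ τ : ℂ, ‖τ‖ < t / 8 → ‖t⁻¹ • τ‖ < 1/8 := fun τ hτ => by
    rw [norm_smul, norm_inv, Real.norm_of_nonneg ht0.le]
    rw [inv_mul_lt_iff₀ ht0]; linarith
  have kd : ∀ τ, HasFDerivAt (fun τ : ℂ => y + t • F g (t⁻¹ • τ)) (fderiv ℝ (F g) (t⁻¹ • τ)) τ := fun τ => by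
    have h2 : HasFDerivAt (fun z : ℂ => t⁻¹ • z) (t⁻¹ • ContinuousLinearMap.id ℝ ℂ) τ :=
      (t⁻¹ • ContinuousLinearMap.id ℝ ℂ).hasFDerivAt
    have h3 := (((Fd g hg (t⁻¹ • τ)).differentiableAt.hasFDerivAt.comp τ h2).const_smul t).const_add y
    refine h3.congr_fderiv ?_
    ext v
    simp [smul_smul, ht0.ne']
  refine ⟨fun τ => y + t • F g (t⁻¹ • τ), ?_, fun τ hτ => ⟨(kd τ).differentiableAt, ?_⟩, fun τ τ' hτ hτ' => ?_⟩
  · have e0 : ℓ 0 = 0 := by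
      have h1 := (ha4 0 (by simp)).1
      have h2 := (hb4 0 (by simp)).1
      simp only [hℓ, h1, h2]; simp
    simp [hF, e0]
  · rw [(kd τ).fderiv]
    set z := t⁻¹ • τ with hz
    have hz8 := hzn τ hτ
    have hz4 : ‖z‖ < 1/4 := by linarith
    have e1 := (HT g M hg).2.2.2 hsupp z hz4.le
    have e2 : g z = Q g z (fderiv ℝ (F g) z I) := by
      conv_lhs => rw [← hfix]
      simp [hΦ, hχ1 z hz8.le]
    have e3 : fderiv ℝ ℓ z 1 + J0 (fderiv ℝ ℓ z I) = 0 := by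
      rw [(ℓd z).fderiv, (ha4 z hz4).2, (hb4 z hz4).2]
      simp [hy]
    have e4 : fderiv ℝ (F g) z 1 + J0 (fderiv ℝ (F g) z I) = g z := by
      rw [(Fd g hg z).fderiv]
      simp only [ContinuousLinearMap.add_apply, map_add]
      rw [← e1]
      calc _ = (fderiv ℝ ℓ z 1 + J0 (fderiv ℝ ℓ z I)) + ((fderiv ℝ (TC J0 g) z) 1 + J0 ((fderiv ℝ (TC J0 g) z) I)) := by abel
        _ = _ := by rw [e3, zero_add]
    rw [e2] at e4
    simp only [hQ, ContinuousLinearMap.sub_apply] at e4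
    have := sub_eq_zero.2 e4
    rw [← this]; abel
  · have hz4 : ‖t⁻¹ • τ‖ < 1/4 := by linarith [hzn τ hτ]
    have hz4' : ‖t⁻¹ • τ'‖ < 1/4 := by linarith [hzn τ' hτ']
    have hl := lip_of_fderiv (HT g M hg).1 (HT g M hg).2.2.1.1 (t⁻¹ • τ) (t⁻¹ • τ')
    have e : (y + t • F g (t⁻¹ • τ)) - (y + t • F g (t⁻¹ • τ')) - ((τ - τ').re • w + (τ - τ').im • J0 w)
        = t • (TC J0 g (t⁻¹ • τ) - TC J0 g (t⁻¹ • τ')) := by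
      simp only [hF, hℓ, (ha4 _ hz4).1, (hb4 _ hz4).1, (ha4 _ hz4').1, (hb4 _ hz4').1]
      simp only [map_smul, smul_add, smul_sub, smul_smul, smul_eq_mul, reCLM_apply, imCLM_apply, sub_re, sub_im, sub_smul]
      rw [mul_inv_cancel_left₀ ht0.ne', mul_inv_cancel_left₀ ht0.ne', mul_inv_cancel_left₀ ht0.ne', mul_inv_cancel_left₀ ht0.ne']
      abel
    rw [e, norm_smul, Real.norm_of_nonneg ht0.le]
    calc _ ≤ t * (C * M * ‖t⁻¹ • τ - t⁻¹ • τ'‖) := by gcongr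
      _ = C * M * ‖τ - τ'‖ := by
        rw [← smul_sub, norm_smul, norm_inv, Real.norm_of_nonneg ht0.le]; field_simp
      _ ≤ _ := by gcongr

end P2b
end RS

namespace RS

section P2c
variable {V : Type*} [NormedAddCommGroup V] [InnerProductSpace ℝ V] [FiniteDimensional ℝ V]

theorem compact_pert {X Y : Type*} [NormedAddCommGroup X] [NormedSpace ℝ X] [NormedAddCommGroup Y] [NormedSpace ℝ Y]
    {q : X → Y} (h1 : ContDiff ℝ (⊤ : ℕ∞) q) (h2 : HasCompactSupport q) :
    ∃ S, 0 ≤ S ∧ (∀ z, ‖q z‖ ≤ S) ∧ (∀ z, ‖fderiv ℝ q z‖ ≤ S) ∧ ∀ z z', ‖fderiv ℝ q z - fderiv ℝ q z'‖ ≤ S * ‖z - z'‖ := by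
  obtain ⟨B0, hB0⟩ := h1.continuous.bounded_above_of_compact_support h2
  have h3 : ContDiff ℝ (⊤ : ℕ∞) (fderiv ℝ q) := h1.fderiv_right (m := (⊤ : ℕ∞)) (by simp)
  have h4 : HasCompactSupport (fderiv ℝ q) := h2.fderiv ℝ
  obtain ⟨B1, hB1⟩ := fderiv_bdd h2 h1
  obtain ⟨B2, hB2⟩ := fderiv_bdd h4 h3
  refine ⟨max 0 (max B0 (max B1 B2)), by simp, fun z => (hB0 z).trans (by simp), fun z => (hB1 z).trans (by simp), fun z z' => ?_⟩
  exact Convex.norm_image_sub_le_of_norm_fderiv_le (s := univ) (fun x _ => h3.differentiable (by simp) x)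
    (fun x _ => (hB2 x).trans (by simp)) convex_univ (mem_univ z') (mem_univ z)

theorem localize {Ω : Set V} (hΩ : IsOpen Ω) {J : V → V →L[ℝ] V} (hJ : ContDiffOn ℝ (⊤ : ℕ∞) J Ω) {p : V} (hp : p ∈ Ω) :
    ∃ A : V → V →L[ℝ] V, ∃ L R : ℝ, 0 < R ∧ NiceJ A L ∧ closedBall p R ⊆ Ω ∧ ∀ x ∈ ball p R, A x = J x := by
  obtain ⟨R, hR, hsub⟩ := Metric.nhds_basis_closedBall.mem_iff.1 (hΩ.mem_nhds hp)
  let b : ContDiffBump p := ⟨R/2, R, by positivity, by linarith⟩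
  set q : V → V →L[ℝ] V := fun x => b x • (J x - J p) with hq
  have hqs : HasCompactSupport q := b.hasCompactSupport.smul_right
  have hqc : ContDiff ℝ (⊤ : ℕ∞) q := by
    rw [contDiff_iff_contDiffAt]
    intro x
    by_cases hx : x ∈ Ω
    · exact b.contDiff.contDiffAt.smul ((hJ.contDiffAt (hΩ.mem_nhds hx)).sub contDiffAt_const)
    · have hx2 : x ∉ tsupport b := by rw [b.tsupport_eq]; exact fun h => hx (hsub h)
      have : q =ᶠ[𝓝 x] fun _ => 0 := by
        filter_upwards [(isClosed_tsupport b).isOpen_compl.mem_nhds hx2] with y hy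
        have : b y = 0 := image_eq_zero_of_notMem_tsupport hy
        simp [hq, this]
      exact contDiffAt_const.congr_of_eventuallyEq this
  obtain ⟨S, hS, s0, s1, s2⟩ := compact_pert hqc hqs
  have hd : ∀ x, HasFDerivAt (fun x => J p + q x) (fderiv ℝ q x) x := fun x =>
    ((hqc.differentiable (by simp) x).hasFDerivAt).const_add _
  refine ⟨fun x => J p + q x, ‖J p‖ + S, R/2, by positivity, ⟨fun x => (hd x).differentiableAt, fun x => ?_, fun x => ?_, fun x y => ?_⟩, ?_, ?_⟩
  · exact (norm_add_le _ _).trans (by linarith [s0 x])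
  · rw [(hd x).fderiv]; linarith [s1 x, norm_nonneg (J p)]
  · rw [(hd x).fderiv, (hd y).fderiv]
    exact (s2 x y).trans (by gcongr; linarith [norm_nonneg (J p)])
  · exact (closedBall_subset_closedBall (by linarith)).trans hsub
  · intro x hx
    have : b x = 1 := b.one_of_mem_closedBall (ball_subset_closedBall hx)
    simp [hq, this]

/-- k is A-holomorphic on s -/
def JH (A : V → V →L[ℝ] V) (k : ℂ → V) (s : Set ℂ) : Prop :=
  ∀ τ ∈ s, DifferentiableAt ℝ k τ ∧ fderiv ℝ k τ I = A (k τ) (fderiv ℝ k τ 1)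

/-- the torsion like vector -/
noncomputable def NN (A : V → V →L[ℝ] V) (x w : V) : V := fderiv ℝ A x (A x w) w - fderiv ℝ A x w (A x w)

theorem JH.mono {A : V → V →L[ℝ] V} {k : ℂ → V} {s t : Set ℂ} (h : JH A k s) (hst : t ⊆ s) : JH A k t :=
  fun τ hτ => h τ (hst hτ)

theorem JH.apply {A : V → V →L[ℝ] V} {k : ℂ → V} {s : Set ℂ} (h : JH A k s) {τ : ℂ} (hτ : τ ∈ s)
    (hA : ∀ v, A (k τ) (A (k τ) v) = -v) (z : ℂ) :
    A (k τ) (fderiv ℝ k τ (I * z)) = - fderiv ℝ k τ z := by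
  have e := (h τ hτ).2
  have hz : I * z = z.re • I + (-z.im) • 1 := by apply Complex.ext <;> simp
  have hz2 : z = z.re • 1 + z.im • I := by apply Complex.ext <;> simp
  rw [hz]; conv_rhs => rw [hz2]
  simp only [map_add, map_smul, e, hA]
  simp only [smul_neg, neg_smul, neg_add]

/-- existence of discs, final form -/
theorem disc_exists' {A : V → V →L[ℝ] V} {L : ℝ} (hA : NiceJ A L) {U : Set V} (hU : IsOpen U)
    (hAU : ∀ x ∈ U, ∀ v, A x (A x v) = -v) {x : V} (hx : x ∈ U) (w : V) {ε : ℝ} (hε : 0 < ε) :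
    ∃ r0 > 0, ∀ᶠ y in 𝓝 x, ∃ k : ℂ → V, k 0 = y ∧ MapsTo k (ball 0 r0) U ∧ JH A k (ball 0 r0) ∧
      ∀ τ ∈ ball (0:ℂ) r0, ∀ τ' ∈ ball (0:ℂ) r0,
        ‖k τ - k τ' - ((τ - τ').re • w + (τ - τ').im • A y w)‖ ≤ ε * ‖τ - τ'‖ := by
  obtain ⟨r0, hr0, H⟩ := disc_exists hA w hε
  obtain ⟨R, hR, hRU⟩ := Metric.isOpen_iff.1 hU x hx
  have hL := hA.nonneg
  set K := ‖w‖ + L * ‖w‖ + ε with hK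
  have hK0 : 0 < K := by positivity
  refine ⟨min r0 (R / (2 * K)), by positivity, ?_⟩
  filter_upwards [Metric.ball_mem_nhds x (show 0 < R/2 by positivity)] with y hy
  have hyU : y ∈ U := hRU (ball_subset_ball (by linarith) hy)
  obtain ⟨k, k0, k1, k2⟩ := H y (hAU y hyU)
  have hb : ∀ τ ∈ ball (0:ℂ) (min r0 (R / (2 * K))), ‖τ‖ < r0 ∧ k τ ∈ U := fun τ hτ => by
    rw [mem_ball_zero_iff, lt_min_iff] at hτ
    refine ⟨hτ.1, hRU ?_⟩
    have e := k2 τ 0 hτ.1 (by simpa using hr0)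
    rw [k0, sub_zero] at e
    have e2 : ‖τ.re • w + τ.im • A y w‖ ≤ (‖w‖ + L * ‖w‖) * ‖τ‖ := by
      refine (norm_add_le _ _).trans ?_
      rw [norm_smul, norm_smul]
      have h1 : ‖A y w‖ ≤ L * ‖w‖ := ((A y).le_opNorm _).trans (by gcongr; exact hA.bd y)
      have h2 := Complex.abs_re_le_norm τ
      have h3 := Complex.abs_im_le_norm τ
      rw [← Real.norm_eq_abs] at h2 h3
      calc _ ≤ ‖τ‖ * ‖w‖ + ‖τ‖ * (L * ‖w‖) := by gcongr
        _ = _ := by ring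
    have e3 : ‖k τ - y‖ ≤ K * ‖τ‖ := by
      calc ‖k τ - y‖ = ‖(k τ - y - (τ.re • w + τ.im • A y w)) + (τ.re • w + τ.im • A y w)‖ := by rw [sub_add_cancel]
        _ ≤ _ := norm_add_le _ _
        _ ≤ ε * ‖τ‖ + (‖w‖ + L * ‖w‖) * ‖τ‖ := add_le_add e e2
        _ = _ := by rw [hK]; ring
    have e4 : K * ‖τ‖ < R / 2 := by
      have := (lt_div_iff₀ (by positivity : 0 < 2 * K)).1 hτ.2
      linarith
    rw [mem_ball, dist_eq_norm]
    rw [mem_ball, dist_eq_norm] at hy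
    calc _ = ‖(k τ - y) + (y - x)‖ := by rw [sub_add_sub_cancel]
      _ ≤ _ := norm_add_le _ _
      _ < R := by linarith
  refine ⟨k, k0, fun τ hτ => (hb τ hτ).2, fun τ hτ => ⟨(k1 τ (hb τ hτ).1).1, ?_⟩, fun τ hτ τ' hτ' => k2 τ τ' (hb τ hτ).1 (hb τ' hτ').1⟩
  have e := (k1 τ (hb τ hτ).1).2
  have := congrArg (A (k τ)) e
  rw [map_add, hAU _ (hb τ hτ).2, map_zero] at this
  rw [← sub_eq_add_neg, sub_eq_zero] at this
  exact this.symm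

end P2c
end RS

namespace RS

section P3
variable {V : Type*} [NormedAddCommGroup V] [InnerProductSpace ℝ V] [FiniteDimensional ℝ V]

theorem NiceJ.taylor {A : V → V →L[ℝ] V} {L : ℝ} (hA : NiceJ A L) (x y : V) :
    ‖A x - A y - fderiv ℝ A y (x - y)‖ ≤ L * ‖x - y‖ ^ 2 := by
  have := (convex_closedBall y ‖x - y‖).norm_image_sub_le_of_norm_hasFDerivWithin_le' (𝕜 := ℝ) (f := A) (f' := fderiv ℝ A)
    (C := L * ‖x - y‖) (φ := fderiv ℝ A y) (x := y) (y := x) (fun z _ => (hA.diff z).hasFDerivAt.hasFDerivWithinAt)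
    (fun z hz => (hA.lip1 z y).trans (by
      have h1 : ‖z - y‖ ≤ ‖x - y‖ := by rwa [mem_closedBall, dist_eq_norm] at hz
      have := hA.nonneg
      gcongr)) (by simp) (by simp [dist_eq_norm])
  refine this.trans (le_of_eq (by ring))

theorem ii_of_bdd {X : Type*} [NormedAddCommGroup X] {h : ℝ → X} (hm : StronglyMeasurable h) {C : ℝ} (hb : ∀ θ, ‖h θ‖ ≤ C) (a b : ℝ) :
    IntervalIntegrable h volume a b :=
  (intervalIntegrable_const (c := C)).mono_fun hm.aestronglyMeasurable
    (Eventually.of_forall fun θ => (hb θ).trans (le_abs_self C))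

theorem bil_alg (B : V →L[ℝ] V →L[ℝ] V) (w w' : V) (ρ s c : ℝ) (hcs : s ^ 2 + c ^ 2 = 1) :
    B ((ρ * (-s)) • w + (ρ * c) • w') ((ρ * c) • w + (ρ * s) • w')
      + ρ ^ 2 • ((s * c) • (B w w - B w' w') - ((c ^ 2 - s ^ 2) / 2) • (B w w' + B w' w))
      = (ρ ^ 2 / 2) • (B w' w - B w w') := by
  simp only [map_add, map_smul, ContinuousLinearMap.add_apply, ContinuousLinearMap.smul_apply]
  have h1 : s ^ 2 = 1 - c ^ 2 := by linarith
  match_scalars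
  · ring_nf
  · ring_nf; rw [h1]; ring
  · ring_nf; rw [h1]; ring
  · ring_nf

theorem circ_int {A : V → V →L[ℝ] V} {L : ℝ} (hA : NiceJ A L) {f : ℂ → V} {R : ℝ}
    (hf : ∀ τ ∈ ball (0:ℂ) R, DifferentiableAt ℝ f τ)
    {Λ : ℝ} (hΛ : 0 ≤ Λ) (hlip : ∀ τ ∈ ball (0:ℂ) R, ∀ τ' ∈ ball (0:ℂ) R, ‖f τ - f τ'‖ ≤ Λ * ‖τ - τ'‖)
    {w : V} {ω : ℝ} (hω0 : 0 ≤ ω) (hω : ∀ τ ∈ ball (0:ℂ) R, ‖f τ - f 0 - (τ.re • w + τ.im • A (f 0) w)‖ ≤ ω * ‖τ‖)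
    {ρ : ℝ} (hρ : 0 < ρ) (hρR : ρ < R) :
    StronglyMeasurable (fun θ : ℝ => A (f (circleMap 0 ρ θ)) (fderiv ℝ f (circleMap 0 ρ θ) (circleMap 0 ρ θ * I))) ∧
    (∀ θ : ℝ, ‖A (f (circleMap 0 ρ θ)) (fderiv ℝ f (circleMap 0 ρ θ) (circleMap 0 ρ θ * I))‖ ≤ L * (Λ * ρ)) ∧
    ‖(∫ θ in (0:ℝ)..2 * Real.pi, A (f (circleMap 0 ρ θ)) (fderiv ℝ f (circleMap 0 ρ θ) (circleMap 0 ρ θ * I)))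
      + (Real.pi * ρ ^ 2) • NN A (f 0) w‖ ≤
      (L * Λ ^ 3 + L * Λ + L * ((1 + L) * ‖w‖)) * (ρ ^ 2 * (ω + ρ)) * (2 * Real.pi) := by
  have hL := hA.nonneg
  have hcm : ∀ θ, circleMap 0 ρ θ ∈ ball (0:ℂ) R := fun θ => by simp [abs_of_pos hρ, hρR]
  have hcn : ∀ θ, ‖circleMap 0 ρ θ‖ = ρ := fun θ => by simp [abs_of_pos hρ]
  obtain ⟨γ, hγ⟩ : ∃ γ : ℝ → V, γ = fun θ => f (circleMap 0 ρ θ) := ⟨_, rfl⟩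
  obtain ⟨γ', hγ'⟩ : ∃ γ' : ℝ → V, γ' = fun θ => fderiv ℝ f (circleMap 0 ρ θ) (circleMap 0 ρ θ * I) := ⟨_, rfl⟩
  have hd : ∀ θ, HasDerivAt γ (γ' θ) θ := fun θ => by
    rw [hγ, hγ']
    exact (hf _ (hcm θ)).hasFDerivAt.comp_hasDerivAt θ (hasDerivAt_circleMap 0 ρ θ)
  have hγc : Continuous γ := continuous_iff_continuousAt.2 fun θ => (hd θ).continuousAt
  have hγm : StronglyMeasurable γ' := by
    have : γ' = deriv γ := funext fun θ => (hd θ).deriv.symm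
    rw [this]; exact stronglyMeasurable_deriv γ
  have hfn : ∀ τ ∈ ball (0:ℂ) R, ‖fderiv ℝ f τ‖ ≤ Λ := fun τ hτ =>
    norm_fderiv_le_of_lip' ℝ hΛ (by
      filter_upwards [isOpen_ball.mem_nhds hτ] with x hx using hlip x hx τ hτ)
  have hγb : ∀ θ, ‖γ' θ‖ ≤ Λ * ρ := fun θ => by
    rw [hγ']
    refine ((fderiv ℝ f _).le_opNorm _).trans ?_
    rw [norm_mul, hcn, norm_I, mul_one]
    gcongr
    exact hfn _ (hcm θ)
  have hAc : Continuous A := continuous_iff_continuousAt.2 fun x => (hA.diff x).continuousAt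
  have hm : StronglyMeasurable (fun θ => A (γ θ) (γ' θ)) :=
    (isBoundedBilinearMap_apply (𝕜 := ℝ) (E := V) (F := V)).continuous.comp_stronglyMeasurable
      ((hAc.comp hγc).stronglyMeasurable.prodMk hγm)
  have hb : ∀ θ, ‖A (γ θ) (γ' θ)‖ ≤ L * (Λ * ρ) := fun θ =>
    ((A (γ θ)).le_opNorm _).trans (mul_le_mul (hA.bd _) (hγb θ) (norm_nonneg _) hL)
  have key : ‖(∫ θ in (0:ℝ)..2 * Real.pi, A (γ θ) (γ' θ)) + (Real.pi * ρ ^ 2) • NN A (f 0) w‖ ≤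
      (L * Λ ^ 3 + L * Λ + L * ((1 + L) * ‖w‖)) * (ρ ^ 2 * (ω + ρ)) * (2 * Real.pi) := by
    obtain ⟨B, hB⟩ : ∃ B : V →L[ℝ] V →L[ℝ] V, B = fderiv ℝ A (f 0) := ⟨_, rfl⟩
    obtain ⟨w', hw'⟩ : ∃ w' : V, w' = A (f 0) w := ⟨_, rfl⟩
    have hwb : ‖w'‖ ≤ L * ‖w‖ := by rw [hw']; exact ((A (f 0)).le_opNorm _).trans (by gcongr; exact hA.bd _)
    have hBb : ‖B‖ ≤ L := by rw [hB]; exact hA.bd1 _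
    have hN : NN A (f 0) w = B w' w - B w w' := by rw [NN, hB, hw']
    obtain ⟨l, hl⟩ : ∃ l : ℝ → V, l = fun θ => (ρ * Real.cos θ) • w + (ρ * Real.sin θ) • w' := ⟨_, rfl⟩
    obtain ⟨l', hl'⟩ : ∃ l' : ℝ → V, l' = fun θ => (ρ * (-Real.sin θ)) • w + (ρ * Real.cos θ) • w' := ⟨_, rfl⟩
    have hld : ∀ θ, HasDerivAt l (l' θ) θ := fun θ => by
      rw [hl, hl']
      exact (((Real.hasDerivAt_cos θ).const_mul ρ).smul_const w).add (((Real.hasDerivAt_sin θ).const_mul ρ).smul_const w')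
    have hre : ∀ θ, (circleMap 0 ρ θ).re = ρ * Real.cos θ := fun θ => by
      simp [circleMap, Complex.exp_re]
    have him : ∀ θ, (circleMap 0 ρ θ).im = ρ * Real.sin θ := fun θ => by
      simp [circleMap, Complex.exp_im]
    have he : ∀ θ, ‖γ θ - f 0 - l θ‖ ≤ ω * ρ := fun θ => by
      have := hω _ (hcm θ)
      rw [hre, him, hcn, ← hw'] at this
      rw [hγ, hl]; exact this
    have hl'b : ∀ θ, ‖l' θ‖ ≤ ρ * ((1 + L) * ‖w‖) := fun θ => by
      rw [hl']
      refine (norm_add_le _ _).trans ?_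
      rw [norm_smul, norm_smul, norm_mul, norm_mul, Real.norm_of_nonneg hρ.le, norm_neg, Real.norm_eq_abs, Real.norm_eq_abs]
      have h1 := Real.abs_sin_le_one θ
      have h2 := Real.abs_cos_le_one θ
      calc _ ≤ ρ * 1 * ‖w‖ + ρ * 1 * (L * ‖w‖) := by gcongr
        _ = _ := by ring
    obtain ⟨H, hH⟩ : ∃ H : ℝ → V, H = fun θ => A (f 0) (γ θ) + B (l θ) (γ θ - f 0) +
      ρ ^ 2 • ((Real.sin θ ^ 2 / 2) • (B w w - B w' w') - (Real.sin θ * Real.cos θ / 2) • (B w w' + B w' w)) := ⟨_, rfl⟩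
    obtain ⟨H', hH'⟩ : ∃ H' : ℝ → V, H' = fun θ => A (f 0) (γ' θ) + (B (l θ) (γ' θ) + B (l' θ) (γ θ - f 0)) +
      ρ ^ 2 • ((Real.sin θ * Real.cos θ) • (B w w - B w' w') - ((Real.cos θ ^ 2 - Real.sin θ ^ 2) / 2) • (B w w' + B w' w)) := ⟨_, rfl⟩
    have hHd : ∀ θ, HasDerivAt H (H' θ) θ := fun θ => by
      rw [hH, hH']
      have a1 : HasDerivAt (fun θ => A (f 0) (γ θ)) (A (f 0) (γ' θ)) θ := (A (f 0)).hasFDerivAt.comp_hasDerivAt θ (hd θ)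
      have a2 : HasDerivAt (fun θ => B (l θ)) (B (l' θ)) θ := B.hasFDerivAt.comp_hasDerivAt θ (hld θ)
      have a3 : HasDerivAt (fun θ => B (l θ) (γ θ - f 0)) (B (l' θ) (γ θ - f 0) + B (l θ) (γ' θ)) θ :=
        a2.clm_apply ((hd θ).sub_const (f 0))
      have a4 : HasDerivAt (fun θ => Real.sin θ ^ 2 / 2) (Real.sin θ * Real.cos θ) θ := by
        have := ((Real.hasDerivAt_sin θ).pow 2).div_const 2
        exact this.congr_deriv (by push_cast; ring)
      have a5 : HasDerivAt (fun θ => Real.sin θ * Real.cos θ / 2) ((Real.cos θ ^ 2 - Real.sin θ ^ 2) / 2) θ := by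
        have := ((Real.hasDerivAt_sin θ).mul (Real.hasDerivAt_cos θ)).div_const 2
        exact this.congr_deriv (by ring)
      beta_reduce
      rw [add_comm (B (l θ) (γ' θ))]
      exact (a1.add a3).add (((a4.smul_const _).sub (a5.smul_const _)).const_smul (ρ ^ 2))
    have hE : ∀ θ, A (γ θ) (γ' θ) + (ρ ^ 2 / 2) • NN A (f 0) w - H' θ =
        (A (γ θ) - A (f 0) - B (l θ)) (γ' θ) - B (l' θ) (γ θ - f 0 - l θ) := fun θ => by
      have e1 := bil_alg B w w' ρ (Real.sin θ) (Real.cos θ) (Real.sin_sq_add_cos_sq θ)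
      rw [← hN] at e1
      rw [← e1, hH']
      have e2 : B ((ρ * (-Real.sin θ)) • w + (ρ * Real.cos θ) • w') ((ρ * Real.cos θ) • w + (ρ * Real.sin θ) • w') = B (l' θ) (l θ) := by
        rw [hl, hl']
      rw [e2]
      simp only [map_sub, ContinuousLinearMap.sub_apply]
      abel
    have hEb : ∀ θ, ‖A (γ θ) (γ' θ) + (ρ ^ 2 / 2) • NN A (f 0) w - H' θ‖ ≤
        (L * Λ ^ 3 + L * Λ + L * ((1 + L) * ‖w‖)) * (ρ ^ 2 * (ω + ρ)) := fun θ => by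
      rw [hE]
      have g1 : ‖γ θ - f 0‖ ≤ Λ * ρ := by
        have := hlip _ (hcm θ) 0 (by simp; linarith)
        rw [sub_zero, hcn] at this
        rw [hγ]; exact this
      have g2 : ‖A (γ θ) - A (f 0) - B (l θ)‖ ≤ L * (Λ * ρ) ^ 2 + L * (ω * ρ) := by
        have e : A (γ θ) - A (f 0) - B (l θ) = (A (γ θ) - A (f 0) - B (γ θ - f 0)) + B (γ θ - f 0 - l θ) := by
          rw [map_sub B (γ θ - f 0)]; abel
        rw [e]
        refine (norm_add_le _ _).trans (add_le_add ?_ ?_)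
        · have := hA.taylor (γ θ) (f 0)
          rw [← hB] at this
          exact this.trans (by gcongr)
        · exact (B.le_opNorm _).trans (mul_le_mul hBb (he θ) (norm_nonneg _) hL)
      have g3 : ‖B (l' θ) (γ θ - f 0 - l θ)‖ ≤ L * (ρ * ((1 + L) * ‖w‖)) * (ω * ρ) := by
        refine ((B (l' θ)).le_opNorm _).trans (mul_le_mul ((B.le_opNorm _).trans (mul_le_mul hBb (hl'b θ) (norm_nonneg _) hL)) (he θ) (norm_nonneg _) (by positivity))
      have g4 := (A (γ θ) - A (f 0) - B (l θ)).le_opNorm (γ' θ)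
      have g5 : ‖A (γ θ) - A (f 0) - B (l θ)‖ * ‖γ' θ‖ ≤ (L * (Λ * ρ) ^ 2 + L * (ω * ρ)) * (Λ * ρ) :=
        mul_le_mul g2 (hγb θ) (norm_nonneg _) (by positivity)
      refine (norm_sub_le _ _).trans ?_
      have p1 : 0 ≤ L * Λ ^ 3 * ρ ^ 2 * ω := by positivity
      have p2 : 0 ≤ L * Λ * ρ ^ 2 * ρ := by positivity
      have p3 : 0 ≤ L * ((1 + L) * ‖w‖) * ρ ^ 2 * ρ := by positivity
      nlinarith
    have hmt : StronglyMeasurable H' := by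
      have : H' = deriv H := funext fun θ => (hHd θ).deriv.symm
      rw [this]; exact stronglyMeasurable_deriv H
    have hHi : IntervalIntegrable H' volume 0 (2 * Real.pi) := by
      refine ii_of_bdd hmt (C := L * (Λ * ρ) + ‖(ρ ^ 2 / 2) • NN A (f 0) w‖ + (L * Λ ^ 3 + L * Λ + L * ((1 + L) * ‖w‖)) * (ρ ^ 2 * (ω + ρ))) (fun θ => ?_) _ _
      have e : H' θ = A (γ θ) (γ' θ) + (ρ ^ 2 / 2) • NN A (f 0) w - (A (γ θ) (γ' θ) + (ρ ^ 2 / 2) • NN A (f 0) w - H' θ) := by abel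
      rw [e]
      refine (norm_sub_le _ _).trans (add_le_add ((norm_add_le _ _).trans (add_le_add (hb θ) le_rfl)) (hEb θ))
    have hAi : IntervalIntegrable (fun θ => A (γ θ) (γ' θ)) volume 0 (2 * Real.pi) := ii_of_bdd hm hb _ _
    have hper : H (2 * Real.pi) - H 0 = 0 := by
      have h1 : γ (2 * Real.pi) = γ 0 := by
        rw [hγ]
        have := periodic_circleMap 0 ρ 0
        rw [zero_add] at this
        simp only [this]
      have h2 : l (2 * Real.pi) = l 0 := by rw [hl]; simp
      rw [hH]; simp [h1, h2]
    have hinteg := intervalIntegral.integral_eq_sub_of_hasDerivAt (fun θ _ => hHd θ) hHi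
    rw [hper] at hinteg
    have e : (∫ θ in (0:ℝ)..2 * Real.pi, A (γ θ) (γ' θ)) + (Real.pi * ρ ^ 2) • NN A (f 0) w =
        ∫ θ in (0:ℝ)..2 * Real.pi, (A (γ θ) (γ' θ) + (ρ ^ 2 / 2) • NN A (f 0) w - H' θ) := by
      rw [intervalIntegral.integral_sub (hAi.add intervalIntegrable_const) hHi, hinteg, sub_zero,
        intervalIntegral.integral_add hAi intervalIntegrable_const, intervalIntegral.integral_const, smul_smul]
      congr 2
      ring
    rw [e]
    refine (intervalIntegral.norm_integral_le_of_norm_le_const (fun θ _ => hEb θ)).trans (le_of_eq ?_)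
    rw [sub_zero, abs_of_pos Real.two_pi_pos]
  rw [hγ, hγ'] at hm key hb
  exact ⟨hm, hb, key⟩

theorem lemM {A : V → V →L[ℝ] V} {L : ℝ} (hA : NiceJ A L) {f : ℂ → V} {R : ℝ} (hf : JH A f (ball 0 R))
    (hA2 : ∀ τ ∈ ball (0:ℂ) R, ∀ v, A (f τ) (A (f τ) v) = -v)
    {Λ : ℝ} (hΛ : 0 ≤ Λ) (hlip : ∀ τ ∈ ball (0:ℂ) R, ∀ τ' ∈ ball (0:ℂ) R, ‖f τ - f τ'‖ ≤ Λ * ‖τ - τ'‖)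
    {w : V} {ω : ℝ} (hω0 : 0 ≤ ω) (hω : ∀ τ ∈ ball (0:ℂ) R, ‖f τ - f 0 - (τ.re • w + τ.im • A (f 0) w)‖ ≤ ω * ‖τ‖)
    {r : ℝ} (hr : 0 < r) (hrR : r < R) :
    ‖Real.circleAverage f 0 r - f 0 - (r ^ 2 / 4) • NN A (f 0) w‖ ≤
      (L * Λ ^ 3 + L * Λ + L * ((1 + L) * ‖w‖)) * (r ^ 2 * (ω + r)) := by
  have hL := hA.nonneg
  obtain ⟨K, hK⟩ : ∃ K, K = (L * Λ ^ 3 + L * Λ + L * ((1 + L) * ‖w‖)) := ⟨_, rfl⟩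
  have hK0 : 0 ≤ K := by rw [hK]; positivity
  have hfc : ∀ ρ, 0 ≤ ρ → ρ < R → Continuous (fun θ => f (circleMap 0 ρ θ)) := fun ρ h0 h1 =>
    continuous_iff_continuousAt.2 fun θ => ContinuousAt.comp (g := f)
      (hf _ (by simp [abs_of_nonneg h0, h1])).1.continuousAt (continuous_circleMap 0 ρ).continuousAt
  have cdiff : ∀ (ρ ρ' : ℝ) θ, circleMap 0 ρ θ - circleMap 0 ρ' θ = ((ρ - ρ' : ℝ) : ℂ) * exp (θ * I) := fun ρ ρ' θ => by
    simp [circleMap]; ring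
  have hlr : ∀ θ, ∀ ρ ∈ Ico 0 R, ∀ ρ' ∈ Ico 0 R, ‖f (circleMap 0 ρ θ) - f (circleMap 0 ρ' θ)‖ ≤ Λ * |ρ - ρ'| := fun θ ρ h ρ' h' => by
    have := hlip (circleMap 0 ρ θ) (by simp [abs_of_nonneg h.1, h.2]) (circleMap 0 ρ' θ) (by simp [abs_of_nonneg h'.1, h'.2])
    rw [cdiff, norm_mul, norm_exp_ofReal_mul_I, mul_one, norm_real, Real.norm_eq_abs] at this
    exact this
  obtain ⟨m, hm⟩ : ∃ m : ℝ → V, m = fun ρ => Real.circleAverage f 0 ρ := ⟨_, rfl⟩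
  obtain ⟨m', hm'⟩ : ∃ m' : ℝ → V, m' = fun ρ => (2 * Real.pi)⁻¹ • ∫ θ in (0:ℝ)..2 * Real.pi, fderiv ℝ f (circleMap 0 ρ θ) (exp (θ * I)) := ⟨_, rfl⟩
  have hder : ∀ ρ ∈ Ioo 0 R, HasDerivAt m (m' ρ) ρ ∧ ‖m' ρ - (ρ / 2) • NN A (f 0) w‖ ≤ K * (ρ * (ω + ρ)) := by
    intro ρ hρ
    obtain ⟨c1, c2, c3⟩ := circ_int hA (fun τ hτ => (hf τ hτ).1) hΛ hlip hω0 hω hρ.1 hρ.2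
    have hcm : ∀ θ, circleMap 0 ρ θ ∈ ball (0:ℂ) R := fun θ => by simp [abs_of_pos hρ.1, hρ.2]
    have eA : ∀ θ : ℝ, A (f (circleMap 0 ρ θ)) (fderiv ℝ f (circleMap 0 ρ θ) (circleMap 0 ρ θ * I)) =
        - (ρ • fderiv ℝ f (circleMap 0 ρ θ) (exp (θ * I))) := fun θ => by
      rw [mul_comm, hf.apply (hcm θ) (hA2 _ (hcm θ)), circleMap_zero, ← map_smul]
      simp
    have eF : ∀ θ : ℝ, fderiv ℝ f (circleMap 0 ρ θ) (exp (θ * I)) =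
        (-ρ⁻¹) • A (f (circleMap 0 ρ θ)) (fderiv ℝ f (circleMap 0 ρ θ) (circleMap 0 ρ θ * I)) := fun θ => by
      rw [eA, smul_neg, neg_smul, neg_neg, smul_smul, inv_mul_cancel₀ hρ.1.ne', one_smul]
    refine ⟨?_, ?_⟩
    · have key := (intervalIntegral.hasDerivAt_integral_of_dominated_loc_of_lip (𝕜 := ℝ) (μ := volume) (a := 0) (b := 2 * Real.pi)
        (F := fun ρ θ => f (circleMap 0 ρ θ)) (F' := fun θ => fderiv ℝ f (circleMap 0 ρ θ) (exp (θ * I)))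
        (bound := fun _ => Λ) (x₀ := ρ) (s := Ioo 0 R) (Ioo_mem_nhds hρ.1 hρ.2)
        (by filter_upwards [Ioo_mem_nhds hρ.1 hρ.2] with x hx using (hfc x hx.1.le hx.2).aestronglyMeasurable)
        ((hfc ρ hρ.1.le hρ.2).intervalIntegrable _ _)
        (by
          have : (fun θ : ℝ => fderiv ℝ f (circleMap 0 ρ θ) (exp (θ * I))) = fun θ : ℝ => (-ρ⁻¹) • A (f (circleMap 0 ρ θ)) (fderiv ℝ f (circleMap 0 ρ θ) (circleMap 0 ρ θ * I)) := funext eF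
          rw [this]
          exact (c1.const_smul _).aestronglyMeasurable)
        (Eventually.of_forall fun θ _ => by
          refine LipschitzOnWith.of_dist_le_mul fun x hx y hy => ?_
          rw [dist_eq_norm, Real.dist_eq, Real.coe_nnabs, abs_of_nonneg hΛ]
          exact hlr θ x ⟨hx.1.le, hx.2⟩ y ⟨hy.1.le, hy.2⟩)
        intervalIntegrable_const
        (Eventually.of_forall fun θ _ => by
          have h1 : HasDerivAt (fun x : ℝ => circleMap 0 x θ) (exp (θ * I)) ρ := by
            simp only [circleMap_zero]
            have := (Complex.ofRealCLM.hasDerivAt (x := ρ)).mul_const (exp (θ * I))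
            simpa using this
          exact (hf _ (hcm θ)).1.hasFDerivAt.comp_hasDerivAt ρ h1)).2
      rw [hm, hm']
      have := key.const_smul ((2 * Real.pi)⁻¹)
      exact this
    · have e1 : m' ρ - (ρ / 2) • NN A (f 0) w = (-(ρ⁻¹ * (2 * Real.pi)⁻¹)) • ((∫ θ in (0:ℝ)..2 * Real.pi, A (f (circleMap 0 ρ θ)) (fderiv ℝ f (circleMap 0 ρ θ) (circleMap 0 ρ θ * I)))
          + (Real.pi * ρ ^ 2) • NN A (f 0) w) := by
        rw [hm']
        simp only [eF]
        rw [intervalIntegral.integral_smul, smul_add, smul_smul, smul_smul, sub_eq_add_neg, ← neg_smul]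
        have hρ' := hρ.1.ne'
        have hpi := Real.pi_pos.ne'
        congr 2
        · field_simp
        · field_simp
      rw [e1, norm_smul, norm_neg, Real.norm_of_nonneg (by have := hρ.1; have := Real.pi_pos; positivity)]
      calc _ ≤ ρ⁻¹ * (2 * Real.pi)⁻¹ * (K * (ρ ^ 2 * (ω + ρ)) * (2 * Real.pi)) := by
            have := hρ.1; have := Real.pi_pos
            rw [hK]; gcongr
        _ = _ := by have := hρ.1.ne'; have := Real.pi_pos.ne'; field_simp
  -- distance of m to f 0
  have hm0 : ∀ ρ ∈ Ioo 0 R, ‖m ρ - f 0‖ ≤ Λ * ρ := fun ρ hρ => by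
    have e : m ρ - f 0 = (2 * Real.pi)⁻¹ • ∫ θ in (0:ℝ)..2 * Real.pi, (f (circleMap 0 ρ θ) - f 0) := by
      rw [intervalIntegral.integral_sub ((hfc ρ hρ.1.le hρ.2).intervalIntegrable _ _) intervalIntegrable_const, hm, smul_sub,
        intervalIntegral.integral_const, sub_zero, smul_smul, inv_mul_cancel₀ Real.two_pi_pos.ne', one_smul]
      rfl
    rw [e, norm_smul, Real.norm_of_nonneg (by have := Real.pi_pos; positivity)]
    have : ‖∫ θ in (0:ℝ)..2 * Real.pi, (f (circleMap 0 ρ θ) - f 0)‖ ≤ Λ * ρ * |2 * Real.pi - 0| := by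
      apply intervalIntegral.norm_integral_le_of_norm_le_const
      intro θ _
      have := hlip (circleMap 0 ρ θ) (by simp [abs_of_pos hρ.1, hρ.2]) 0 (by simp; linarith [hρ.1, hρ.2])
      simpa [abs_of_pos hρ.1] using this
    rw [sub_zero, abs_of_pos Real.two_pi_pos] at this
    calc _ ≤ (2 * Real.pi)⁻¹ * (Λ * ρ * (2 * Real.pi)) := by have := Real.pi_pos; gcongr
      _ = _ := by have := Real.pi_pos.ne'; field_simp
  rw [← hK]
  obtain ⟨N, hN⟩ : ∃ N, N = NN A (f 0) w := ⟨_, rfl⟩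
  rw [← hN] at hder ⊢
  have hmr : Real.circleAverage f 0 r = m r := by rw [hm]
  rw [hmr]
  have hstep : ∀ s ∈ Ioo 0 r, ‖m r - f 0 - (r ^ 2 / 4) • N‖ ≤ K * (r ^ 2 * (ω + r)) + (Λ * s + s ^ 2 / 4 * ‖N‖) := by
    intro s hs
    have hsub : Icc s r ⊆ Ioo 0 R := fun x hx => ⟨hs.1.trans_le hx.1, hx.2.trans_lt hrR⟩
    have := (convex_Icc s r).norm_image_sub_le_of_norm_hasDerivWithin_le (f := fun ρ => m ρ - (ρ ^ 2 / 4) • N)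
      (f' := fun ρ => m' ρ - (ρ / 2) • N) (C := K * (r * (ω + r))) (x := s) (y := r)
      (fun x hx => by
        have h1 : HasDerivAt (fun ρ : ℝ => ρ ^ 2 / 4) (x / 2) x := by
          have := (hasDerivAt_pow 2 x).div_const 4
          exact this.congr_deriv (by push_cast; ring)
        exact ((hder x (hsub hx)).1.sub (h1.smul_const N)).hasDerivWithinAt)
      (fun x hx => (hder x (hsub hx)).2.trans (by
        have h1 := (hsub hx).1.le
        have h2 := hx.2
        gcongr)) ⟨le_rfl, hs.2.le⟩ ⟨hs.2.le, le_rfl⟩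
    rw [Real.norm_of_nonneg (by linarith [hs.2])] at this
    have h3 : K * (r * (ω + r)) * (r - s) ≤ K * (r ^ 2 * (ω + r)) := by
      have : K * (r * (ω + r)) * (r - s) ≤ K * (r * (ω + r)) * r := by
        have := hs.1
        gcongr
        linarith
      linarith
    have h4 := hm0 s ⟨hs.1, hs.2.trans hrR⟩
    calc ‖m r - f 0 - (r ^ 2 / 4) • N‖ = ‖(m r - (r ^ 2 / 4) • N - (m s - (s ^ 2 / 4) • N)) + ((m s - f 0) - (s ^ 2 / 4) • N)‖ := by
          congr 1; abel
      _ ≤ ‖m r - (r ^ 2 / 4) • N - (m s - (s ^ 2 / 4) • N)‖ + (‖m s - f 0‖ + ‖(s ^ 2 / 4) • N‖) :=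
          (norm_add_le _ _).trans (add_le_add le_rfl (norm_sub_le _ _))
      _ ≤ _ := by
          rw [norm_smul, Real.norm_of_nonneg (by positivity)]
          linarith
  have ht : Tendsto (fun s : ℝ => K * (r ^ 2 * (ω + r)) + (Λ * s + s ^ 2 / 4 * ‖N‖)) (𝓝[>] 0) (𝓝 (K * (r ^ 2 * (ω + r)) + (Λ * 0 + 0 ^ 2 / 4 * ‖N‖))) := by
    apply Filter.Tendsto.mono_left _ nhdsWithin_le_nhds
    apply Continuous.tendsto
    fun_prop
  have := ge_of_tendsto ht (by filter_upwards [Ioo_mem_nhdsGT hr] with s hs using hstep s hs)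
  simpa using this

end P3
end RS

namespace RS

section P3b
variable {V : Type*} [NormedAddCommGroup V] [InnerProductSpace ℝ V] [FiniteDimensional ℝ V]

/-- second order expansion of a function at a point -/
def HasQuad (φ : V → ℝ) (x : V) (D : V →L[ℝ] ℝ) (Q : V →L[ℝ] V →L[ℝ] ℝ) : Prop :=
  ∀ ε : ℝ, 0 < ε → ∀ᶠ h in 𝓝 (0:V), |φ (x + h) - φ x - D h - 1 / 2 * Q h h| ≤ ε * ‖h‖ ^ 2

/-- second order expansion, one variable -/
def SQ (Θ : ℝ → ℝ) (t a b : ℝ) : Prop :=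
  ∀ ε : ℝ, 0 < ε → ∀ᶠ s in 𝓝 (0:ℝ), |Θ (t + s) - Θ t - a * s - 1 / 2 * b * s ^ 2| ≤ ε * s ^ 2

theorem HasQuad.of_hasFDerivAt {φ : V → ℝ} {x : V} {φ' : V → V →L[ℝ] ℝ} {Q : V →L[ℝ] V →L[ℝ] ℝ}
    (h1 : ∀ᶠ y in 𝓝 x, HasFDerivAt φ (φ' y) y) (h2 : HasFDerivAt φ' Q x) : HasQuad φ x (φ' x) Q := by
  intro ε hε
  have h3 := h2.isLittleO.def hε
  have h4 := h1.and h3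
  obtain ⟨δ, hδ, hball⟩ := Metric.eventually_nhds_iff_ball.1 h4
  filter_upwards [Metric.ball_mem_nhds (0:V) hδ] with h hh
  rw [mem_ball_zero_iff] at hh
  have hin : ∀ t ∈ Icc (0:ℝ) 1, x + t • h ∈ ball x δ := fun t ht => by
    rw [mem_ball, dist_eq_norm, add_sub_cancel_left, norm_smul, Real.norm_of_nonneg ht.1]
    nlinarith [ht.2, norm_nonneg h]
  have hd : ∀ t ∈ Icc (0:ℝ) 1, HasDerivWithinAt (fun t : ℝ => φ (x + t • h) - t * φ' x h - 1/2 * t ^ 2 * Q h h)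
      (φ' (x + t • h) h - φ' x h - t * Q h h) (Icc 0 1) t := fun t ht => by
    have a1 : HasDerivAt (fun t : ℝ => x + t • h) h t := by
      simpa using ((hasDerivAt_id t).smul_const h).const_add x
    have a2 := (hball _ (hin t ht)).1.comp_hasDerivAt t a1
    have a3 : HasDerivAt (fun t : ℝ => t * φ' x h) (φ' x h) t := by simpa using (hasDerivAt_id t).mul_const (φ' x h)
    have a4 : HasDerivAt (fun t : ℝ => 1/2 * t ^ 2 * Q h h) (t * Q h h) t := by
      exact (((hasDerivAt_pow 2 t).const_mul (1/2)).mul_const (Q h h)).congr_deriv (by push_cast; ring)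
    exact ((a2.sub a3).sub a4).hasDerivWithinAt
  have := (convex_Icc (0:ℝ) 1).norm_image_sub_le_of_norm_hasDerivWithin_le hd (C := ε * ‖h‖ ^ 2) (x := 0) (y := 1)
    (fun t ht => by
      have a5 := (hball _ (hin t ht)).2
      rw [add_sub_cancel_left] at a5
      have a6 : φ' (x + t • h) h - φ' x h - t * Q h h = (φ' (x + t • h) - φ' x - Q (t • h)) h := by simp
      rw [a6]
      refine (ContinuousLinearMap.le_opNorm _ _).trans ?_
      rw [norm_smul, Real.norm_of_nonneg ht.1] at a5
      have : ε * (t * ‖h‖) ≤ ε * ‖h‖ := by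
        have := ht.2
        have : t * ‖h‖ ≤ 1 * ‖h‖ := by gcongr
        gcongr; linarith
      nlinarith [norm_nonneg h, mul_le_mul_of_nonneg_right (a5.trans this) (norm_nonneg h)])
    (by simp) (by simp)
  simp only [Real.norm_eq_abs, one_smul, zero_smul, add_zero, sub_zero, abs_one, mul_one, one_mul, zero_mul, one_pow] at this
  refine le_trans (le_of_eq ?_) this
  congr 1
  ring

theorem SQ.of_deriv {Θ Θ' : ℝ → ℝ} {t b : ℝ} (h1 : ∀ᶠ y in 𝓝 t, HasDerivAt Θ (Θ' y) y) (h2 : HasDerivAt Θ' b t) :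
    SQ Θ t (Θ' t) b := by
  have h3 : HasFDerivAt (fun y => ContinuousLinearMap.toSpanSingleton ℝ (Θ' y))
      ((ContinuousLinearMap.toSpanSingletonCLE (𝕜 := ℝ) (E := ℝ)).toContinuousLinearMap.comp (ContinuousLinearMap.toSpanSingleton ℝ b)) t :=
    (ContinuousLinearMap.toSpanSingletonCLE (𝕜 := ℝ) (E := ℝ)).toContinuousLinearMap.hasFDerivAt.comp t h2.hasFDerivAt
  have := HasQuad.of_hasFDerivAt (h1.mono fun y hy => hy.hasFDerivAt) h3
  intro ε hε
  filter_upwards [this ε hε] with s hs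
  simp at hs
  refine le_trans (le_of_eq ?_) hs
  congr 1; ring

theorem HasQuad.add {φ φ2 : V → ℝ} {x : V} {D D2 : V →L[ℝ] ℝ} {Q Q2 : V →L[ℝ] V →L[ℝ] ℝ}
    (h1 : HasQuad φ x D Q) (h2 : HasQuad φ2 x D2 Q2) : HasQuad (fun y => φ y + φ2 y) x (D + D2) (Q + Q2) := by
  intro ε hε
  filter_upwards [h1 (ε/2) (by positivity), h2 (ε/2) (by positivity)] with h a b
  simp only [ContinuousLinearMap.add_apply]
  rw [abs_le] at *
  constructor <;> nlinarith [a.1, a.2, b.1, b.2]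

theorem HasQuad.comp {φ : V → ℝ} {x : V} {D : V →L[ℝ] ℝ} {Q : V →L[ℝ] V →L[ℝ] ℝ} {Θ : ℝ → ℝ} {a b : ℝ}
    (h1 : HasQuad φ x D Q) (h2 : SQ Θ (φ x) a b) :
    HasQuad (fun y => Θ (φ y)) x (a • D) (a • Q + b • D.smulRight D) := by
  intro ε hε
  obtain ⟨M, hM⟩ : ∃ M, M = ‖D‖ + ‖Q‖ + 1 := ⟨_, rfl⟩
  have hM1 : 1 ≤ M := by rw [hM]; linarith [norm_nonneg D, norm_nonneg Q]
  obtain ⟨ε1, hε1⟩ : ∃ e, e = min 1 (ε / (2 * (|a| + 2 * |b| * M + 1))) := ⟨_, rfl⟩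
  have he1 : 0 < ε1 := by rw [hε1]; positivity
  have he2 : ε1 ≤ 1 := by rw [hε1]; exact min_le_left _ _
  have he3 : ε1 * (|a| + 2 * |b| * M + 1) ≤ ε / 2 := by
    have : ε1 ≤ ε / (2 * (|a| + 2 * |b| * M + 1)) := by rw [hε1]; exact min_le_right _ _
    rw [le_div_iff₀ (by positivity)] at this
    linarith
  have hb1 : ∀ᶠ h in 𝓝 (0:V), ‖h‖ ≤ ε1 / M ^ 2 ∧ ‖h‖ ≤ 1 := by
    have : Tendsto (fun h : V => ‖h‖) (𝓝 0) (𝓝 0) := tendsto_norm_zero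
    exact (this.eventually (eventually_le_nhds (show (0:ℝ) < ε1 / M ^ 2 by positivity))).and
      (this.eventually (eventually_le_nhds (show (0:ℝ) < 1 by norm_num)))
  have key : ∀ᶠ h in 𝓝 (0:V), |φ (x + h) - φ x - D h - 1 / 2 * Q h h| ≤ ε1 * ‖h‖ ^ 2 ∧ ‖h‖ ≤ ε1 / M ^ 2 ∧ ‖h‖ ≤ 1 :=
    (h1 ε1 he1).and hb1
  have key2 : ∀ᶠ h in 𝓝 (0:V), |φ (x + h) - φ x - D h| ≤ M * ‖h‖ ^ 2 ∧ |φ (x+h) - φ x| ≤ 2 * M * ‖h‖ := by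
    filter_upwards [key] with h ⟨k1, k2, k3⟩
    have q1 : |D h| ≤ ‖D‖ * ‖h‖ := D.le_opNorm h
    have q2 : |Q h h| ≤ ‖Q‖ * ‖h‖ * ‖h‖ := Q.le_opNorm₂ h h
    have e1 : |φ (x + h) - φ x - D h| ≤ M * ‖h‖ ^ 2 := by
      have : ε1 * ‖h‖ ^ 2 ≤ 1 * ‖h‖ ^ 2 := by gcongr
      rw [hM]
      have := norm_nonneg D
      rw [abs_le] at *
      constructor <;> nlinarith [sq_nonneg ‖h‖, mul_nonneg (norm_nonneg D) (sq_nonneg ‖h‖), mul_nonneg (norm_nonneg Q) (sq_nonneg ‖h‖)]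
    refine ⟨e1, ?_⟩
    have : M * ‖h‖ ^ 2 ≤ M * ‖h‖ := by
      gcongr; nlinarith [norm_nonneg h]
    have : ‖D‖ * ‖h‖ ≤ M * ‖h‖ := by gcongr; rw [hM]; linarith [norm_nonneg Q]
    rw [abs_le] at *
    constructor <;> linarith [e1.1, e1.2, q1.1, q1.2]
  have htend : Tendsto (fun h => φ (x + h) - φ x) (𝓝 (0:V)) (𝓝 0) := by
    refine squeeze_zero_norm' (a := fun h => 2 * M * ‖h‖) (key2.mono fun h hh => hh.2) ?_
    have : Tendsto (fun h : V => ‖h‖) (𝓝 0) (𝓝 0) := tendsto_norm_zero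
    simpa using this.const_mul (2 * M)
  have hS := htend.eventually (h2 (ε / (8 * M ^ 2)) (by positivity))
  filter_upwards [key, key2, hS] with h ⟨k1, k2, k3⟩ ⟨k4, k5⟩ k6
  simp only [add_sub_cancel] at k6
  obtain ⟨s, hs⟩ : ∃ s, s = φ (x + h) - φ x := ⟨_, rfl⟩
  rw [← hs] at k1 k4 k5 k6
  have q1 : |D h| ≤ M * ‖h‖ := (D.le_opNorm h).trans (by gcongr; rw [hM]; linarith [norm_nonneg Q])
  have e0 : |s ^ 2 - (D h) ^ 2| ≤ ε1 * 3 * M * ‖h‖^2 / 1 := by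
    have : s ^ 2 - (D h) ^ 2 = (s - D h) * (s + D h) := by ring
    rw [this, abs_mul]
    have : |s + D h| ≤ 3 * M * ‖h‖ := (abs_add_le _ _).trans (by linarith)
    calc _ ≤ (M * ‖h‖ ^ 2) * (3 * M * ‖h‖) := by gcongr
      _ = 3 * ‖h‖ ^ 2 * (M ^ 2 * ‖h‖) := by ring
      _ ≤ 3 * ‖h‖ ^ 2 * (M ^ 2 * (ε1 / M ^ 2)) := by gcongr
      _ = 3 * ‖h‖ ^ 2 * ε1 := by field_simp
      _ ≤ 3 * ‖h‖ ^ 2 * ε1 * M := by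
        have : 0 ≤ 3 * ‖h‖ ^ 2 * ε1 := by positivity
        nlinarith
      _ = _ := by ring
  have e2 : ε / (8 * M ^ 2) * s ^ 2 ≤ ε / 2 * ‖h‖ ^ 2 := by
    have : s ^ 2 ≤ (2 * M * ‖h‖) ^ 2 := by rw [← sq_abs s]; gcongr
    calc _ ≤ ε / (8 * M ^ 2) * (2 * M * ‖h‖) ^ 2 := by gcongr
      _ = _ := by field_simp; ring
  have e3 : Θ (φ (x + h)) - Θ (φ x) - (a • D) h - 1 / 2 * ((a • Q + b • D.smulRight D) h) h
     = (Θ (φ (x+h)) - Θ (φ x) - a * s - 1 / 2 * b * s ^ 2) + a * (s - D h - 1 / 2 * Q h h) + 1 / 2 * b * (s ^ 2 - (D h)^2) := by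
    simp; ring
  rw [e3]
  have e4 : |a * (s - D h - 1 / 2 * Q h h)| ≤ |a| * (ε1 * ‖h‖ ^ 2) := by rw [abs_mul]; gcongr
  have e5 : |1 / 2 * b * (s ^ 2 - (D h)^2)| ≤ 2 * |b| * (ε1 * M * ‖h‖ ^ 2) := by
    rw [abs_mul, abs_mul, abs_of_nonneg (by norm_num : (0:ℝ) ≤ 1/2)]
    have : 0 ≤ ε1 * M * ‖h‖ ^ 2 := by positivity
    nlinarith [abs_nonneg b, mul_le_mul_of_nonneg_left e0 (abs_nonneg b), mul_nonneg (abs_nonneg b) this]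
  have e6 : ε1 * (|a| + 2 * |b| * M + 1) * ‖h‖ ^ 2 ≤ ε / 2 * ‖h‖ ^ 2 := by gcongr
  have e7 : 0 ≤ ε1 * ‖h‖ ^ 2 := by positivity
  refine (abs_add_three _ _ _).trans ?_
  linarith

theorem ca_close {X : Type*} [NormedAddCommGroup X] [NormedSpace ℝ X] {f g : ℂ → X} {c : ℂ} {r C : ℝ} (hf : CircleIntegrable f c r)
    (hg : CircleIntegrable g c r) (h : ∀ τ ∈ sphere c |r|, ‖f τ - g τ‖ ≤ C) :
    ‖Real.circleAverage f c r - Real.circleAverage g c r‖ ≤ C := by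
  rw [← Real.circleAverage_sub hf hg, Real.circleAverage_def, norm_smul]
  have := intervalIntegral.norm_integral_le_of_norm_le_const (a := 0) (b := 2 * Real.pi) (f := fun θ => (f - g) (circleMap c r θ)) (C := C)
    (fun θ _ => h _ (circleMap_mem_sphere' c r θ))
  have hpi := Real.pi_pos
  rw [Real.norm_of_nonneg (by positivity)]
  rw [sub_zero, abs_of_nonneg (by positivity)] at this
  calc _ ≤ (2 * Real.pi)⁻¹ * (C * (2 * Real.pi)) := by gcongr
    _ = C := by field_simp

theorem ca_quad (Q : V →L[ℝ] V →L[ℝ] ℝ) (w w' : V) (r : ℝ) :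
    Real.circleAverage (fun τ : ℂ => Q (τ.re • w + τ.im • w') (τ.re • w + τ.im • w')) 0 r = r ^ 2 / 2 * (Q w w + Q w' w') := by
  rw [Real.circleAverage_def]
  have h1 : ∀ θ : ℝ, Q ((circleMap 0 r θ).re • w + (circleMap 0 r θ).im • w') ((circleMap 0 r θ).re • w + (circleMap 0 r θ).im • w')
      = r ^ 2 * (Real.cos θ ^ 2 * Q w w) + r ^ 2 * (Real.sin θ ^ 2 * Q w' w') + r ^ 2 * (Real.sin θ * Real.cos θ * (Q w w' + Q w' w)) := fun θ => by
    have hre : (circleMap 0 r θ).re = r * Real.cos θ := by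
      simp [circleMap, Complex.exp_ofReal_mul_I_re]
    have him : (circleMap 0 r θ).im = r * Real.sin θ := by
      simp [circleMap, Complex.exp_ofReal_mul_I_im]
    rw [hre, him]
    simp only [map_add, map_smul, ContinuousLinearMap.add_apply, ContinuousLinearMap.smul_apply, smul_eq_mul]
    ring
  simp_rw [h1]
  have c1 : Continuous fun θ : ℝ => r ^ 2 * (Real.cos θ ^ 2 * Q w w) := by fun_prop
  have c2 : Continuous fun θ : ℝ => r ^ 2 * (Real.sin θ ^ 2 * Q w' w') := by fun_prop
  have c3 : Continuous fun θ : ℝ => r ^ 2 * (Real.sin θ * Real.cos θ * (Q w w' + Q w' w)) := by fun_prop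
  have c4 : Continuous fun θ : ℝ => r ^ 2 * (Real.cos θ ^ 2 * Q w w) + r ^ 2 * (Real.sin θ ^ 2 * Q w' w') := by fun_prop
  rw [intervalIntegral.integral_add (c4.intervalIntegrable _ _) (c3.intervalIntegrable _ _),
    intervalIntegral.integral_add (c1.intervalIntegrable _ _) (c2.intervalIntegrable _ _)]
  simp only [intervalIntegral.integral_const_mul, intervalIntegral.integral_mul_const, integral_cos_sq, integral_sin_sq, integral_sin_mul_cos₁]
  have hpi := Real.pi_pos
  simp
  field_simp

theorem circInt_of_cont {X : Type*} [NormedAddCommGroup X] {f : ℂ → X} {c : ℂ} {r : ℝ} (h : ∀ τ ∈ sphere c |r|, ContinuousAt f τ) : CircleIntegrable f c r :=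
  ContinuousOn.circleIntegrable' fun τ hτ => (h τ hτ).continuousWithinAt

theorem JH.omega {A : V → V →L[ℝ] V} {f : ℂ → V} {R : ℝ} (hR : 0 < R) (hf : JH A f (ball 0 R)) {ω : ℝ} (hω : 0 < ω) :
    ∃ R' > 0, ∀ τ ∈ ball (0:ℂ) R', ‖f τ - f 0 - (τ.re • fderiv ℝ f 0 1 + τ.im • A (f 0) (fderiv ℝ f 0 1))‖ ≤ ω * ‖τ‖ := by
  have h0 := hf 0 (by simpa using hR)
  have h1 := h0.1.hasFDerivAt.isLittleO.def hω
  obtain ⟨R', hR', hb⟩ := Metric.eventually_nhds_iff_ball.1 h1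
  refine ⟨R', hR', fun τ hτ => ?_⟩
  have := hb τ hτ
  rw [sub_zero] at this
  have e : fderiv ℝ f 0 τ = τ.re • fderiv ℝ f 0 1 + τ.im • A (f 0) (fderiv ℝ f 0 1) := by
    rw [← h0.2, ← map_smul, ← map_smul, ← map_add]
    congr 1
    apply Complex.ext <;> simp
  rw [e] at this
  exact this

set_option maxHeartbeats 1000000 in
theorem M2 {A : V → V →L[ℝ] V} {L : ℝ} (hA : NiceJ A L) {f : ℂ → V} {R : ℝ} (hR : 0 < R) (hf : JH A f (ball 0 R))
    (hA2 : ∀ τ ∈ ball (0:ℂ) R, ∀ v, A (f τ) (A (f τ) v) = -v)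
    {Λ : ℝ} (hΛ : 0 ≤ Λ) (hlip : ∀ τ ∈ ball (0:ℂ) R, ∀ τ' ∈ ball (0:ℂ) R, ‖f τ - f τ'‖ ≤ Λ * ‖τ - τ'‖)
    {φ : V → ℝ} {D : V →L[ℝ] ℝ} {Q : V →L[ℝ] V →L[ℝ] ℝ} (hφ : HasQuad φ (f 0) D Q)
    (hφc : ∀ᶠ y in 𝓝 (f 0), ContinuousAt φ y) {w : V} (hw : w = fderiv ℝ f 0 1) {η : ℝ} (hη : 0 < η) :
    ∀ᶠ r in 𝓝[>] (0:ℝ), |Real.circleAverage (fun τ => φ (f τ)) 0 r - φ (f 0) -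
      r ^ 2 / 4 * (Q w w + Q (A (f 0) w) (A (f 0) w) + D (NN A (f 0) w))| ≤ η * r ^ 2 := by
  obtain ⟨K, hK⟩ : ∃ K, K = (L * Λ ^ 3 + L * Λ + L * ((1 + L) * ‖w‖)) := ⟨_, rfl⟩
  have hL := hA.nonneg
  have hK0 : 0 ≤ K := by rw [hK]; positivity
  have hcont : Continuous fun t : ℝ => t * Λ ^ 2 + 1 / 2 * (‖Q‖ * t * (2 * Λ + t)) + ‖D‖ * (K * (t + t)) := by fun_prop
  have hev : ∀ᶠ t in 𝓝[>] (0:ℝ), t * Λ ^ 2 + 1 / 2 * (‖Q‖ * t * (2 * Λ + t)) + ‖D‖ * (K * (t + t)) < η := by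
    have := (hcont.tendsto 0).mono_left (nhdsWithin_le_nhds (s := Ioi 0))
    simp only [zero_mul, add_zero, mul_zero] at this
    exact this.eventually (eventually_lt_nhds hη)
  obtain ⟨t, ht, ht0⟩ := (hev.and self_mem_nhdsWithin).exists
  replace ht0 : 0 < t := ht0
  obtain ⟨R1, hR1, hω⟩ := hf.omega hR ht0
  rw [← hw] at hω
  have hf0 : ContinuousAt f 0 := (hf 0 (by simpa using hR)).1.continuousAt
  have hev2 : ∀ᶠ τ in 𝓝 (0:ℂ), |φ (f τ) - φ (f 0) - D (f τ - f 0) - 1 / 2 * Q (f τ - f 0) (f τ - f 0)| ≤ t * ‖f τ - f 0‖ ^ 2 ∧ ContinuousAt φ (f τ) := by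
    have a1 : Tendsto (fun τ => f τ - f 0) (𝓝 0) (𝓝 0) := by
      simpa using hf0.tendsto.sub_const (f 0)
    filter_upwards [a1.eventually (hφ t ht0), hf0.tendsto.eventually hφc] with τ h1 h2
    rw [add_sub_cancel] at h1
    exact ⟨h1, h2⟩
  obtain ⟨R2, hR2, hb2⟩ := Metric.eventually_nhds_iff_ball.1 hev2
  have hpos : 0 < min (min R R1) (min R2 t) := by positivity
  filter_upwards [Ioo_mem_nhdsGT hpos] with r hr
  have r0 := hr.1
  have rR : r < R := hr.2.trans_le ((min_le_left _ _).trans (min_le_left _ _))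
  have rR1 : r < R1 := hr.2.trans_le ((min_le_left _ _).trans (min_le_right _ _))
  have rR2 : r < R2 := hr.2.trans_le ((min_le_right _ _).trans (min_le_left _ _))
  have rt : r < t := hr.2.trans_le ((min_le_right _ _).trans (min_le_right _ _))
  obtain ⟨R3, hR3⟩ : ∃ R3, R3 = min R R1 := ⟨_, rfl⟩
  have hs3 : ball (0:ℂ) R3 ⊆ ball 0 R := ball_subset_ball (by rw [hR3]; exact min_le_left _ _)
  have hs4 : ball (0:ℂ) R3 ⊆ ball 0 R1 := ball_subset_ball (by rw [hR3]; exact min_le_right _ _)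
  have hM := lemM hA (hf.mono hs3) (fun τ hτ => hA2 τ (hs3 hτ)) hΛ (fun τ hτ τ' hτ' => hlip τ (hs3 hτ) τ' (hs3 hτ')) ht0.le
    (fun τ hτ => hω τ (hs4 hτ)) r0 (by rw [hR3]; exact lt_min rR rR1)
  rw [← hK] at hM
  obtain ⟨w', hw'⟩ : ∃ w', w' = A (f 0) w := ⟨_, rfl⟩
  rw [← hw'] at hω ⊢
  obtain ⟨l, hl⟩ : ∃ l : ℂ → V, l = fun τ => τ.re • w + τ.im • w' := ⟨_, rfl⟩
  have hfi : CircleIntegrable f 0 r := circInt_of_cont fun τ hτ => (hf τ (by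
    rw [abs_of_pos r0] at hτ
    exact sphere_subset_closedBall.trans (closedBall_subset_ball rR) hτ)).1.continuousAt
  have hlc : Continuous l := by rw [hl]; fun_prop
  have hqi : CircleIntegrable (fun τ => Q (l τ) (l τ)) 0 r := circInt_of_cont fun τ hτ => by fun_prop
  have hDi : CircleIntegrable (fun τ => D (f τ)) 0 r := circInt_of_cont fun τ hτ => D.continuous.continuousAt.comp (hf τ (by
    rw [abs_of_pos r0] at hτ
    exact sphere_subset_closedBall.trans (closedBall_subset_ball rR) hτ)).1.continuousAt
  have hG : Real.circleAverage (fun τ => (φ (f 0) - D (f 0)) + D (f τ) + 1 / 2 * Q (l τ) (l τ)) 0 r =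
      φ (f 0) + D (Real.circleAverage f 0 r - f 0) + r ^ 2 / 4 * (Q w w + Q w' w') := by
    have hc : CircleIntegrable (fun _ : ℂ => φ (f 0) - D (f 0)) 0 r := circleIntegrable_const _ _ _
    have hcD : CircleIntegrable (fun τ => (φ (f 0) - D (f 0)) + D (f τ)) 0 r := hc.add hDi
    have hq2 : CircleIntegrable (fun τ => 1 / 2 * Q (l τ) (l τ)) 0 r := hqi.const_fun_smul (a := (1/2:ℝ))
    rw [Real.circleAverage_fun_add hcD hq2, Real.circleAverage_fun_add hc hDi,
      Real.circleAverage_const]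
    have e1 := Real.circleAverage_fun_smul (f := fun τ => Q (l τ) (l τ)) (c := 0) (R := r) (a := (1/2:ℝ))
    simp only [smul_eq_mul] at e1
    rw [e1]
    have e2 := ca_quad Q w w' r
    have e3 := D.circleAverage_comp_comm hfi
    have e4 : (fun τ => Q (l τ) (l τ)) = (fun τ : ℂ => Q (τ.re • w + τ.im • w') (τ.re • w + τ.im • w')) := by rw [hl]
    rw [e4, e2]
    rw [map_sub, ← e3]
    simp only [Function.comp_def]
    ring
  have hclose := ca_close (f := fun τ => φ (f τ)) (g := fun τ => (φ (f 0) - D (f 0)) + D (f τ) + 1 / 2 * Q (l τ) (l τ)) (c := 0) (r := r)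
    (C := (t * Λ ^ 2 + 1 / 2 * (‖Q‖ * t * (2 * Λ + t))) * r ^ 2)
    (circInt_of_cont fun τ hτ => by
      rw [abs_of_pos r0] at hτ
      exact ContinuousAt.comp (g := φ) (hb2 τ (sphere_subset_closedBall.trans (closedBall_subset_ball rR2) hτ)).2
        (hf τ (sphere_subset_closedBall.trans (closedBall_subset_ball rR) hτ)).1.continuousAt)
    (((circleIntegrable_const _ _ _).add hDi).add (hqi.const_fun_smul (a := (1/2:ℝ))))
    (fun τ hτ => by
      rw [abs_of_pos r0] at hτ
      have hn : ‖τ‖ = r := by simpa using hτ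
      have b1 := (hb2 τ (sphere_subset_closedBall.trans (closedBall_subset_ball rR2) hτ)).1
      have b2 := hω τ (sphere_subset_closedBall.trans (closedBall_subset_ball rR1) hτ)
      have b3 := hlip τ (sphere_subset_closedBall.trans (closedBall_subset_ball rR) hτ) 0 (by simpa using hR)
      rw [sub_zero, hn] at b3
      rw [hn] at b2
      have b4 : l τ = τ.re • w + τ.im • w' := by rw [hl]
      rw [← b4] at b2
      obtain ⟨h, hh⟩ : ∃ h, h = f τ - f 0 := ⟨_, rfl⟩
      rw [← hh] at b1 b2 b3
      have b5 : ‖l τ‖ ≤ (Λ + t) * r := by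
        have : l τ = h - (h - l τ) := by abel
        rw [this]; exact (norm_sub_le _ _).trans (by linarith)
      have b6 : |Q h h - Q (l τ) (l τ)| ≤ ‖Q‖ * t * (2 * Λ + t) * r ^ 2 := by
        have : Q h h - Q (l τ) (l τ) = Q (h - l τ) h + Q (l τ) (h - l τ) := by simp
        rw [this]
        refine (abs_add_le _ _).trans ?_
        have c1 := Q.le_opNorm₂ (h - l τ) h
        have c2 := Q.le_opNorm₂ (l τ) (h - l τ)
        rw [Real.norm_eq_abs] at c1 c2
        calc _ ≤ ‖Q‖ * (t * r) * (Λ * r) + ‖Q‖ * ((Λ + t) * r) * (t * r) := by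
              refine add_le_add (c1.trans ?_) (c2.trans ?_) <;> gcongr
          _ = _ := by ring
      have b7 : t * ‖h‖ ^ 2 ≤ t * (Λ * r) ^ 2 := by gcongr
      rw [Real.norm_eq_abs]
      have b8 : φ (f τ) - (φ (f 0) - D (f 0) + D (f τ) + 1 / 2 * Q (l τ) (l τ)) =
        (φ (f τ) - φ (f 0) - D h - 1 / 2 * Q h h) + 1 / 2 * (Q h h - Q (l τ) (l τ)) := by
        rw [hh, map_sub]; ring
      rw [b8]
      refine (abs_add_le _ _).trans ?_
      rw [abs_mul, abs_of_nonneg (by norm_num : (0:ℝ) ≤ 1/2)]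
      linarith)
  rw [hG, Real.norm_eq_abs] at hclose
  have hD : |D (Real.circleAverage f 0 r - f 0) - r ^ 2 / 4 * D (NN A (f 0) w)| ≤ ‖D‖ * (K * (t + t)) * r ^ 2 := by
    have e1 : D (Real.circleAverage f 0 r - f 0) - r ^ 2 / 4 * D (NN A (f 0) w) = D (Real.circleAverage f 0 r - f 0 - (r ^ 2 / 4) • NN A (f 0) w) := by
      simp
    rw [e1]
    refine (D.le_opNorm _).trans ?_
    calc _ ≤ ‖D‖ * (K * (r ^ 2 * (t + r))) := by gcongr
      _ ≤ ‖D‖ * (K * (r ^ 2 * (t + t))) := by gcongr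
      _ = _ := by ring
  have hfin := mul_le_mul_of_nonneg_right ht.le (sq_nonneg r)
  rw [abs_le] at *
  constructor <;> linarith [hclose.1, hclose.2, hD.1, hD.2]

end P3b
end RS

namespace RS

section P4
variable {V : Type*} [NormedAddCommGroup V] [InnerProductSpace ℝ V] [FiniteDimensional ℝ V]

theorem ca_log {a z : ℂ} (h : z ≠ a) : ∀ᶠ r in 𝓝[>] (0:ℝ), Real.circleAverage (fun ζ => Real.log ‖ζ - a‖) z r = Real.log ‖z - a‖ := by
  have hpos : 0 < ‖z - a‖ := norm_pos_iff.2 (sub_ne_zero.2 h)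
  filter_upwards [Ioo_mem_nhdsGT hpos] with r hr
  rw [InnerProductSpace.HarmonicOnNhd.circleAverage_eq]
  intro x hx
  apply AnalyticAt.harmonicAt_log_norm (by fun_prop)
  intro h0
  rw [sub_eq_zero] at h0
  rw [h0, mem_closedBall, dist_comm, dist_eq_norm, abs_of_pos hr.1] at hx
  exact absurd hr.2 (not_lt.2 hx)

theorem ca_sq (a z : ℂ) (r : ℝ) : Real.circleAverage (fun ζ => ‖ζ - a‖ ^ 2) z r = ‖z - a‖ ^ 2 + r ^ 2 := by
  rw [← Real.circleAverage_map_add_const, Real.circleAverage_def]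
  have h1 : ∀ θ : ℝ, ‖circleMap 0 r θ + z - a‖ ^ 2 = (‖z - a‖ ^ 2 + r ^ 2) + (2 * r * (z - a).re * Real.cos θ + 2 * r * (z - a).im * Real.sin θ) := fun θ => by
    rw [← Complex.normSq_eq_norm_sq, ← Complex.normSq_eq_norm_sq, Complex.normSq_apply, Complex.normSq_apply]
    simp [circleMap, Complex.exp_ofReal_mul_I_re, Complex.exp_ofReal_mul_I_im]
    have := Real.sin_sq_add_cos_sq θ
    linear_combination r ^ 2 * this
  simp_rw [h1]
  have c1 : Continuous fun θ : ℝ => 2 * r * (z - a).re * Real.cos θ + 2 * r * (z - a).im * Real.sin θ := by fun_prop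
  have c2 : Continuous fun θ : ℝ => 2 * r * (z - a).re * Real.cos θ := by fun_prop
  have c3 : Continuous fun θ : ℝ => 2 * r * (z - a).im * Real.sin θ := by fun_prop
  rw [intervalIntegral.integral_add (by simp) (c1.intervalIntegrable _ _), intervalIntegral.integral_add (c2.intervalIntegrable _ _) (c3.intervalIntegrable _ _)]
  simp only [intervalIntegral.integral_const_mul, integral_cos, integral_sin]
  have hpi := Real.pi_pos
  simp
  field_simp

/-- maximum principle -/
theorem max_princ {K U : Set ℂ} (hK : IsCompact K) (hU : IsOpen U) (hUK : U ⊆ K) {h : ℂ → ℝ} (hc : ContinuousOn h K)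
    (hsub : ∀ z ∈ U, ∃ᶠ r in 𝓝[>] (0:ℝ), h z < Real.circleAverage h z r) {z : ℂ} (hz : z ∈ U) :
    ∃ z' ∈ K \ U, h z ≤ h z' := by
  obtain ⟨z0, hz0, hmax⟩ := hK.exists_isMaxOn ⟨z, hUK hz⟩ hc
  refine ⟨z0, ⟨hz0, fun hz0U => ?_⟩, hmax (hUK hz)⟩
  obtain ⟨ρ, hρ, hb⟩ := Metric.isOpen_iff.1 hU z0 hz0U
  obtain ⟨r, hr1, hr2⟩ := ((hsub z0 hz0U).and_eventually (Ioo_mem_nhdsGT hρ)).exists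
  have hs : sphere z0 |r| ⊆ K := fun x hx => hUK (hb (by
    rw [mem_sphere, abs_of_pos hr2.1] at hx
    rw [mem_ball, hx]; exact hr2.2))
  have := Real.circleAverage_mono_on_of_le_circle (f := h) (a := h z0) (c := z0) (R := r) ((hc.mono hs).circleIntegrable')
    (fun x hx => hmax (hs hx))
  linarith

def LocLip (f : ℂ → V) (s : Set ℂ) : Prop := ∀ ζ ∈ s, ∃ R > 0, ∃ Λ ≥ 0, ∀ τ ∈ ball ζ R, ∀ τ' ∈ ball ζ R, ‖f τ - f τ'‖ ≤ Λ * ‖τ - τ'‖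

theorem JH.shift {A : V → V →L[ℝ] V} {f : ℂ → V} {ζ : ℂ} {R : ℝ} (h : JH A f (ball ζ R)) : JH A (fun τ => f (τ + ζ)) (ball 0 R) := by
  intro τ hτ
  have h1 := h (τ + ζ) (by simpa [dist_eq_norm] using hτ)
  refine ⟨?_, ?_⟩
  · exact DifferentiableAt.comp (g := f) τ h1.1 (by fun_prop)
  · rw [fderiv_comp_add_right]; exact h1.2

theorem M2' {A : V → V →L[ℝ] V} {L : ℝ} (hA : NiceJ A L) {f : ℂ → V} {s : Set ℂ} (hs : IsOpen s) (hf : JH A f s) (hl : LocLip f s)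
    (hA2 : ∀ τ ∈ s, ∀ v, A (f τ) (A (f τ) v) = -v) {ζ : ℂ} (hζ : ζ ∈ s)
    {φ : V → ℝ} {D : V →L[ℝ] ℝ} {Q : V →L[ℝ] V →L[ℝ] ℝ} (hφ : HasQuad φ (f ζ) D Q)
    (hφc : ∀ᶠ y in 𝓝 (f ζ), ContinuousAt φ y) {w : V} (hw : w = fderiv ℝ f ζ 1) {η : ℝ} (hη : 0 < η) :
    ∀ᶠ r in 𝓝[>] (0:ℝ), |Real.circleAverage (fun τ => φ (f τ)) ζ r - φ (f ζ) -
      r ^ 2 / 4 * (Q w w + Q (A (f ζ) w) (A (f ζ) w) + D (NN A (f ζ) w))| ≤ η * r ^ 2 := by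
  obtain ⟨R1, hR1, hb⟩ := Metric.isOpen_iff.1 hs ζ hζ
  obtain ⟨R2, hR2, Λ, hΛ, hlip⟩ := hl ζ hζ
  obtain ⟨R, hR⟩ : ∃ R, R = min R1 R2 := ⟨_, rfl⟩
  have hR0 : 0 < R := by rw [hR]; positivity
  have hsub : ∀ τ ∈ ball (0:ℂ) R, τ + ζ ∈ s ∧ τ + ζ ∈ ball ζ R2 := fun τ hτ => by
    rw [mem_ball_zero_iff, hR, lt_min_iff] at hτ
    exact ⟨hb (by simpa [dist_eq_norm] using hτ.1), by simpa [dist_eq_norm] using hτ.2⟩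
  have hJ : JH A (fun τ => f (τ + ζ)) (ball 0 R) := (hf.mono ((ball_subset_ball (by rw [hR]; exact min_le_left _ _)).trans hb)).shift
  have := M2 hA hR0 hJ (fun τ hτ => hA2 _ (hsub τ hτ).1) hΛ (fun τ hτ τ' hτ' => by
    have := hlip _ (hsub τ hτ).2 _ (hsub τ' hτ').2
    simpa using this) (φ := φ) (D := D) (Q := Q) (by simpa using hφ) (by simpa using hφc) (w := w)
    (by rw [hw, fderiv_comp_add_right]; simp) hη
  filter_upwards [this] with r hr
  rw [← Real.circleAverage_map_add_const]
  simpa using hr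

noncomputable def Bf (P : V →L[ℝ] V) : V →L[ℝ] V →L[ℝ] ℝ :=
  innerSL ℝ + ((ContinuousLinearMap.compL ℝ V V ℝ).flip P).comp ((innerSL ℝ).comp P)

theorem Bf_apply (P : V →L[ℝ] V) (u v : V) : Bf P u v = inner ℝ u v + inner ℝ (P u) (P v) := by
  simp only [Bf, ContinuousLinearMap.add_apply, ContinuousLinearMap.comp_apply, ContinuousLinearMap.flip_apply, ContinuousLinearMap.compL_apply, innerSL_apply_apply]
  rfl

theorem Bf_symm (P : V →L[ℝ] V) (u v : V) : Bf P u v = Bf P v u := by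
  rw [Bf_apply, Bf_apply, real_inner_comm u, real_inner_comm (P u)]

theorem Bf_ge (P : V →L[ℝ] V) (u : V) : ‖u‖ ^ 2 ≤ Bf P u u := by
  rw [Bf_apply, real_inner_self_eq_norm_sq, real_inner_self_eq_norm_sq]
  nlinarith [sq_nonneg ‖P u‖]

theorem Bf_le {P : V →L[ℝ] V} {L : ℝ} (hP : ‖P‖ ≤ L) (u v : V) : |Bf P u v| ≤ (1 + L ^ 2) * (‖u‖ * ‖v‖) := by
  rw [Bf_apply]
  have h1 := abs_real_inner_le_norm u v
  have h2 := abs_real_inner_le_norm (P u) (P v)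
  have h3 := P.le_of_opNorm_le hP u
  have h4 := P.le_of_opNorm_le hP v
  have hL : 0 ≤ L := (norm_nonneg _).trans hP
  have h5 : ‖P u‖ * ‖P v‖ ≤ (L * ‖u‖) * (L * ‖v‖) := by gcongr
  refine (abs_add_le _ _).trans ?_
  nlinarith

theorem Bf_bessel {P : V →L[ℝ] V} (hP : ∀ v, P (P v) = -v) (e w : V) : Bf P e w ^ 2 + Bf P e (P w) ^ 2 ≤ Bf P e e * Bf P w w := by
  have h0 : Bf P w (P w) = 0 := by
    rw [Bf_apply, hP, inner_neg_right, real_inner_comm]; ring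
  have h1 : Bf P (P w) (P w) = Bf P w w := by
    rw [Bf_apply, Bf_apply, hP, inner_neg_neg]; ring
  by_cases hw : w = 0
  · simp [hw]
  obtain ⟨W, hW⟩ : ∃ W, W = Bf P w w := ⟨_, rfl⟩
  have hWp : 0 < W := by
    rw [hW]; exact lt_of_lt_of_le (by have := norm_pos_iff.2 hw; positivity) (Bf_ge P w)
  have h2 := (sq_nonneg _).trans (Bf_ge P (W • e - Bf P e w • w - Bf P e (P w) • P w))
  have h3 : Bf P (W • e - Bf P e w • w - Bf P e (P w) • P w) (W • e - Bf P e w • w - Bf P e (P w) • P w) =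
      W * (W * Bf P e e - Bf P e w ^ 2 - Bf P e (P w) ^ 2) := by
    simp only [map_sub, map_smul, ContinuousLinearMap.sub_apply, ContinuousLinearMap.smul_apply, smul_eq_mul]
    rw [Bf_symm P w e, Bf_symm P (P w) e, Bf_symm P (P w) w, h0, h1, ← hW]
    ring
  rw [h3] at h2
  have := nonneg_of_mul_nonneg_right h2 hWp
  rw [← hW]; linarith

theorem Bf_quad (P : V →L[ℝ] V) (p x : V) (c : ℝ) : HasQuad (fun y => Bf P (y - p) (y - p) + c) x ((2:ℝ) • Bf P (x - p)) ((2:ℝ) • Bf P) := by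
  intro ε hε
  refine Eventually.of_forall fun h => ?_
  have : Bf P (x + h - p) (x + h - p) + c - (Bf P (x - p) (x - p) + c) - ((2:ℝ) • Bf P (x - p)) h - 1 / 2 * (((2:ℝ) • Bf P) h) h = 0 := by
    have e : x + h - p = (x - p) + h := by abel
    rw [e]
    simp only [map_add, ContinuousLinearMap.add_apply, ContinuousLinearMap.smul_apply, smul_eq_mul]
    rw [Bf_symm P h (x - p)]; ring
  rw [this, abs_zero]; positivity

theorem NN_le {A : V → V →L[ℝ] V} {L : ℝ} (hA : NiceJ A L) (x w : V) : ‖NN A x w‖ ≤ 2 * L ^ 2 * ‖w‖ ^ 2 := by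
  have hL := hA.nonneg
  have hw := (A x).le_of_opNorm_le (hA.bd x) w
  have h1 : ∀ a b : V, ‖fderiv ℝ A x a b‖ ≤ L * ‖a‖ * ‖b‖ := fun a b => by
    refine (ContinuousLinearMap.le_opNorm _ _).trans ?_
    have := (fderiv ℝ A x).le_of_opNorm_le (hA.bd1 x) a
    gcongr
  refine (norm_sub_le _ _).trans ?_
  have e1 := h1 (A x w) w
  have e2 := h1 w (A x w)
  have e3 : L * ‖A x w‖ * ‖w‖ ≤ L * (L * ‖w‖) * ‖w‖ := by gcongr
  have e4 : L * ‖w‖ * ‖A x w‖ ≤ L * ‖w‖ * (L * ‖w‖) := by gcongr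
  linarith

noncomputable def c1 (L : ℝ) : ℝ := 8 * (1 + L ^ 2) * L ^ 2
noncomputable def c2 (L : ℝ) : ℝ := 3 * (1 + L ^ 2) ^ 2 * L ^ 2
noncomputable def cS (L : ℝ) : ℝ := c1 L / 2 + 2 * c2 L

theorem levi_bounds {A : V → V →L[ℝ] V} {L : ℝ} (hA : NiceJ A L) {p x : V} (hp : ∀ v, A p (A p v) = -v) (hx : ‖x - p‖ ≤ 1) (w : V) :
    4 * Bf (A p) w w - c1 L * (‖x - p‖ * ‖w‖ ^ 2) ≤ 2 * Bf (A p) w w + 2 * Bf (A p) (A x w) (A x w) + 2 * Bf (A p) (x - p) (NN A x w) ∧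
    Bf (A p) (x - p) w ^ 2 + Bf (A p) (x - p) (A x w) ^ 2 ≤ Bf (A p) (x - p) (x - p) * Bf (A p) w w + c2 L * (‖x - p‖ ^ 3 * ‖w‖ ^ 2) := by
  have hL := hA.nonneg
  obtain ⟨e, he⟩ : ∃ e, e = x - p := ⟨_, rfl⟩
  obtain ⟨z, hz⟩ : ∃ z, z = A p w := ⟨_, rfl⟩
  obtain ⟨d, hd⟩ : ∃ d, d = A x w - A p w := ⟨_, rfl⟩
  obtain ⟨B, hB⟩ : ∃ B, B = Bf (A p) := ⟨_, rfl⟩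
  obtain ⟨M, hM⟩ : ∃ M, M = 1 + L ^ 2 := ⟨_, rfl⟩
  have hM0 : 0 ≤ M := by rw [hM]; positivity
  have hle : ∀ u v, |B u v| ≤ M * (‖u‖ * ‖v‖) := fun u v => by rw [hB, hM]; exact Bf_le (hA.bd p) u v
  have hsym : ∀ u v, B u v = B v u := fun u v => by rw [hB]; exact Bf_symm _ u v
  have hge : ∀ u, 0 ≤ B u u := fun u => (sq_nonneg _).trans (by rw [hB]; exact Bf_ge _ u)
  have hbes : B e w ^ 2 + B e z ^ 2 ≤ B e e * B w w := by rw [hB, hz]; exact Bf_bessel hp e w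
  have hzz : B z z = B w w := by
    rw [hB, hz, Bf_apply, Bf_apply, hp, inner_neg_neg]; ring
  have hAx : A x w = z + d := by rw [hd, hz]; abel
  have hdn : ‖d‖ ≤ L * ‖e‖ * ‖w‖ := by
    rw [hd, he, ← ContinuousLinearMap.sub_apply]
    exact (ContinuousLinearMap.le_opNorm _ _).trans (mul_le_mul_of_nonneg_right (hA.lip x p) (norm_nonneg _))
  have hzn : ‖z‖ ≤ L * ‖w‖ := by rw [hz]; exact (A p).le_of_opNorm_le (hA.bd p) w
  have hN := NN_le hA x w
  rw [← he] at hx ⊢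
  rw [← hB, hAx]
  obtain ⟨s, hs⟩ : ∃ s, s = ‖e‖ := ⟨_, rfl⟩
  obtain ⟨t, ht⟩ : ∃ t, t = ‖w‖ := ⟨_, rfl⟩
  have hs0 : 0 ≤ s := by rw [hs]; positivity
  have ht0 : 0 ≤ t := by rw [ht]; positivity
  rw [← hs] at hx hdn ⊢
  rw [← ht] at hdn hzn hN ⊢
  have b1 : |B z d| ≤ M * (L * t * (L * s * t)) := (hle z d).trans (by gcongr)
  have b2 : |B e (NN A x w)| ≤ M * (s * (2 * L ^ 2 * t ^ 2)) := (hle _ _).trans (by rw [← hs]; gcongr)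
  have b3 : |B e z| ≤ M * (s * (L * t)) := (hle _ _).trans (by rw [← hs]; gcongr)
  have b4 : |B e d| ≤ M * (s * (L * s * t)) := (hle _ _).trans (by rw [← hs]; gcongr)
  unfold c1 c2
  rw [← hM]
  constructor
  · simp only [map_add, ContinuousLinearMap.add_apply]
    rw [hsym d z, hzz]
    have := hge d
    linarith [(abs_le.1 b1).1, (abs_le.1 b2).1]
  · rw [map_add]
    have b5 : |B e z| * |B e d| ≤ (M * (s * (L * t))) * (M * (s * (L * s * t))) := by gcongr
    have b6 : |B e d| ^ 2 ≤ (M * (s * (L * s * t))) ^ 2 := by gcongr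
    have b7 : (M * (s * (L * s * t))) ^ 2 ≤ M ^ 2 * L ^ 2 * (s ^ 3 * t ^ 2) := by
      have : (M * (s * (L * s * t))) ^ 2 = M ^ 2 * L ^ 2 * (s ^ 3 * t ^ 2) * s := by ring
      rw [this]
      have : 0 ≤ M ^ 2 * L ^ 2 * (s ^ 3 * t ^ 2) := by positivity
      nlinarith
    rw [sq_abs] at b6
    have b8 : (M * (s * (L * t))) * (M * (s * (L * s * t))) = M ^ 2 * L ^ 2 * (s ^ 3 * t ^ 2) := by ring
    rw [← abs_mul] at b5
    have := le_abs_self (B e z * B e d)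
    have b9 : 3 * M ^ 2 * L ^ 2 * (s ^ 3 * t ^ 2) = 3 * (M ^ 2 * L ^ 2 * (s ^ 3 * t ^ 2)) := by ring
    rw [b9]
    nlinarith

end P4
end RS

namespace RS

section P4b
variable {V : Type*} [NormedAddCommGroup V] [InnerProductSpace ℝ V] [FiniteDimensional ℝ V]

noncomputable def Th (a t : ℝ) : ℝ := 1 / 2 * Real.log t + a * √t

theorem Th_mono {a : ℝ} (ha : 0 ≤ a) {s t : ℝ} (hs : 0 < s) (hst : s ≤ t) : Th a s ≤ Th a t := by
  unfold Th
  have h1 := Real.log_le_log hs hst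
  have h2 := mul_le_mul_of_nonneg_left (Real.sqrt_le_sqrt hst) ha
  linarith

theorem Th_cont (a : ℝ) {t : ℝ} (ht : 0 < t) : ContinuousAt (Th a) t := by
  unfold Th
  have := Real.continuousAt_log ht.ne'
  exact (continuousAt_const.mul this).add (continuousAt_const.mul Real.continuous_sqrt.continuousAt)

theorem Th_SQ (a : ℝ) {s : ℝ} (hs : 0 < s) : SQ (Th a) (s ^ 2) (1 / (2 * s ^ 2) + a / (2 * s)) (-1 / (2 * s ^ 4) - a / (4 * s ^ 3)) := by
  have hsq : √(s ^ 2) = s := Real.sqrt_sq hs.le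
  have hp : 0 < s ^ 2 := by positivity
  have h1 : ∀ᶠ y in 𝓝 (s ^ 2), HasDerivAt (Th a) (1 / 2 * y⁻¹ + a * (1 / (2 * √y))) y := by
    filter_upwards [eventually_gt_nhds hp] with y hy
    exact ((Real.hasDerivAt_log hy.ne').const_mul (1/2)).add ((Real.hasDerivAt_sqrt hy.ne').const_mul a)
  have h2 : HasDerivAt (fun y => 1 / 2 * y⁻¹ + a * (1 / (2 * √y))) (-1 / (2 * s ^ 4) - a / (4 * s ^ 3)) (s ^ 2) := by
    have e1 := (hasDerivAt_inv hp.ne').const_mul (1/2:ℝ)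
    have e2 := ((((Real.hasDerivAt_sqrt hp.ne').const_mul 2).fun_inv (by rw [hsq]; positivity)).const_mul a)
    have := e1.add e2
    simp only [one_div] at *
    refine (this.congr_deriv ?_)
    rw [hsq]
    field_simp
    ring
  have := SQ.of_deriv h1 h2
  convert this using 1
  rw [hsq]; field_simp

theorem levi_alg {s e W o X S Bee C1 C2 A0 C : ℝ} (hs : 0 < s) (he : 0 ≤ e) (hes : e ≤ s) (hB : Bee ≤ s ^ 2) (hW : o ≤ W) (ho : 0 ≤ o)
    (hC1 : 0 ≤ C1) (hC2 : 0 ≤ C2) (hC : C = C1 / 2 + 2 * C2) (hA0 : A0 = 2 * C) (heC : 2 * C * e ≤ 1)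
    (hX : 4 * W - C1 * (e * o) ≤ X) (hS : S ≤ Bee * W + C2 * (e ^ 3 * o)) :
    0 ≤ (1 / (2 * s ^ 2) + A0 / (2 * s)) * X + (-1 / (2 * s ^ 4) - A0 / (4 * s ^ 3)) * (4 * S) := by
  have hC0 : 0 ≤ C := by rw [hC]; positivity
  have hA00 : 0 ≤ A0 := by rw [hA0]; positivity
  have hW0 : 0 ≤ W := ho.trans hW
  have e1 : (1 / (2 * s ^ 2) + A0 / (2 * s)) * X + (-1 / (2 * s ^ 4) - A0 / (4 * s ^ 3)) * (4 * S) =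
     ((s ^ 2 / 2 + A0 * s ^ 3 / 2) * X - (2 + A0 * s) * S) / s ^ 4 := by field_simp; ring
  rw [e1]
  apply div_nonneg _ (by positivity)
  have f1 : (s ^ 2 / 2 + A0 * s ^ 3 / 2) * (4 * W - C1 * (e * o)) ≤ (s ^ 2 / 2 + A0 * s ^ 3 / 2) * X := by gcongr
  have f2 : S ≤ s ^ 2 * W + C2 * (e * s ^ 2 * o) := by
    refine hS.trans ?_
    have : e ^ 3 ≤ e * s ^ 2 := by
      have : e ^ 2 ≤ s ^ 2 := by gcongr
      nlinarith
    gcongr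
  have f3 : (2 + A0 * s) * S ≤ (2 + A0 * s) * (s ^ 2 * W + C2 * (e * s ^ 2 * o)) := by gcongr
  have f4 : (s ^ 2 / 2 + A0 * s ^ 3 / 2) * (4 * W - C1 * (e * o)) - (2 + A0 * s) * (s ^ 2 * W + C2 * (e * s ^ 2 * o)) =
     s ^ 2 * (A0 * s * W - e * o * (C + A0 * s * (C1 / 2 + C2))) := by rw [hC]; ring
  have f5 : 0 ≤ A0 * s * W - e * o * (C + A0 * s * (C1 / 2 + C2)) := by
    have g1 : A0 * s * o ≤ A0 * s * W := by gcongr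
    have g2 : e * o * C ≤ s * o * C := by gcongr
    have g3 : e * o * (A0 * s * (C1 / 2 + C2)) ≤ e * o * (A0 * s * C) := by
      rw [hC]; gcongr; linarith
    have g4 : e * o * (A0 * s * C) = (2 * C * e) * (s * o * C) := by rw [hA0]; ring
    have g5 : (2 * C * e) * (s * o * C) ≤ 1 * (s * o * C) := by gcongr
    have g6 : A0 * s * o = 2 * (s * o * C) := by rw [hA0]; ring
    linarith
  have f6 := mul_nonneg (sq_nonneg s) f5
  linarith

theorem levi_nonneg {A : V → V →L[ℝ] V} {L : ℝ} (hA : NiceJ A L) {p x : V} (hp : ∀ v, A p (A p v) = -v) (hx : ‖x - p‖ ≤ 1)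
    (hx2 : 2 * cS L * ‖x - p‖ ≤ 1) {κ : ℝ} (hκ : 0 < κ) :
    ∃ (D : V →L[ℝ] ℝ) (Q : V →L[ℝ] V →L[ℝ] ℝ), HasQuad (fun y => Th (2 * cS L) (Bf (A p) (y - p) (y - p) + κ ^ 2)) x D Q ∧
      ∀ w, 0 ≤ Q w w + Q (A x w) (A x w) + D (NN A x w) := by
  obtain ⟨s, hs⟩ : ∃ s, s = √(Bf (A p) (x - p) (x - p) + κ ^ 2) := ⟨_, rfl⟩
  have hge := Bf_ge (A p) (x - p)
  have hBn : 0 ≤ Bf (A p) (x - p) (x - p) := (sq_nonneg _).trans hge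
  have hBp : 0 < Bf (A p) (x - p) (x - p) + κ ^ 2 := add_pos_of_nonneg_of_pos hBn (by positivity)
  have hs0 : 0 < s := by rw [hs]; exact Real.sqrt_pos.2 hBp
  have hs2 : s ^ 2 = Bf (A p) (x - p) (x - p) + κ ^ 2 := by rw [hs]; exact Real.sq_sqrt hBp.le
  have hL := hA.nonneg
  have hq := (Bf_quad (A p) p x (κ ^ 2)).comp (Θ := Th (2 * cS L)) (a := (1 / (2 * s ^ 2) + (2 * cS L) / (2 * s)))
    (b := (-1 / (2 * s ^ 4) - (2 * cS L) / (4 * s ^ 3))) (by rw [← hs2]; exact Th_SQ _ hs0)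
  refine ⟨_, _, hq, fun w => ?_⟩
  obtain ⟨l1, l2⟩ := levi_bounds hA hp hx w
  have := levi_alg (s := s) (e := ‖x - p‖) (W := Bf (A p) w w) (o := ‖w‖ ^ 2) (Bee := Bf (A p) (x - p) (x - p)) (C1 := c1 L) (C2 := c2 L) (C := cS L)
    (A0 := 2 * cS L) hs0 (norm_nonneg _) (by
      apply le_of_sq_le_sq _ hs0.le
      rw [hs2]; nlinarith) (by rw [hs2]; nlinarith) (Bf_ge _ w) (by positivity) (by unfold c1; positivity) (by unfold c2; positivity) rfl rfl hx2 l1 l2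
  refine this.trans (le_of_eq ?_)
  simp only [ContinuousLinearMap.add_apply, ContinuousLinearMap.smul_apply, ContinuousLinearMap.smulRight_apply, smul_eq_mul]
  ring

end P4b
end RS

namespace RS

section P4c
variable {V : Type*} [NormedAddCommGroup V] [InnerProductSpace ℝ V] [FiniteDimensional ℝ V]

theorem ca_add' {f g : ℂ → ℝ} {c : ℂ} {r : ℝ} (hf : CircleIntegrable f c r) (hg : CircleIntegrable g c r) :
    Real.circleAverage (fun z => f z + g z) c r = Real.circleAverage f c r + Real.circleAverage g c r :=
  Real.circleAverage_add hf hg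

theorem ca_sub' {f g : ℂ → ℝ} {c : ℂ} {r : ℝ} (hf : CircleIntegrable f c r) (hg : CircleIntegrable g c r) :
    Real.circleAverage (fun z => f z - g z) c r = Real.circleAverage f c r - Real.circleAverage g c r :=
  Real.circleAverage_sub hf hg

theorem ca_mul' {f : ℂ → ℝ} {c : ℂ} {r a : ℝ}  :
    Real.circleAverage (fun z => a * f z) c r = a * Real.circleAverage f c r :=
  Real.circleAverage_smul (a := a) (f := f)

theorem schwarz_sub {A : V → V →L[ℝ] V} {L : ℝ} (hA : NiceJ A L) {f : ℂ → V} {s : Set ℂ} (hs : IsOpen s) (hf : JH A f s) (hl : LocLip f s)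
    (hA2 : ∀ τ ∈ s, ∀ v, A (f τ) (A (f τ) v) = -v) {p : V} (hp : ∀ v, A p (A p v) = -v)
    {ζ ζ1 : ℂ} (hζ : ζ ∈ s) (hx : ‖f ζ - p‖ ≤ 1)
    (hx2 : 2 * cS L * ‖f ζ - p‖ ≤ 1) {κ : ℝ} (hκ : 0 < κ) {δ : ℝ} (hδ : 0 < δ) (hζ1 : ζ ≠ ζ1) :
    ∀ᶠ r in 𝓝[>] (0:ℝ), (Th (2 * cS L) (Bf (A p) (f ζ - p) (f ζ - p) + κ ^ 2) + δ * ‖ζ - ζ1‖ ^ 2 - (1 - δ) * Real.log ‖ζ - ζ1‖) <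
      Real.circleAverage (fun ζ => Th (2 * cS L) (Bf (A p) (f ζ - p) (f ζ - p) + κ ^ 2) + δ * ‖ζ - ζ1‖ ^ 2 - (1 - δ) * Real.log ‖ζ - ζ1‖) ζ r := by
  obtain ⟨D, Q, hQ, hpos⟩ := levi_nonneg hA hp hx hx2 hκ
  have hφc : ∀ y, ContinuousAt (fun y => Th (2 * cS L) (Bf (A p) (y - p) (y - p) + κ ^ 2)) y := fun y => by
    have : 0 < Bf (A p) (y - p) (y - p) + κ ^ 2 := add_pos_of_nonneg_of_pos ((sq_nonneg _).trans (Bf_ge (A p) (y - p))) (by positivity)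
    exact ContinuousAt.comp (g := Th (2 * cS L)) (Th_cont _ this) (by fun_prop)
  have h1 := M2' hA hs hf hl hA2 hζ hQ (Eventually.of_forall hφc) rfl (half_pos hδ)
  have hpos' : 0 < ‖ζ - ζ1‖ := norm_pos_iff.2 (sub_ne_zero.2 hζ1)
  obtain ⟨R, hR, hb⟩ := Metric.isOpen_iff.1 hs ζ hζ
  filter_upwards [h1, ca_log hζ1, Ioo_mem_nhdsGT hpos', Ioo_mem_nhdsGT hR] with r h1 h2 h3 h4
  have hr : |r| = r := abs_of_pos h3.1
  have i1 : CircleIntegrable (fun ζ => Th (2 * cS L) (Bf (A p) (f ζ - p) (f ζ - p) + κ ^ 2)) ζ r := circInt_of_cont fun τ hτ => by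
    have hτs : τ ∈ s := hb (by rw [hr] at hτ; rw [mem_ball, hτ]; exact h4.2)
    exact ContinuousAt.comp (g := (fun y => Th (2 * cS L) (Bf (A p) (y - p) (y - p) + κ ^ 2))) (hφc _) (hf τ hτs).1.continuousAt
  have i2 : CircleIntegrable (fun ζ => δ * ‖ζ - ζ1‖ ^ 2) ζ r := circInt_of_cont fun τ hτ => by fun_prop
  have i3 : CircleIntegrable (fun ζ => (1 - δ) * Real.log ‖ζ - ζ1‖) ζ r := circInt_of_cont fun τ hτ => by
    have : ‖τ - ζ1‖ ≠ 0 := fun h0 => by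
      rw [norm_eq_zero, sub_eq_zero] at h0
      rw [h0, mem_sphere, hr, dist_eq_norm, norm_sub_rev] at hτ
      linarith [h3.2]
    exact continuousAt_const.mul ((by fun_prop : ContinuousAt (fun τ => ‖τ - ζ1‖) τ).log this)
  rw [ca_sub' (i1.fun_add i2) i3, ca_add' i1 i2, ca_mul', ca_mul', ca_sq, h2]
  have := (abs_le.1 h1).1
  have h5 := hpos (fderiv ℝ f ζ 1)
  have h6 : 0 < δ * r ^ 2 := by have := h3.1; positivity
  have h7 := mul_nonneg (by positivity : 0 ≤ r ^ 2 / 4) h5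
  linarith

theorem inner_lim {K a δ : ℝ} (hK : 0 < K) (hδ : 0 < δ) (Z : ℝ) : ∀ᶠ ρ in 𝓝[>] (0:ℝ), Th a (K * ρ ^ 2) + δ * ρ ^ 2 - (1 - δ) * Real.log ρ ≤ Z := by
  have h1 : Tendsto (fun ρ : ℝ => 1 / 2 * Real.log K + a * (√K * ρ) + δ * ρ ^ 2) (𝓝[>] 0) (𝓝 (1 / 2 * Real.log K + a * (√K * 0) + δ * 0 ^ 2)) := by
    apply Tendsto.mono_left _ nhdsWithin_le_nhds
    exact Continuous.tendsto (by fun_prop) 0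
  have h2 : Tendsto (fun ρ : ℝ => δ * Real.log ρ) (𝓝[>] 0) atBot := Real.tendsto_log_nhdsGT_zero.const_mul_atBot hδ
  have h3 := h1.add_atBot h2
  filter_upwards [h3.eventually_le_atBot Z, self_mem_nhdsWithin] with ρ h4 h5
  have h5 : 0 < ρ := h5
  refine le_trans (le_of_eq ?_) h4
  unfold Th
  rw [Real.log_mul hK.ne' (by positivity), Real.log_pow, Real.sqrt_mul hK.le, Real.sqrt_sq h5.le]
  push_cast
  ring

theorem schwarz_pt {A : V → V →L[ℝ] V} {L : ℝ} (hA : NiceJ A L) {f : ℂ → V} {ζ1 : ℂ} {d σ : ℝ} (hd : 0 < d) (hσ : 0 < σ) (hσ1 : σ ≤ 1)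
    (hσ2 : 2 * cS L * σ ≤ 1)
    (hf : JH A f (ball ζ1 d)) (hl : LocLip f (ball ζ1 d))
    (hA2 : ∀ τ ∈ ball ζ1 d, ∀ v, A (f τ) (A (f τ) v) = -v) (hb : ∀ ζ ∈ ball ζ1 d, ‖f ζ - f ζ1‖ ≤ σ)
    {ζ : ℂ} (hζ0 : ζ ≠ ζ1) (hζ : ‖ζ - ζ1‖ < d / 2) (hfζ : f ζ ≠ f ζ1) {δ : ℝ} (hδ : 0 < δ) (hδ1 : δ < 1) :
    Th (2 * cS L) (Bf (A (f ζ1)) (f ζ - f ζ1) (f ζ - f ζ1)) + δ * ‖ζ - ζ1‖ ^ 2 - (1 - δ) * Real.log ‖ζ - ζ1‖ ≤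
      Th (2 * cS L) ((2 + L ^ 2) * σ ^ 2) + δ * (d / 2) ^ 2 - (1 - δ) * Real.log (d / 2) := by
  have hL := hA.nonneg
  have hcS : 0 ≤ 2 * cS L := by unfold cS c1 c2; positivity
  have h10 : ζ1 ∈ ball ζ1 d := mem_ball_self hd
  obtain ⟨p, hpdef⟩ : ∃ p, p = f ζ1 := ⟨_, rfl⟩
  rw [← hpdef] at hb hfζ ⊢
  have hp : ∀ v, A p (A p v) = -v := by rw [hpdef]; exact hA2 ζ1 h10
  have hBge : ∀ v, 0 ≤ Bf (A p) v v := fun v => (sq_nonneg _).trans (Bf_ge (A p) v)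
  have hBle : ∀ v, Bf (A p) v v ≤ (1 + L ^ 2) * ‖v‖ ^ 2 := fun v => by
    have := (abs_le.1 (Bf_le (hA.bd p) v v)).2
    rwa [← sq] at this
  obtain ⟨Z, hZ⟩ : ∃ Z, Z = Th (2 * cS L) ((2 + L ^ 2) * σ ^ 2) + δ * (d / 2) ^ 2 - (1 - δ) * Real.log (d / 2) := ⟨_, rfl⟩
  rw [← hZ]
  have hζp : 0 < ‖ζ - ζ1‖ := norm_pos_iff.2 (sub_ne_zero.2 hζ0)
  -- local Lipschitz at ζ1
  obtain ⟨R, hR, Λ, hΛ, hlip⟩ := hl ζ1 h10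
  have hev := inner_lim (K := (1 + L ^ 2) * Λ ^ 2 + 1) (a := 2 * cS L) (by positivity) hδ Z
  have v1 : ∀ᶠ r in 𝓝[>] (0:ℝ), r ∈ Ioo 0 ‖ζ - ζ1‖ := Ioo_mem_nhdsGT hζp
  have v2 : ∀ᶠ r in 𝓝[>] (0:ℝ), r ∈ Ioo 0 R := Ioo_mem_nhdsGT hR
  have v3 : ∀ᶠ r in 𝓝[>] (0:ℝ), r ∈ Ioo 0 σ := Ioo_mem_nhdsGT hσ
  obtain ⟨ρ, e1, e2, e3, e4⟩ := (hev.and (v1.and (v2.and v3))).exists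
  have hρ := e2.1
  have hsubd : ∀ z, ‖z - ζ1‖ ≤ d / 2 → z ∈ ball ζ1 d := fun z hz => by
    rw [mem_ball, dist_eq_norm]; linarith
  have hn : Continuous fun z : ℂ => ‖z - ζ1‖ := by fun_prop
  have hann := max_princ (K := {z | ρ ≤ ‖z - ζ1‖ ∧ ‖z - ζ1‖ ≤ d / 2}) (U := {z | ρ < ‖z - ζ1‖ ∧ ‖z - ζ1‖ < d / 2})
    (h := fun ζ => Th (2 * cS L) (Bf (A p) (f ζ - p) (f ζ - p) + ρ ^ 2) + δ * ‖ζ - ζ1‖ ^ 2 - (1 - δ) * Real.log ‖ζ - ζ1‖) (z := ζ)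
    (by
      apply (isCompact_closedBall ζ1 (d/2)).of_isClosed_subset
      · exact (isClosed_le continuous_const hn).inter (isClosed_le hn continuous_const)
      · intro z hz; rw [mem_closedBall, dist_eq_norm]; exact hz.2)
    ((isOpen_lt continuous_const hn).inter (isOpen_lt hn continuous_const))
    (fun z hz => ⟨hz.1.le, hz.2.le⟩)
    (by
      intro z hz
      apply ContinuousAt.continuousWithinAt
      have c1 : ContinuousAt f z := (hf z (hsubd z hz.2)).1.continuousAt
      have c2 : ContinuousAt (fun z => ‖z - ζ1‖) z := by fun_prop
      have c3 : ContinuousAt (fun z => Bf (A p) (f z - p) (f z - p) + ρ ^ 2) z :=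
        ContinuousAt.comp (g := fun y => Bf (A p) (y - p) (y - p) + ρ ^ 2) (by fun_prop) c1
      have c4 : 0 < Bf (A p) (f z - p) (f z - p) + ρ ^ 2 := add_pos_of_nonneg_of_pos (hBge _) (by positivity)
      have c5 := ContinuousAt.comp (g := Th (2 * cS L)) (f := fun z => Bf (A p) (f z - p) (f z - p) + ρ ^ 2) (x := z) (Th_cont _ c4) c3
      exact (c5.add (continuousAt_const.mul (c2.pow 2))).sub (continuousAt_const.mul (c2.log (lt_of_lt_of_le hρ hz.1).ne')))
    (fun z hz => by
      have hzd := hsubd z hz.2.le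
      have hz1 : z ≠ ζ1 := by rintro rfl; simp at hz; linarith [hz.1]
      exact (schwarz_sub hA isOpen_ball hf hl hA2 hp hzd ((hb z hzd).trans hσ1) ((mul_le_mul_of_nonneg_left (hb z hzd) hcS).trans hσ2) hρ hδ hz1).frequently)
    ⟨e2.2, hζ⟩
  obtain ⟨z, ⟨hzK, hzU⟩, hle⟩ := hann
  have hzB : Bf (A p) (ζ - ζ1 |> fun _ => f ζ - p) (f ζ - p) > 0 := lt_of_lt_of_le (by
    have := norm_pos_iff.2 (sub_ne_zero.2 hfζ); positivity) (Bf_ge (A p) (f ζ - p))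
  have hstep := Th_mono hcS hzB (le_add_of_nonneg_right (sq_nonneg ρ))
  have key : Th (2 * cS L) (Bf (A p) (f z - p) (f z - p) + ρ ^ 2) + δ * ‖z - ζ1‖ ^ 2 - (1 - δ) * Real.log ‖z - ζ1‖ ≤ Z := by
    have hpz : 0 < Bf (A p) (f z - p) (f z - p) + ρ ^ 2 := add_pos_of_nonneg_of_pos (hBge _) (by positivity)
    rcases hzK.1.eq_or_lt with h | h
    · rw [← h]
      refine le_trans ?_ e1
      gcongr
      apply Th_mono hcS hpz
      have h1 : ‖f z - p‖ ≤ Λ * ρ := by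
        rw [h, hpdef]
        exact hlip z (by rw [mem_ball, dist_eq_norm, ← h]; exact e3.2) ζ1 (mem_ball_self hR)
      have h2 : ‖f z - p‖ ^ 2 ≤ (Λ * ρ) ^ 2 := by gcongr
      have h3 := mul_le_mul_of_nonneg_left h2 (by positivity : 0 ≤ 1 + L ^ 2)
      have := hBle (f z - p)
      linarith
    · have h2 : ‖z - ζ1‖ = d / 2 := le_antisymm hzK.2 (not_lt.1 fun h' => hzU ⟨h, h'⟩)
      rw [h2, hZ]
      gcongr
      apply Th_mono hcS hpz
      have h2 : ‖f z - p‖ ^ 2 ≤ σ ^ 2 := by gcongr; exact hb z (hsubd z hzK.2)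
      have h3 := mul_le_mul_of_nonneg_left h2 (by positivity : 0 ≤ 1 + L ^ 2)
      have := hBle (f z - p)
      have : ρ ^ 2 ≤ σ ^ 2 := by gcongr; exact e4.2.le
      linarith
  simp only at hle hstep
  linarith

theorem schwarz {A : V → V →L[ℝ] V} {L : ℝ} (hA : NiceJ A L) : ∃ C > 0, ∃ R0 > 0, ∀ (f : ℂ → V) (ζ1 : ℂ) (d σ : ℝ), 0 < d → 0 < σ → σ ≤ R0 →
    JH A f (ball ζ1 d) → LocLip f (ball ζ1 d) →
    (∀ τ ∈ ball ζ1 d, ∀ v, A (f τ) (A (f τ) v) = -v) → (∀ ζ ∈ ball ζ1 d, ‖f ζ - f ζ1‖ ≤ σ) → ‖fderiv ℝ f ζ1‖ ≤ C * σ / d := by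
  have hL := hA.nonneg
  have hcS : 0 ≤ 2 * cS L := by unfold cS c1 c2; positivity
  refine ⟨2 * √(2 + L ^ 2) * Real.exp (√(2 + L ^ 2)), by positivity, 1 / (2 * cS L + 1), by positivity, fun f ζ1 d σ hd hσ hσR hf hl hA2 hb => ?_⟩
  have hσ0 : σ * (2 * cS L + 1) ≤ 1 := (le_div_iff₀ (by positivity)).1 hσR
  have hσ1 : σ ≤ 1 := by nlinarith
  have hσ2 : 2 * cS L * σ ≤ 1 := by nlinarith
  apply (hf ζ1 (mem_ball_self hd)).1.hasFDerivAt.le_of_lip' (by positivity)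
  filter_upwards [ball_mem_nhds ζ1 (half_pos hd)] with ζ hζ
  rw [mem_ball, dist_eq_norm] at hζ
  by_cases hfζ : f ζ = f ζ1
  · rw [hfζ, sub_self, norm_zero]; positivity
  have hζ0 : ζ ≠ ζ1 := fun h => hfζ (by rw [h])
  have hζp : 0 < ‖ζ - ζ1‖ := norm_pos_iff.2 (sub_ne_zero.2 hζ0)
  have hfp : 0 < ‖f ζ - f ζ1‖ := norm_pos_iff.2 (sub_ne_zero.2 hfζ)
  have h1 := fun (δ : ℝ) (h : 0 < δ) (h' : δ < 1) => schwarz_pt hA hd hσ hσ1 hσ2 hf hl hA2 hb hζ0 hζ hfζ h h'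
  obtain ⟨T1, hT1⟩ : ∃ x, x = Th (2 * cS L) (Bf (A (f ζ1)) (f ζ - f ζ1) (f ζ - f ζ1)) := ⟨_, rfl⟩
  obtain ⟨T2, hT2⟩ : ∃ x, x = Th (2 * cS L) ((2 + L ^ 2) * σ ^ 2) := ⟨_, rfl⟩
  rw [← hT1, ← hT2] at h1
  have h2 : T1 - Real.log ‖ζ - ζ1‖ ≤ T2 - Real.log (d / 2) := by
    have t1 : Tendsto (fun δ : ℝ => T1 + δ * ‖ζ - ζ1‖ ^ 2 - (1 - δ) * Real.log ‖ζ - ζ1‖) (𝓝[>] 0) (𝓝 (T1 + 0 * ‖ζ - ζ1‖ ^ 2 - (1 - 0) * Real.log ‖ζ - ζ1‖)) :=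
      (Continuous.tendsto (by fun_prop) 0).mono_left nhdsWithin_le_nhds
    have t2 : Tendsto (fun δ : ℝ => T2 + δ * (d / 2) ^ 2 - (1 - δ) * Real.log (d / 2)) (𝓝[>] 0) (𝓝 (T2 + 0 * (d / 2) ^ 2 - (1 - 0) * Real.log (d / 2))) :=
      (Continuous.tendsto (by fun_prop) 0).mono_left nhdsWithin_le_nhds
    have := le_of_tendsto_of_tendsto t1 t2 (by
      filter_upwards [Ioo_mem_nhdsGT (zero_lt_one' ℝ)] with δ hδ
      exact h1 δ hδ.1 hδ.2)
    linarith
  have h3 : Real.log ‖f ζ - f ζ1‖ ≤ T1 := by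
    have := Th_mono hcS (by positivity) (Bf_ge (A (f ζ1)) (f ζ - f ζ1))
    rw [hT1]
    refine le_trans ?_ this
    unfold Th
    rw [Real.log_pow, Real.sqrt_sq hfp.le]
    push_cast
    have := mul_nonneg hcS hfp.le
    linarith
  have h4 : T2 ≤ Real.log (√(2 + L ^ 2) * σ) + √(2 + L ^ 2) := by
    rw [hT2]; unfold Th
    have e : (2 + L ^ 2) * σ ^ 2 = (√(2 + L ^ 2) * σ) ^ 2 := by
      rw [mul_pow, Real.sq_sqrt (by positivity)]
    rw [e, Real.log_pow, Real.sqrt_sq (by positivity)]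
    push_cast
    have := mul_le_mul_of_nonneg_left hσ2 (Real.sqrt_nonneg (2 + L ^ 2))
    linarith
  have h5 : Real.log ‖f ζ - f ζ1‖ ≤ Real.log (2 * √(2 + L ^ 2) * Real.exp (√(2 + L ^ 2)) * σ / d * ‖ζ - ζ1‖) := by
    have e : 2 * √(2 + L ^ 2) * Real.exp (√(2 + L ^ 2)) * σ / d * ‖ζ - ζ1‖ = (√(2 + L ^ 2) * σ) * Real.exp (√(2 + L ^ 2)) * ‖ζ - ζ1‖ / (d / 2) := by
      field_simp
    rw [e, Real.log_div (by positivity) (by positivity), Real.log_mul (by positivity) (by positivity), Real.log_mul (by positivity) (by positivity), Real.log_exp]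
    linarith
  exact (Real.log_le_log_iff hfp (by positivity)).1 h5

end P4c
end RS

namespace RS

section P4d
variable {V : Type*} [NormedAddCommGroup V] [InnerProductSpace ℝ V] [FiniteDimensional ℝ V]

theorem locLip_baire {f : ℂ → V} {s F : Set ℂ} (hd : ∀ ζ ∈ s, DifferentiableAt ℝ f ζ) (hFs : F ⊆ s) (hF : IsLocallyClosed F)
    (hne : F.Nonempty) : ∃ ζ1 ∈ F, ∃ δ > 0, ∃ M ≥ (1:ℝ), ∀ ζ ∈ F, ‖ζ - ζ1‖ < δ → ∀ ζ' ∈ s, ‖ζ' - ζ‖ < 1 / M → ‖f ζ' - f ζ‖ ≤ M * ‖ζ' - ζ‖ := by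
  have : LocallyCompactSpace F := hF.locallyCompactSpace
  have : Nonempty F := hne.to_subtype
  have hcf : Continuous fun ζ : F => f ζ := continuous_iff_continuousAt.2 fun ζ =>
    (hd ζ (hFs ζ.2)).continuousAt.comp continuous_subtype_val.continuousAt
  let Em : ℕ → Set F := fun m => {ζ : F | ∀ ζ' ∈ s, ‖ζ' - ζ‖ < 1 / ((m:ℝ) + 1) → ‖f ζ' - f ζ‖ ≤ ((m:ℝ) + 1) * ‖ζ' - ζ‖}
  have hcl : ∀ m, IsClosed (Em m) := fun m => by
    have : Em m = ⋂ ζ' ∈ s, ({ζ : F | 1 / ((m:ℝ) + 1) ≤ ‖ζ' - ζ‖} ∪ {ζ : F | ‖f ζ' - f ζ‖ ≤ ((m:ℝ) + 1) * ‖ζ' - ζ‖}) := by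
      ext ζ
      simp only [Em, mem_setOf_eq, mem_iInter, mem_union]
      refine forall₂_congr fun ζ' _ => ?_
      rw [or_iff_not_imp_left, not_le]
    rw [this]
    refine isClosed_biInter fun ζ' _ => IsClosed.union (isClosed_le continuous_const (by fun_prop)) (isClosed_le (continuous_const.sub hcf).norm (by fun_prop))
  have hun : (⋃ m, Em m) = univ := by
    rw [eq_univ_iff_forall]
    intro ζ
    have h1 := (hd ζ (hFs ζ.2)).hasFDerivAt.isBigO_sub
    obtain ⟨c, hc⟩ := h1.bound
    obtain ⟨ρ, hρ, hb⟩ := Metric.eventually_nhds_iff_ball.1 hc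
    obtain ⟨m, hm⟩ := exists_nat_gt (max c (1 / ρ))
    rw [max_lt_iff] at hm
    rw [mem_iUnion]
    refine ⟨m, fun ζ' hζ' hn => ?_⟩
    have hm1 : 1 / ((m:ℝ) + 1) < ρ := by
      rw [div_lt_comm₀ (by positivity) hρ]
      linarith
    have := hb ζ' (by rw [mem_ball, dist_eq_norm]; linarith)
    refine this.trans ?_
    gcongr; linarith
  obtain ⟨m, ζ1, hinteg⟩ := nonempty_interior_of_iUnion_of_closed hcl hun
  rw [mem_interior_iff_mem_nhds, Metric.mem_nhds_iff] at hinteg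
  obtain ⟨δ, hδ, hb⟩ := hinteg
  refine ⟨ζ1, ζ1.2, δ, hδ, (m:ℝ) + 1, by linarith [(Nat.cast_nonneg m : (0:ℝ) ≤ m)], fun ζ hζ hn => ?_⟩
  exact hb (show (⟨ζ, hζ⟩ : F) ∈ ball ζ1 δ by rw [mem_ball, Subtype.dist_eq, dist_eq_norm]; exact hn)

theorem locLip_of_JH {A : V → V →L[ℝ] V} {L : ℝ} (hA : NiceJ A L) {f : ℂ → V} {s : Set ℂ} (hs : IsOpen s) (hf : JH A f s)
    (hA2 : ∀ τ ∈ s, ∀ v, A (f τ) (A (f τ) v) = -v) : LocLip f s := by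
  obtain ⟨W, hW⟩ : ∃ W : Set ℂ, W = {ζ | ∃ R > 0, ∃ Λ ≥ 0, ∀ τ ∈ ball ζ R, ∀ τ' ∈ ball ζ R, ‖f τ - f τ'‖ ≤ Λ * ‖τ - τ'‖} := ⟨_, rfl⟩
  have hWo : IsOpen W := by
    rw [Metric.isOpen_iff]
    intro ζ hζ
    rw [hW] at hζ
    obtain ⟨R, hR, Λ, hΛ, h⟩ := hζ
    refine ⟨R / 2, half_pos hR, fun ζ' hζ' => ?_⟩
    rw [hW]
    have : ball ζ' (R / 2) ⊆ ball ζ R := ball_subset_ball' (by rw [mem_ball] at hζ'; linarith)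
    exact ⟨R / 2, half_pos hR, Λ, hΛ, fun τ hτ τ' hτ' => h τ (this hτ) τ' (this hτ')⟩
  by_contra hcon
  have hne : (s \ W).Nonempty := by
    simp only [LocLip, not_forall] at hcon
    obtain ⟨ζ, h1, h2⟩ := hcon
    exact ⟨ζ, h1, fun h => h2 (by rw [hW] at h; exact h)⟩
  have hFl : IsLocallyClosed (s \ W) := hs.isLocallyClosed.inter hWo.isClosed_compl.isLocallyClosed
  obtain ⟨ζ1, hζ1, δ, hδ, M, hM, hE⟩ := locLip_baire (fun ζ hζ => (hf ζ hζ).1) diff_subset hFl hne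
  obtain ⟨C, hC, R0, hR0, hsch⟩ := schwarz hA
  obtain ⟨ρ, hρ, hbs⟩ := Metric.isOpen_iff.1 hs ζ1 hζ1.1
  obtain ⟨e, he⟩ : ∃ e, e = min (min (ρ / 4) (δ / 4)) (min (1 / (4 * M)) (R0 / (5 * M))) := ⟨_, rfl⟩
  have hM0 : 0 < M := by linarith
  have he0 : 0 < e := by rw [he]; positivity
  have he1 : e ≤ ρ / 4 := by rw [he]; exact (min_le_left _ _).trans (min_le_left _ _)
  have he2 : e ≤ δ / 4 := by rw [he]; exact (min_le_left _ _).trans (min_le_right _ _)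
  have he3 : e ≤ 1 / (4 * M) := by rw [he]; exact (min_le_right _ _).trans (min_le_left _ _)
  have he4 : e ≤ R0 / (5 * M) := by rw [he]; exact (min_le_right _ _).trans (min_le_right _ _)
  have he3' : 4 * e ≤ 1 / M := by
    rw [le_div_iff₀ (by positivity)] at he3 ⊢; linarith
  have he4' : 5 * M * e ≤ R0 := by
    rw [le_div_iff₀ (by positivity)] at he4; linarith
  have hin : ∀ z, ‖z - ζ1‖ < 4 * e → z ∈ s := fun z hz => hbs (by rw [mem_ball, dist_eq_norm]; linarith)
  have hbound : ∀ ζ ∈ ball ζ1 e, ‖fderiv ℝ f ζ‖ ≤ M + C * (5 * M) := by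
    intro ζ hζ
    rw [mem_ball, dist_eq_norm] at hζ
    have hζs := hin ζ (by linarith)
    by_cases hζW : ζ ∈ W
    swap
    · have : ‖fderiv ℝ f ζ‖ ≤ M := by
        apply (hf ζ hζs).1.hasFDerivAt.le_of_lip' (by positivity)
        filter_upwards [ball_mem_nhds ζ (by positivity : 0 < 1 / M), hs.mem_nhds hζs] with z hz hzs
        rw [mem_ball, dist_eq_norm] at hz
        exact hE ζ ⟨hζs, hζW⟩ (by linarith) z hzs hz
      have : 0 ≤ C * (5 * M) := by positivity
      linarith
    · obtain ⟨d, hd⟩ : ∃ d, d = infDist ζ (s \ W) := ⟨_, rfl⟩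
      have hdle : d < e := by
        have := infDist_le_dist_of_mem (x := ζ) hζ1
        rw [dist_eq_norm, ← hd] at this
        linarith
      have hd0 : 0 < d := by
        obtain ⟨t, ht, htb⟩ := Metric.isOpen_iff.1 hWo ζ hζW
        refine lt_of_lt_of_le ht ?_
        rw [hd, le_infDist hne]
        intro y hy
        by_contra h
        rw [not_le, dist_comm] at h
        exact hy.2 (htb h)
      have hbW : ball ζ d ⊆ s ∩ W := fun z hz => by
        have hzs : z ∈ s := hin z (by
          rw [mem_ball, dist_eq_norm] at hz
          have := norm_sub_le_norm_sub_add_norm_sub z ζ ζ1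
          linarith)
        refine ⟨hzs, ?_⟩
        by_contra h
        have := infDist_le_dist_of_mem (x := ζ) (show z ∈ s \ W from ⟨hzs, h⟩)
        rw [mem_ball, dist_comm] at hz
        linarith
      obtain ⟨z, hz, hzd⟩ := (infDist_lt_iff hne).1 (show infDist ζ (s \ W) < 2 * d by linarith)
      rw [dist_eq_norm] at hzd
      have hz1 : ‖z - ζ1‖ < δ := by
        have := norm_sub_le_norm_sub_add_norm_sub z ζ ζ1
        rw [norm_sub_rev z ζ] at this
        linarith
      have hEz := hE z hz hz1
      have hosc : ∀ ζ' ∈ ball ζ d, ‖f ζ' - f ζ‖ ≤ 5 * M * d := fun ζ' hζ' => by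
        have hs' := (hbW hζ').1
        rw [mem_ball, dist_eq_norm] at hζ'
        have n1 : ‖ζ' - z‖ ≤ 3 * d := by
          have := norm_sub_le_norm_sub_add_norm_sub ζ' ζ z
          linarith
        have m1 := hEz ζ' hs' (by linarith)
        have m2 := hEz ζ hζs (by linarith)
        have m3 := norm_sub_le_norm_sub_add_norm_sub (f ζ') (f z) (f ζ)
        rw [norm_sub_rev (f z)] at m3
        have m4 := mul_le_mul_of_nonneg_left n1 hM0.le
        have m5 := mul_le_mul_of_nonneg_left hzd.le hM0.le
        linarith
      have := hsch f ζ d (5 * M * d) hd0 (by positivity) (le_trans (by gcongr) he4') (hf.mono (hbW.trans inter_subset_left))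
        (fun z hz => by have := (hbW hz).2; rw [hW] at this; exact this) (fun τ hτ => hA2 τ (hbW hτ).1) hosc
      have e1 : C * (5 * M * d) / d = C * (5 * M) := by field_simp
      rw [e1] at this
      linarith
  apply hζ1.2
  rw [hW]
  refine ⟨e, he0, M + C * (5 * M), by positivity, fun τ hτ τ' hτ' => ?_⟩
  exact (convex_ball ζ1 e).norm_image_sub_le_of_norm_fderiv_le (𝕜 := ℝ) (fun x hx => (hf x (hin x (by rw [mem_ball, dist_eq_norm] at hx; linarith))).1) hbound hτ' hτ

end P4d
end RS

namespace RS

section P5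

/-- continuous with the mean value property -/
def Harm {X : Type*} [NormedAddCommGroup X] [NormedSpace ℝ X] (q : ℂ → X) : Prop :=
  Continuous q ∧ ∀ z ρ, Real.circleAverage q z ρ = q z

theorem Harm.add {X : Type*} [NormedAddCommGroup X] [NormedSpace ℝ X] {q q' : ℂ → X} (h : Harm q) (h' : Harm q') : Harm (fun z => q z + q' z) :=
  ⟨h.1.add h'.1, fun z ρ => by
    rw [Real.circleAverage_fun_add (circInt_of_cont fun _ _ => h.1.continuousAt) (circInt_of_cont fun _ _ => h'.1.continuousAt), h.2, h'.2]⟩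

theorem Harm.clm {X Y : Type*} [NormedAddCommGroup X] [NormedSpace ℝ X] [CompleteSpace X] [NormedAddCommGroup Y] [NormedSpace ℝ Y] [CompleteSpace Y] {q : ℂ → X} (h : Harm q) (T : X →L[ℝ] Y) : Harm (fun z => T (q z)) :=
  ⟨T.continuous.comp h.1, fun z ρ => by
    have := T.circleAverage_comp_comm (f := q) (c := z) (R := ρ) (circInt_of_cont fun _ _ => h.1.continuousAt)
    rw [h.2] at this
    exact this⟩

theorem Harm.of_diff {q : ℂ → ℂ} (h : Differentiable ℂ q) : Harm q :=
  ⟨h.continuous, fun z ρ => h.diffContOnCl.circleAverage⟩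

theorem harm_approx {g : ℂ → ℝ} {a : ℂ} {r : ℝ} (hr : 0 < r) (hg : ContinuousOn g (sphere a r)) {ε : ℝ} (hε : 0 < ε) :
    ∃ q : ℂ → ℝ, Harm q ∧ ∀ z ∈ sphere a r, |q z - g z| ≤ ε := by
  have : Fact (0 < 2 * Real.pi) := ⟨Real.two_pi_pos⟩
  have hmem : ∀ x : AddCircle (2 * Real.pi), a + r * (AddCircle.toCircle x : ℂ) ∈ sphere a r := fun x => by
    rw [mem_sphere, dist_eq_norm]; simp [abs_of_pos hr, Circle.norm_coe]
  let G : C(AddCircle (2 * Real.pi), ℂ) := ⟨fun x => ((g (a + r * (AddCircle.toCircle x : ℂ)) : ℝ) : ℂ), by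
    apply Complex.continuous_ofReal.comp
    apply hg.comp_continuous _ hmem
    have := AddCircle.continuous_toCircle (T := 2 * Real.pi)
    fun_prop⟩
  have hG : G ∈ (Submodule.span ℂ (range (fourier (T := 2 * Real.pi)))).topologicalClosure := by
    rw [span_fourier_closure_eq_top]; trivial
  rw [← SetLike.mem_coe, Submodule.topologicalClosure_coe, Metric.mem_closure_iff] at hG
  obtain ⟨t, ht, htd⟩ := hG ε hε
  have hS : ∃ Q : ℂ → ℂ, Harm Q ∧ ∀ x : AddCircle (2 * Real.pi), Q (a + r * (AddCircle.toCircle x : ℂ)) = t x := by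
    clear htd
    have hr' : (r : ℂ) ≠ 0 := by exact_mod_cast hr.ne'
    rw [SetLike.mem_coe] at ht
    induction ht using Submodule.span_induction with
    | mem t h =>
      obtain ⟨n, rfl⟩ := h
      have hpos : ∀ n : ℕ, Harm (fun z => ((z - a) / r) ^ n) ∧ ∀ x : AddCircle (2 * Real.pi), ((a + r * (AddCircle.toCircle x : ℂ) - a) / r) ^ n = fourier (n : ℤ) x := fun n => by
        refine ⟨Harm.of_diff (by fun_prop), fun x => ?_⟩
        rw [fourier_apply, AddCircle.toCircle_zsmul]
        have : (a + r * (AddCircle.toCircle x : ℂ) - a) / r = AddCircle.toCircle x := by field_simp; ring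
        rw [this]; simp
      obtain ⟨m, rfl | rfl⟩ := n.eq_nat_or_neg
      · exact ⟨_, (hpos m).1, (hpos m).2⟩
      · refine ⟨_, (hpos m).1.clm Complex.conjCLE.toContinuousLinearMap, fun x => ?_⟩
        rw [fourier_neg, ← (hpos m).2]
        simp
    | zero => exact ⟨fun _ => 0, ⟨continuous_const, fun z ρ => Real.circleAverage_const _ _ _⟩, fun x => rfl⟩
    | add t t' _ _ h h' =>
      obtain ⟨Q, h1, h2⟩ := h
      obtain ⟨Q', h1', h2'⟩ := h'
      exact ⟨_, h1.add h1', fun x => by simp only [h2, h2']; rfl⟩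
    | smul c t _ h =>
      obtain ⟨Q, h1, h2⟩ := h
      refine ⟨_, h1.clm ((ContinuousLinearMap.mul ℂ ℂ c).restrictScalars ℝ), fun x => ?_⟩
      simp [h2]
  obtain ⟨Q, hQ, hQe⟩ := hS
  refine ⟨_, hQ.clm Complex.reCLM, fun z hz => ?_⟩
  obtain ⟨x, hx⟩ : ∃ x : AddCircle (2 * Real.pi), z = a + r * (AddCircle.toCircle x : ℂ) := by
    rw [mem_sphere, dist_eq_norm] at hz
    refine ⟨((Complex.arg (z - a) : ℝ) : AddCircle (2 * Real.pi)), ?_⟩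
    rw [AddCircle.toCircle_apply_mk, Circle.coe_exp]
    have := Complex.norm_mul_exp_arg_mul_I (z - a)
    rw [hz] at this
    have e : (2 * Real.pi / (2 * Real.pi) : ℝ) = 1 := div_self Real.two_pi_pos.ne'
    rw [e, one_mul, this]; ring
  have h1 := (ContinuousMap.dist_apply_le_dist (f := G) (g := t) x).trans htd.le
  rw [dist_comm, dist_eq_norm, ← hQe, ← hx] at h1
  have h2 : G x = ((g z : ℝ) : ℂ) := by rw [hx]; rfl
  rw [h2] at h1
  refine le_trans ?_ h1
  have := Complex.abs_re_le_norm (Q z - ((g z : ℝ) : ℂ))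
  simpa using this

theorem lemB {h : ℂ → ℝ} {r R M : ℝ} {ζ1 : ℂ} (hr : 0 < r) (hrR : r < R) (hc : ∀ z ∈ ball (0:ℂ) R, z ≠ ζ1 → ContinuousAt h z)
    (hM : ∀ z ∈ ball (0:ℂ) R, z ≠ ζ1 → h z ≤ M)
    (hsub : ∀ z ∈ ball (0:ℂ) r, z ≠ ζ1 → ∀ᶠ ρ in 𝓝[>] (0:ℝ), h z ≤ Real.circleAverage h z ρ) (h0 : ζ1 ≠ 0) (h1 : ‖ζ1‖ ≠ r) :
    h 0 ≤ Real.circleAverage h 0 r := by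
  have hz0 : 0 < ‖ζ1‖ := norm_pos_iff.2 h0
  have hsph : ∀ z ∈ sphere (0:ℂ) r, z ≠ ζ1 ∧ z ∈ ball (0:ℂ) R := fun z hz => by
    rw [mem_sphere_zero_iff_norm] at hz
    exact ⟨fun e => h1 (by rw [← e, hz]), by rw [mem_ball_zero_iff, hz]; exact hrR⟩
  have hcs : ContinuousOn h (sphere 0 r) := fun z hz => (hc z (hsph z hz).2 (hsph z hz).1).continuousWithinAt
  have hci : CircleIntegrable h 0 r := ContinuousOn.circleIntegrable' (by rwa [abs_of_pos hr])
  apply _root_.le_of_forall_pos_le_add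
  intro ε2 hε2
  obtain ⟨ε, hε⟩ : ∃ ε, ε = ε2 / 2 := ⟨_, rfl⟩
  have hε0 : 0 < ε := by rw [hε]; positivity
  obtain ⟨q, hq, hqh⟩ := harm_approx hr hcs hε0
  have hqi : ∀ z ρ, CircleIntegrable q z ρ := fun z ρ => circInt_of_cont fun _ _ => hq.1.continuousAt
  obtain ⟨B, hB⟩ : ∃ B, B = Real.log (r + ‖ζ1‖) + r ^ 2 := ⟨_, rfl⟩
  -- lower bound for q
  obtain ⟨Q0, hQ0⟩ : ∃ Q0, ∀ z ∈ closedBall (0:ℂ) r, -q z ≤ Q0 := by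
    obtain ⟨C, hC⟩ := (isCompact_closedBall (0:ℂ) r).exists_bound_of_continuousOn hq.1.continuousOn
    exact ⟨C, fun z hz => by have := hC z hz; rw [Real.norm_eq_abs, abs_le] at this; linarith [this.1]⟩
  have key : ∀ δ > 0, h 0 - q 0 + δ * Real.log ‖ζ1‖ ≤ ε + δ * B := by
    intro δ hδ
    have ev1 : ∀ᶠ ρ in 𝓝[>] (0:ℝ), δ * Real.log ρ ≤ ε + δ * B - (M + Q0 + δ * r ^ 2) :=
      (Real.tendsto_log_nhdsGT_zero.const_mul_atBot hδ).eventually_le_atBot _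
    have ev2 : ∀ᶠ ρ in 𝓝[>] (0:ℝ), ρ ∈ Ioo 0 ‖ζ1‖ := Ioo_mem_nhdsGT hz0
    obtain ⟨ρ, e1, e2⟩ := (ev1.and ev2).exists
    have hn : Continuous fun z : ℂ => ‖z - ζ1‖ := by fun_prop
    have hn' : Continuous fun z : ℂ => ‖z‖ := by fun_prop
    have hCB : ∀ z : ℂ, ‖z‖ ≤ r → z ∈ ball (0:ℂ) R := fun z hz => by rw [mem_ball_zero_iff]; linarith
    have hne : ∀ z : ℂ, ρ ≤ ‖z - ζ1‖ → z ≠ ζ1 := fun z hz e => by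
      rw [e, sub_self, norm_zero] at hz; linarith [e2.1]
    obtain ⟨z, ⟨hzK, hzU⟩, hle⟩ := max_princ (K := {z | ρ ≤ ‖z - ζ1‖ ∧ ‖z‖ ≤ r}) (U := {z | ρ < ‖z - ζ1‖ ∧ ‖z‖ < r})
      (h := fun z => h z - q z + (δ * Real.log ‖z - ζ1‖ + δ * ‖z - 0‖ ^ 2)) (z := 0)
      (by
        apply (isCompact_closedBall (0:ℂ) r).of_isClosed_subset
        · exact (isClosed_le continuous_const hn).inter (isClosed_le hn' continuous_const)
        · intro z hz; rw [mem_closedBall, dist_zero_right]; exact hz.2)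
      ((isOpen_lt continuous_const hn).inter (isOpen_lt hn' continuous_const))
      (fun z hz => ⟨hz.1.le, hz.2.le⟩)
      (fun z hz => by
        apply ContinuousAt.continuousWithinAt
        have c1 := hc z (hCB z hz.2) (hne z hz.1)
        have c2 : ContinuousAt (fun z => Real.log ‖z - ζ1‖) z := hn.continuousAt.log (lt_of_lt_of_le e2.1 hz.1).ne'
        exact (c1.sub hq.1.continuousAt).add ((continuousAt_const.mul c2).add (by fun_prop)))
      (fun z hz => by
        apply Eventually.frequently
        have hzR : 0 < R - ‖z‖ := by linarith [hz.2]
        have hzp : 0 < ‖z - ζ1‖ := by linarith [e2.1, hz.1]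
        filter_upwards [hsub z (by rw [mem_ball_zero_iff]; exact hz.2) (hne z hz.1.le), ca_log (hne z hz.1.le), Ioo_mem_nhdsGT hzR, Ioo_mem_nhdsGT hzp] with t f1 f2 f3 f4
        have ht : |t| = t := abs_of_pos f3.1
        have hts : ∀ τ ∈ sphere z |t|, τ ∈ ball (0:ℂ) R ∧ τ ≠ ζ1 := fun τ hτ => by
          rw [ht, mem_sphere, dist_eq_norm] at hτ
          constructor
          · rw [mem_ball_zero_iff]
            have := norm_add_le (τ - z) z
            rw [sub_add_cancel] at this
            linarith [f3.2]
          · rintro rfl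
            rw [norm_sub_rev] at hτ
            linarith [f4.2]
        have i1 : CircleIntegrable h z t := circInt_of_cont fun τ hτ => hc τ (hts τ hτ).1 (hts τ hτ).2
        have i2 := hqi z t
        have i3 : CircleIntegrable (fun z => δ * Real.log ‖z - ζ1‖) z t := circInt_of_cont fun τ hτ =>
          continuousAt_const.mul (hn.continuousAt.log (norm_pos_iff.2 (sub_ne_zero.2 (hts τ hτ).2)).ne')
        have i4 : CircleIntegrable (fun z => δ * ‖z - 0‖ ^ 2) z t := circInt_of_cont fun τ hτ => by fun_prop
        rw [ca_add' (i1.fun_sub i2) (i3.fun_add i4), ca_sub' i1 i2, ca_add' i3 i4, ca_mul', ca_mul', ca_sq, f2, hq.2]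
        have : 0 < δ * t ^ 2 := by have := f3.1; positivity
        linarith)
      ⟨by simpa using e2.2, by simpa using hr⟩
    simp only [zero_sub, norm_neg, sub_zero, norm_zero] at hle
    have hpz : 0 < ‖z - ζ1‖ := lt_of_lt_of_le e2.1 hzK.1
    have : h z - q z + (δ * Real.log ‖z - ζ1‖ + δ * ‖z‖ ^ 2) ≤ ε + δ * B := by
      rcases hzK.1.eq_or_lt with hh | hh
      · rw [← hh]
        have b1 := hM z (hCB z hzK.2) (hne z hzK.1)
        have b2 := hQ0 z (by rw [mem_closedBall, dist_zero_right]; exact hzK.2)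
        have b3 : δ * ‖z‖ ^ 2 ≤ δ * r ^ 2 := by gcongr; exact hzK.2
        linarith
      · have h2 : ‖z‖ = r := le_antisymm hzK.2 (not_lt.1 fun h' => hzU ⟨hh, h'⟩)
        have b1 := (abs_le.1 (hqh z (by rw [mem_sphere_zero_iff_norm]; exact h2))).1
        have b2 : Real.log ‖z - ζ1‖ ≤ Real.log (r + ‖ζ1‖) := Real.log_le_log hpz (by rw [← h2]; exact norm_sub_le _ _)
        have b3 := mul_le_mul_of_nonneg_left b2 hδ.le
        rw [h2, hB]
        linarith
    simp at hle
    linarith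
  have hlim : h 0 - q 0 ≤ ε := by
    have t1 : Tendsto (fun δ : ℝ => h 0 - q 0 + δ * Real.log ‖ζ1‖) (𝓝[>] 0) (𝓝 (h 0 - q 0 + 0 * Real.log ‖ζ1‖)) :=
      (Continuous.tendsto (by fun_prop) 0).mono_left nhdsWithin_le_nhds
    have t2 : Tendsto (fun δ : ℝ => ε + δ * B) (𝓝[>] 0) (𝓝 (ε + 0 * B)) :=
      (Continuous.tendsto (by fun_prop) 0).mono_left nhdsWithin_le_nhds
    have := le_of_tendsto_of_tendsto t1 t2 (by
      filter_upwards [self_mem_nhdsWithin] with δ hδ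
      exact key δ hδ)
    linarith
  have hav : q 0 ≤ Real.circleAverage h 0 r + ε := by
    have := Real.circleAverage_mono (c := 0) (R := r) (hqi 0 r) (hci.add (circleIntegrable_const ε 0 r)) (fun z hz => by
      rw [abs_of_pos hr] at hz
      have := (abs_le.1 (hqh z hz)).2
      simp only [Pi.add_apply]
      linarith)
    rw [hq.2, Real.circleAverage_add hci (circleIntegrable_const ε 0 r), Real.circleAverage_const] at this
    exact this
  linarith

theorem erealIntegral_coe {X : Type} [MeasurableSpace X] {μ : Measure X} {g : X → ℝ} (hg : Integrable g μ) :
    erealIntegral μ (fun x => (g x : EReal)) = ((∫ x, g x ∂μ : ℝ) : EReal) := by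
  unfold erealIntegral
  have e1 : ∀ x : ℝ, erealPos (x : EReal) = ENNReal.ofReal x := fun x => by simp [erealPos]
  have e2 : ∀ x : ℝ, erealPos (-(x : EReal)) = ENNReal.ofReal (-x) := fun x => by rw [← EReal.coe_neg, e1]
  simp only [e1, e2]
  rw [integral_eq_lintegral_pos_part_sub_lintegral_neg_part hg]
  have f1 := hg.lintegral_lt_top
  have f2 := hg.neg.lintegral_lt_top
  simp only [Pi.neg_apply] at f2
  rw [EReal.coe_sub, EReal.coe_ennreal_toReal f1.ne, EReal.coe_ennreal_toReal f2.ne]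

theorem erealIntegral_circle {h : ℂ → ℝ} {a : ℂ} {r : ℝ} (hc : CircleIntegrable h a r) :
    (((2 * Real.pi)⁻¹ : ℝ) : EReal) *
      erealIntegral (volume.restrict (Set.Ioc (0 : ℝ) (2 * Real.pi)))
        (fun θ : ℝ => (h (a + (r : ℂ) * Complex.exp ((θ : ℂ) * Complex.I)) : EReal)) = ((Real.circleAverage h a r : ℝ) : EReal) := by
  have hi : Integrable (fun θ : ℝ => h (a + (r : ℂ) * Complex.exp ((θ : ℂ) * Complex.I))) (volume.restrict (Set.Ioc (0 : ℝ) (2 * Real.pi))) := by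
    have : IntervalIntegrable (fun θ : ℝ => h (circleMap a r θ)) volume 0 (2 * Real.pi) := hc
    rw [intervalIntegrable_iff, uIoc_of_le Real.two_pi_pos.le] at this
    exact this
  rw [erealIntegral_coe hi, ← EReal.coe_mul, Real.circleAverage_def, intervalIntegral.integral_of_le Real.two_pi_pos.le]
  rfl

theorem psh_mean {J : Cn 2 → Cn 2 →L[ℝ] Cn 2} {O : Set (Cn 2)} (hO : IsOpen O) (hJ2 : ∀ x ∈ O, ∀ v, J x (J x v) = -v) {u : Cn 2 → ℝ} (hu : JPshOnR J O u) (huc : ContinuousOn u O) {k : ℂ → Cn 2} {z : ℂ} {R ρ : ℝ}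
    (hk : JH J k (ball z R)) (hm : MapsTo k (ball z R) O) (hρ : 0 < ρ) (hρR : ρ < R) : u (k z) ≤ Real.circleAverage (fun τ => u (k τ)) z ρ := by
  have hR : 0 < R := hρ.trans hρR
  have hRC : (R : ℂ) ≠ 0 := by exact_mod_cast hR.ne'
  have hin : ∀ ζ ∈ unitDisc, z + R * ζ ∈ ball z R := fun ζ hζ => by
    rw [unitDisc, mem_ball_zero_iff] at hζ
    rw [mem_ball, dist_eq_norm]
    simp [abs_of_pos hR]
    nlinarith
  have hd : JDisc J O (fun ζ => k (z + R * ζ)) := by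
    refine ⟨fun ζ hζ => hm (hin ζ hζ), fun ζ hζ => ?_⟩
    obtain ⟨d1, d2⟩ := hk _ (hin ζ hζ)
    have g : HasFDerivAt (fun ζ : ℂ => z + R * ζ) ((R:ℝ) • ContinuousLinearMap.id ℝ ℂ) ζ := by
      have : HasFDerivAt (fun ζ : ℂ => z + (R:ℝ) • ζ) ((R:ℝ) • ContinuousLinearMap.id ℝ ℂ) ζ := ((hasFDerivAt_id ζ).const_smul R).const_add z
      simpa [Complex.real_smul] using this
    have hc := d1.hasFDerivAt.comp ζ g
    have hc' : HasFDerivAt (fun ζ => k (z + R * ζ)) ((fderiv ℝ k (z + R * ζ)).comp ((R:ℝ) • ContinuousLinearMap.id ℝ ℂ)) ζ := hc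
    refine ⟨hc'.differentiableAt, ?_⟩
    rw [hc'.fderiv]
    apply ContinuousLinearMap.ext
    intro v
    have ev : ∀ v : ℂ, v = v.re • (1:ℂ) + v.im • I := fun v => by apply Complex.ext <;> simp
    obtain ⟨T, hT⟩ : ∃ T, T = fderiv ℝ k (z + R * ζ) := ⟨_, rfl⟩
    rw [← hT] at d2 ⊢
    have l : ∀ v : ℂ, T v = v.re • T 1 + v.im • T I := fun v => by
      conv_lhs => rw [ev v]
      rw [map_add, map_smul, map_smul]
    have e1 : JstdC v = I * v := rfl
    obtain ⟨P, hP⟩ : ∃ P, P = J (k (z + R * ζ)) := ⟨_, rfl⟩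
    have hPP : P (P (T 1)) = - T 1 := by rw [hP]; exact hJ2 _ (hm (hin ζ hζ)) _
    simp only [ContinuousLinearMap.comp_apply, ContinuousLinearMap.smul_apply, ContinuousLinearMap.id_apply, e1, map_smul, ← hP]
    rw [← hP] at d2
    congr 1
    rw [l (I * v), l v, d2]
    simp [hPP]
    abel
  have hs := (hu.2 _ hd).2 0 (ρ / R) (by positivity) (fun ζ hζ => by
    rw [mem_closedBall_zero_iff] at hζ
    rw [unitDisc, mem_ball_zero_iff]
    exact hζ.trans_lt ((div_lt_one hR).2 hρR))
  have hci : CircleIntegrable (fun τ => u (k τ)) z ρ := circInt_of_cont fun τ hτ => by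
    have hτ' : τ ∈ ball z R := by rw [abs_of_pos hρ, mem_sphere] at hτ; rw [mem_ball, hτ]; exact hρR
    exact ContinuousAt.comp (g := u) ((huc _ (hm hτ')).continuousAt (hO.mem_nhds (hm hτ'))) (hk τ hτ').1.continuousAt
  have e2 : ∀ θ : ℝ, z + R * (0 + ((ρ / R : ℝ) : ℂ) * Complex.exp ((θ : ℂ) * Complex.I)) = z + (ρ : ℂ) * Complex.exp ((θ : ℂ) * Complex.I) := fun θ => by
    push_cast; field_simp; ring
  simp only [e2] at hs
  rw [erealIntegral_circle (h := fun τ => u (k τ)) hci] at hs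
  rw [mul_zero, add_zero, EReal.coe_le_coe_iff] at hs
  exact hs

end P5
end RS

namespace RS

section P6
variable {V : Type*} [NormedAddCommGroup V] [InnerProductSpace ℝ V] [FiniteDimensional ℝ V]

/-- local data near a point of `E` -/
structure LD (A : V → V →L[ℝ] V) (L : ℝ) (E : Set V) (p : V) (R : ℝ) (Y : Fin 2 → V → ℝ) (D : Fin 2 → V → V →L[ℝ] ℝ)
    (Q : Fin 2 → V → V →L[ℝ] V →L[ℝ] ℝ) (C c : ℝ) : Prop where
  nice : NiceJ A L
  Rpos : 0 < R
  sq : ∀ x ∈ ball p R, ∀ v, A x (A x v) = -v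
  Ech : ∀ x ∈ ball p R, x ∈ E ↔ ∀ i, Y i x = 0
  hasF : ∀ x ∈ ball p R, ∀ i, HasFDerivAt (Y i) (D i x) x
  quad : ∀ x ∈ ball p R, ∀ i, HasQuad (Y i) x (D i x) (Q i x)
  Dc : ∀ x ∈ ball p R, ∀ i, ContinuousAt (D i) x
  Db : ∀ x ∈ ball p R, ∀ i, ‖D i x‖ ≤ C
  Qb : ∀ x ∈ ball p R, ∀ i, ‖Q i x‖ ≤ C
  cpos : 0 < c
  low : ∀ x ∈ ball p R, ∀ w, c * ‖w‖ ^ 2 ≤ (D 0 x w) ^ 2 + (D 1 x w) ^ 2 + (D 0 x (A x w)) ^ 2 + (D 1 x (A x w)) ^ 2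

theorem smooth_pack {φ : V → ℝ} {U : Set V} (hU : IsOpen U) (hφ : ContDiffOn ℝ (⊤ : ℕ∞) φ U) :
    ∃ (D : V → V →L[ℝ] ℝ) (Q : V → V →L[ℝ] V →L[ℝ] ℝ), ContinuousOn D U ∧ ContinuousOn (fun x => ‖Q x‖) U ∧
      ∀ x ∈ U, HasFDerivAt φ (D x) x ∧ HasQuad φ x (D x) (Q x) := by
  obtain ⟨D, hD⟩ : ∃ D, D = fderiv ℝ φ := ⟨_, rfl⟩
  have h1 : ContDiffOn ℝ (⊤ : ℕ∞) D U := by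
    rw [hD]; exact hφ.fderiv_of_isOpen hU (by simp)
  obtain ⟨Q, hQ⟩ : ∃ Q, Q = fderiv ℝ D := ⟨_, rfl⟩
  have h2 : ContDiffOn ℝ (⊤ : ℕ∞) Q U := by
    rw [hQ]; exact h1.fderiv_of_isOpen hU (by simp)
  have h3 : ∀ x ∈ U, HasFDerivAt φ (D x) x := fun x hx => by
    rw [hD]; exact ((hφ.contDiffAt (hU.mem_nhds hx)).differentiableAt (by simp)).hasFDerivAt
  have h4 : ∀ x ∈ U, HasFDerivAt D (Q x) x := fun x hx => by
    rw [hQ]; exact ((h1.contDiffAt (hU.mem_nhds hx)).differentiableAt (by simp)).hasFDerivAt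
  have h5 : ContinuousOn Q U := h2.continuousOn
  have h6 : Continuous (fun T : V →L[ℝ] V →L[ℝ] ℝ => ‖T‖) := continuous_norm (E := V →L[ℝ] V →L[ℝ] ℝ)
  refine ⟨D, Q, h1.continuousOn, h6.comp_continuousOn h5, fun x hx => ⟨h3 x hx, HasQuad.of_hasFDerivAt ?_ (h4 x hx)⟩⟩
  filter_upwards [hU.mem_nhds hx] with y hy using h3 y hy

theorem tangent_of_ker {E : Set (Cn 2)} {p : Cn 2} {U : Set (Cn 2)} {W : Set (EuclideanSpace ℝ (Fin (2 * 2)))}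
    {φ : Cn 2 → EuclideanSpace ℝ (Fin (2 * 2))} {ψ : EuclideanSpace ℝ (Fin (2 * 2)) → Cn 2} (hp : p ∈ E)
    (hU : IsOpen U) (hpU : p ∈ U) (hW : IsOpen W) (hφ : ContDiffOn ℝ (⊤ : ℕ∞) φ U) (hψ : ContDiffOn ℝ (⊤ : ℕ∞) ψ W)
    (h1 : ∀ x ∈ U, ψ (φ x) = x) (hm : MapsTo φ U W) (him : φ '' (E ∩ U) = W ∩ {x | ∀ i : Fin (2 * 2), 2 ≤ (i : ℕ) → x i = 0})
    {w : Cn 2} (hw : ∀ i : Fin (2 * 2), 2 ≤ (i : ℕ) → fderiv ℝ φ p w i = 0) : w ∈ TangentSet E p := by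
  obtain ⟨b, hb⟩ : ∃ b, b = fderiv ℝ φ p w := ⟨_, rfl⟩
  have hφp : φ p ∈ W ∩ {x | ∀ i : Fin (2 * 2), 2 ≤ (i : ℕ) → x i = 0} := by rw [← him]; exact ⟨p, ⟨hp, hpU⟩, rfl⟩
  have hl : HasDerivAt (fun t : ℝ => φ p + t • b) b 0 := by
    have := ((hasDerivAt_id (0:ℝ)).smul_const b).const_add (φ p)
    simpa using this
  have dφ : HasFDerivAt φ (fderiv ℝ φ p) p := ((hφ.contDiffAt (hU.mem_nhds hpU)).differentiableAt (by simp)).hasFDerivAt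
  have dψ : HasFDerivAt ψ (fderiv ℝ ψ (φ p)) (φ p) := ((hψ.contDiffAt (hW.mem_nhds hφp.1)).differentiableAt (by simp)).hasFDerivAt
  have hid : (fderiv ℝ ψ (φ p)).comp (fderiv ℝ φ p) = ContinuousLinearMap.id ℝ (Cn 2) := by
    have e1 := dψ.comp p dφ
    have e2 : HasFDerivAt (ψ ∘ φ) (ContinuousLinearMap.id ℝ (Cn 2)) p := by
      apply (hasFDerivAt_id p).congr_of_eventuallyEq
      filter_upwards [hU.mem_nhds hpU] with x hx using h1 x hx
    exact e1.unique e2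
  have dγ : HasDerivAt (fun t : ℝ => ψ (φ p + t • b)) w 0 := by
    have e0 : φ p + (0:ℝ) • b = φ p := by simp
    have := HasFDerivAt.comp_hasDerivAt (x := (0:ℝ)) (l := ψ) (l' := fderiv ℝ ψ (φ p)) (f := fun t : ℝ => φ p + t • b) (f' := b) (by simpa [e0] using dψ) hl
    have e3 : fderiv ℝ ψ (φ p) b = w := by
      rw [hb]; exact congrArg (fun T => T w) hid
    rw [e3] at this
    exact this
  refine ⟨fun t : ℝ => ψ (φ p + t • b), by simp [h1 p hpU], ?_, dγ.differentiableAt, dγ.deriv⟩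
  have hc : ∀ᶠ t : ℝ in 𝓝 0, φ p + t • b ∈ W := by
    apply hl.continuousAt.eventually_mem
    simpa using hW.mem_nhds hφp.1
  filter_upwards [hc] with t ht
  have : φ p + t • b ∈ φ '' (E ∩ U) := by
    rw [him]
    refine ⟨ht, fun i hi => ?_⟩
    have f1 := hφp.2 i hi
    have f2 := hw i hi
    rw [← hb] at f2
    simp [f1, f2]
  obtain ⟨e, he, hee⟩ := this
  rw [← hee, h1 e he.2]
  exact he.1

theorem LD_exists {Ω : Set (Cn 2)} (hΩ : IsOpen Ω) {J : Cn 2 → Cn 2 →L[ℝ] Cn 2} (hJ : IsACS Ω J)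
    {E : Set (Cn 2)} (hEΩ : E ⊆ Ω) (hEsub : IsSmoothSubmanifold 2 E) (hEtr : TotallyReal J E) {p : Cn 2} (hp : p ∈ E) :
    ∃ A L R Y D Q C c, LD A L E p R Y D Q C c ∧ closedBall p R ⊆ Ω ∧ ∀ x ∈ ball p R, A x = J x := by
  obtain ⟨A, L, R1, hR1, hA, hb1, hAJ⟩ := localize hΩ hJ.1 (hEΩ hp)
  obtain ⟨U, W, φ, ψ, hU, hpU, hW, hφ, hψ, h1, h2, hm, him⟩ := hEsub p hp
  let ix : Fin 2 → Fin (2 * 2) := fun i => ⟨i + 2, by omega⟩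
  let Y : Fin 2 → Cn 2 → ℝ := fun i x => φ x (ix i)
  have hYs : ∀ i, ContDiffOn ℝ (⊤ : ℕ∞) (Y i) U := fun i =>
    (EuclideanSpace.proj (𝕜 := ℝ) (ix i)).contDiff.comp_contDiffOn hφ
  choose D Q hDc hQc hDQ using fun i => smooth_pack hU (hYs i)
  have hix : ∀ x : EuclideanSpace ℝ (Fin (2 * 2)), (∀ i : Fin (2 * 2), 2 ≤ (i : ℕ) → x i = 0) ↔ ∀ i, x (ix i) = 0 := fun x => by
    constructor
    · intro h i; exact h _ (by simp [ix])
    · intro h i hi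
      have := h ⟨i - 2, by omega⟩
      have e : ix ⟨i - 2, by omega⟩ = i := by apply Fin.ext; simp [ix]; omega
      rwa [e] at this
  have hE : ∀ x ∈ U, x ∈ E ↔ ∀ i, Y i x = 0 := fun x hx => by
    constructor
    · intro h
      have : φ x ∈ W ∩ {x | ∀ i : Fin (2 * 2), 2 ≤ (i : ℕ) → x i = 0} := by rw [← him]; exact ⟨x, ⟨h, hx⟩, rfl⟩
      exact (hix _).1 this.2
    · intro h
      have : φ x ∈ φ '' (E ∩ U) := by rw [him]; exact ⟨hm hx, (hix _).2 h⟩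
      obtain ⟨e, he, hee⟩ := this
      have : e = x := by rw [← h1 e he.2, hee, h1 x hx]
      rw [← this]; exact he.1
  have hDφ : ∀ i w, D i p w = fderiv ℝ φ p w (ix i) := fun i w => by
    have dφ : HasFDerivAt φ (fderiv ℝ φ p) p := ((hφ.contDiffAt (hU.mem_nhds hpU)).differentiableAt (by simp)).hasFDerivAt
    have e1 := ((EuclideanSpace.proj (ix i) : EuclideanSpace ℝ (Fin (2*2)) →L[ℝ] ℝ)).hasFDerivAt.comp p dφ
    have e2 := (hDQ i p hpU).1
    have := e2.unique e1
    rw [this]; rfl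
  have hker : ∀ w, (∀ i, D i p w = 0) → w ∈ TangentSet E p := fun w hw =>
    tangent_of_ker hp hU hpU hW hφ hψ h1 hm him ((hix _).2 fun i => by rw [← hDφ]; exact hw i)
  -- the four functionals
  let G : Cn 2 → Fin 2 × Fin 2 → Cn 2 →L[ℝ] ℝ := fun x j => if j.2 = 0 then D j.1 x else (D j.1 x).comp (A x)
  have hAp : A p = J p := hAJ p (mem_ball_self hR1)
  have hinj : ∀ w, (∀ j, G p j w = 0) → w = 0 := fun w hw => by
    apply hEtr p hp w (hker w fun i => by simpa [G] using hw (i, 0))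
    apply hker
    intro i
    rw [← hAp]
    simpa [G] using hw (i, 1)
  let T : Cn 2 →L[ℝ] (Fin 2 × Fin 2 → ℝ) := ContinuousLinearMap.pi (G p)
  obtain ⟨K, hK, hT⟩ := LinearMap.exists_antilipschitzWith (T : Cn 2 →ₗ[ℝ] (Fin 2 × Fin 2 → ℝ)) (by
    rw [LinearMap.ker_eq_bot']
    intro w hw
    exact hinj w fun j => congrFun hw j)
  have hTK : ∀ w, ‖w‖ ≤ K * ‖T w‖ := fun w => by
    have := hT.le_mul_dist w 0
    simpa using this
  have hKr : (0:ℝ) < K := hK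
  have hGc : ∀ j, ContinuousAt (fun x => G x j) p := fun j => by
    have a1 : ContinuousAt (D j.1) p := (hDc j.1).continuousAt (hU.mem_nhds hpU)
    have a2 : ContinuousAt A p := (hA.diff p).continuousAt
    by_cases h : j.2 = 0
    · simpa [G, h] using a1
    · simpa [G, h] using a1.clm_comp a2
  have hGe : ∀ᶠ x in 𝓝 p, ∀ j, ‖G x j - G p j‖ ≤ 1 / (2 * K) := by
    rw [eventually_all]
    intro j
    have := Metric.tendsto_nhds.1 (hGc j) (1 / (2 * K)) (by positivity)
    filter_upwards [this] with x hx
    rw [← dist_eq_norm]; exact hx.le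
  have hDe : ∀ᶠ x in 𝓝 p, ∀ i, ‖D i x‖ ≤ ‖D i p‖ + 1 ∧ ‖Q i x‖ ≤ ‖Q i p‖ + 1 := by
    rw [eventually_all]
    intro i
    have a1 := ((hDc i).continuousAt (hU.mem_nhds hpU)).norm
    have a2 := ((hQc i).continuousAt (hU.mem_nhds hpU))
    filter_upwards [a1.eventually_le_const (lt_add_one _), a2.eventually_le_const (lt_add_one _)] with x e1 e2 using ⟨e1, e2⟩
  obtain ⟨R2, hR2, hall⟩ := Metric.eventually_nhds_iff_ball.1 (hGe.and (hDe.and (hU.mem_nhds hpU : ∀ᶠ x in 𝓝 p, x ∈ U)))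
  obtain ⟨R, hR⟩ : ∃ R, R = min R1 R2 := ⟨_, rfl⟩
  have hRb1 : ball p R ⊆ ball p R1 := ball_subset_ball (by rw [hR]; exact min_le_left _ _)
  have hRb2 : ball p R ⊆ ball p R2 := ball_subset_ball (by rw [hR]; exact min_le_right _ _)
  refine ⟨A, L, R, Y, D, Q, ‖D 0 p‖ + ‖D 1 p‖ + ‖Q 0 p‖ + ‖Q 1 p‖ + 1, 1 / (4 * K ^ 2), ⟨hA, by rw [hR]; positivity, ?_, ?_, ?_, ?_, ?_, ?_, ?_, by positivity, ?_⟩,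
    (closedBall_subset_closedBall (by rw [hR]; exact min_le_left _ _)).trans hb1, fun x hx => hAJ x (hRb1 hx)⟩
  · intro x hx v
    rw [hAJ x (hRb1 hx)]
    have := hJ.2 x (hb1 (ball_subset_closedBall (hRb1 hx)))
    exact congrArg (fun T => T v) this
  · exact fun x hx => hE x (hall x (hRb2 hx)).2.2
  · exact fun x hx i => (hDQ i x (hall x (hRb2 hx)).2.2).1
  · exact fun x hx i => (hDQ i x (hall x (hRb2 hx)).2.2).2
  · exact fun x hx i => (hDc i).continuousAt (hU.mem_nhds (hall x (hRb2 hx)).2.2)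
  · intro x hx i
    have := ((hall x (hRb2 hx)).2.1 i).1
    have n1 := norm_nonneg (D 0 p); have n2 := norm_nonneg (D 1 p); have n3 := norm_nonneg (Q 0 p); have n4 := norm_nonneg (Q 1 p)
    fin_cases i <;> simp at this ⊢ <;> linarith
  · intro x hx i
    have := ((hall x (hRb2 hx)).2.1 i).2
    have n1 := norm_nonneg (D 0 p); have n2 := norm_nonneg (D 1 p); have n3 := norm_nonneg (Q 0 p); have n4 := norm_nonneg (Q 1 p)
    fin_cases i <;> simp at this ⊢ <;> linarith
  · intro x hx w
    have hx' := (hall x (hRb2 hx)).1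
    obtain ⟨j, hj⟩ : ∃ j, ‖w‖ ≤ K * |G p j w| := by
      by_contra hcon
      push Not at hcon
      rcases eq_or_ne w 0 with h0 | h0
      · have := hcon (0, 0); rw [h0] at this; simp at this
      have hw0 : 0 < ‖w‖ := norm_pos_iff.2 h0
      have : ‖T w‖ < ‖w‖ / K := by
        rw [pi_norm_lt_iff (by positivity)]
        intro j
        rw [lt_div_iff₀ hKr, mul_comm]
        exact hcon j
      have h3 := hTK w
      rw [lt_div_iff₀ hKr] at this
      linarith
    have hj2 : ‖w‖ ≤ 2 * K * |G x j w| := by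
      have e1 : |G p j w| ≤ |G x j w| + 1 / (2 * K) * ‖w‖ := by
        have := (G x j - G p j).le_of_opNorm_le (hx' j) w
        rw [ContinuousLinearMap.sub_apply, Real.norm_eq_abs] at this
        have h4 := abs_sub_abs_le_abs_sub (G p j w) (G x j w)
        rw [abs_sub_comm] at h4
        linarith
      have e2 := mul_le_mul_of_nonneg_left e1 hKr.le
      have e3 : (K:ℝ) * (|G x j w| + 1 / (2 * K) * ‖w‖) = K * |G x j w| + ‖w‖ / 2 := by field_simp
      linarith
    have hj3 : 1 / (4 * (K:ℝ) ^ 2) * ‖w‖ ^ 2 ≤ (G x j w) ^ 2 := by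
      have e1 : ‖w‖ ^ 2 ≤ (2 * K * |G x j w|) ^ 2 := by gcongr
      rw [mul_pow, sq_abs] at e1
      rw [one_div, inv_mul_le_iff₀ (by positivity)]
      linarith
    refine hj3.trans ?_
    have q1 := sq_nonneg (D 0 x w); have q2 := sq_nonneg (D 1 x w); have q3 := sq_nonneg (D 0 x (A x w)); have q4 := sq_nonneg (D 1 x (A x w))
    obtain ⟨j1, j2⟩ := j
    fin_cases j1 <;> fin_cases j2 <;> simp [G] <;> linarith

end P6
end RS

namespace RS

section P6b
variable {V : Type*} [NormedAddCommGroup V] [InnerProductSpace ℝ V] [FiniteDimensional ℝ V]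

/-- continuous functions with the sub mean value property along discs -/
def PM (A : V → V →L[ℝ] V) (O : Set V) (u : V → ℝ) : Prop :=
  ContinuousOn u O ∧ ∀ (k : ℂ → V) (z : ℂ) (R ρ : ℝ), JH A k (ball z R) → MapsTo k (ball z R) O → 0 < ρ → ρ < R →
    u (k z) ≤ Real.circleAverage (fun τ => u (k τ)) z ρ

theorem deriv_close {k : ℂ → V} {w w' : V} {r0 ε : ℝ} (hr0 : 0 < r0) (hd : DifferentiableAt ℝ k 0) (hε : 0 < ε)
    (h : ∀ τ ∈ ball (0:ℂ) r0, ‖k τ - k 0 - (τ.re • w + τ.im • w')‖ ≤ ε * ‖τ‖) : ‖fderiv ℝ k 0 1 - w‖ ≤ ε := by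
  let T : ℂ →L[ℝ] V := Complex.reCLM.smulRight w + Complex.imCLM.smulRight w'
  have h1 : HasFDerivAt (fun τ => k τ - T τ) (fderiv ℝ k 0 - T) 0 := hd.hasFDerivAt.sub T.hasFDerivAt
  have h2 : ‖fderiv ℝ k 0 - T‖ ≤ ε := by
    apply h1.le_of_lip' hε.le
    filter_upwards [ball_mem_nhds (0:ℂ) hr0] with τ hτ
    have := h τ hτ
    have e : k τ - T τ - (k 0 - T 0) = k τ - k 0 - (τ.re • w + τ.im • w') := by
      simp [T]; abel
    rw [e]; simpa using this
  have h3 := (fderiv ℝ k 0 - T).le_opNorm 1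
  have e : (fderiv ℝ k 0 - T) 1 = fderiv ℝ k 0 1 - w := by simp [T]
  rw [e] at h3
  simp at h3
  exact h3.trans h2

theorem visc {A : V → V →L[ℝ] V} {L : ℝ} (hA : NiceJ A L) {O : Set V} (hO : IsOpen O) (hA2 : ∀ x ∈ O, ∀ v, A x (A x v) = -v)
    {u : V → ℝ} (hu : PM A O u) {x : V} (hx : x ∈ O) {φ : V → ℝ} {D : V →L[ℝ] ℝ} {Q : V →L[ℝ] V →L[ℝ] ℝ} (hφ : HasQuad φ x D Q)
    (hφc : ∀ᶠ y in 𝓝 x, ContinuousAt φ y) (hmax : ∀ᶠ y in 𝓝 x, u y - φ y ≤ u x - φ x) (w : V) :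
    0 ≤ Q w w + Q (A x w) (A x w) + D (NN A x w) := by
  by_contra hneg
  push Not at hneg
  have hHc : Continuous (fun w => Q w w + Q (A x w) (A x w) + D (NN A x w)) := by
    unfold NN; fun_prop
  have hHe : ∀ᶠ w' in 𝓝 w, Q w' w' + Q (A x w') (A x w') + D (NN A x w') < 0 := hHc.continuousAt.eventually_lt_const hneg
  obtain ⟨ε, hε, hball⟩ := Metric.eventually_nhds_iff_ball.1 hHe
  obtain ⟨r0, hr0, hk⟩ := disc_exists' hA hO hA2 hx w (ε := ε / 2) (by positivity)
  obtain ⟨k, hk0, hkm, hkJ, hka⟩ := hk.self_of_nhds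
  have h0 : (0:ℂ) ∈ ball (0:ℂ) r0 := mem_ball_self hr0
  have hdc := deriv_close (w := w) (w' := A x w) hr0 (hkJ 0 h0).1 (half_pos hε) (fun τ hτ => by
    have := hka τ hτ 0 h0
    simpa using this)
  obtain ⟨w', hw'⟩ : ∃ w', w' = fderiv ℝ k 0 1 := ⟨_, rfl⟩
  rw [← hw'] at hdc
  have hH := hball w' (by rw [mem_ball, dist_eq_norm]; linarith)
  obtain ⟨H, hHd⟩ : ∃ H, H = Q w' w' + Q (A x w') (A x w') + D (NN A x w') := ⟨_, rfl⟩
  rw [← hHd] at hH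
  have hl := locLip_of_JH hA isOpen_ball hkJ (fun τ hτ => hA2 _ (hkm hτ))
  have hm := M2' hA isOpen_ball hkJ hl (fun τ hτ => hA2 _ (hkm hτ)) h0 (by rw [hk0]; exact hφ) (by rw [hk0]; exact hφc) hw' (η := -H / 8) (by linarith)
  rw [hk0, ← hHd] at hm
  have hkc : ContinuousAt k 0 := (hkJ 0 h0).1.continuousAt
  have hn1 : ∀ᶠ τ in 𝓝 (0:ℂ), (u (k τ) - φ (k τ) ≤ u x - φ x ∧ ContinuousAt φ (k τ)) := by
    have := hkc.tendsto
    rw [hk0] at this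
    exact this.eventually (hmax.and hφc)
  obtain ⟨r1, hr1, hb1⟩ := Metric.eventually_nhds_iff_ball.1 hn1
  have v : ∀ᶠ r in 𝓝[>] (0:ℝ), r ∈ Ioo 0 (min r0 r1) := Ioo_mem_nhdsGT (by positivity)
  obtain ⟨r, hr, hrI⟩ := (hm.and v).exists
  have hrp := hrI.1
  have hrr0 : r < r0 := hrI.2.trans_le (min_le_left _ _)
  have hrr1 : r < r1 := hrI.2.trans_le (min_le_right _ _)
  have hs0 : ∀ τ ∈ sphere (0:ℂ) |r|, τ ∈ ball (0:ℂ) r0 ∧ τ ∈ ball (0:ℂ) r1 := fun τ hτ => by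
    rw [abs_of_pos hrp] at hτ
    simp at hτ
    constructor <;> simp <;> linarith
  have hsub := hu.2 k 0 r0 r hkJ hkm hrp hrr0
  rw [hk0] at hsub
  have hi1 : CircleIntegrable (fun τ => u (k τ)) 0 r := circInt_of_cont fun τ hτ => by
    have a1 := (hu.1.continuousAt (hO.mem_nhds (hkm (hs0 τ hτ).1)))
    exact ContinuousAt.comp (g := u) a1 (hkJ τ (hs0 τ hτ).1).1.continuousAt
  have hi2 : CircleIntegrable (fun τ => φ (k τ)) 0 r := circInt_of_cont fun τ hτ => by
    have a1 := (hb1 τ (hs0 τ hτ).2).2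
    exact ContinuousAt.comp (g := φ) a1 (hkJ τ (hs0 τ hτ).1).1.continuousAt
  have hi3 : Real.circleAverage (fun τ => u (k τ) - φ (k τ)) 0 r ≤ u x - φ x := by
    apply Real.circleAverage_mono_on_of_le_circle (hi1.sub hi2)
    intro τ hτ
    exact (hb1 τ (hs0 τ hτ).2).1
  rw [ca_sub' hi1 hi2] at hi3
  have := (abs_le.1 hr).2
  have hr2 : 0 < r ^ 2 := by positivity
  nlinarith

theorem exists_ker (hV : 2 < Module.finrank ℝ V) (D1 D2 : V →L[ℝ] ℝ) : ∃ w, w ≠ 0 ∧ D1 w = 0 ∧ D2 w = 0 := by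
  let T : V →ₗ[ℝ] ℝ × ℝ := (D1 : V →ₗ[ℝ] ℝ).prod (D2 : V →ₗ[ℝ] ℝ)
  have : LinearMap.ker T ≠ ⊥ := LinearMap.ker_ne_bot_of_finrank_lt (by simpa using hV)
  obtain ⟨w, hw, hw0⟩ := (Submodule.ne_bot_iff _).1 this
  rw [LinearMap.mem_ker] at hw
  exact ⟨w, hw0, congrArg Prod.fst hw, congrArg Prod.snd hw⟩

end P6b
end RS

namespace RS

section P6c
variable {V : Type*} [NormedAddCommGroup V] [InnerProductSpace ℝ V] [FiniteDimensional ℝ V]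

theorem SQ_sq (t : ℝ) : SQ (fun t => t ^ 2) t (2 * t) 2 := by
  have := SQ.of_deriv (Θ := fun t : ℝ => t ^ 2) (Θ' := fun t => 2 * t) (t := t) (b := 2) (Eventually.of_forall fun y => by
    simpa using hasDerivAt_pow 2 y) (by simpa using (hasDerivAt_id t).const_mul 2)
  exact this

theorem SQ_mul (κ t : ℝ) : SQ (fun t => κ * t) t κ 0 := by
  have := SQ.of_deriv (Θ := fun t : ℝ => κ * t) (Θ' := fun t => κ) (t := t) (b := 0) (Eventually.of_forall fun y => by
    simpa using (hasDerivAt_id y).const_mul κ) (hasDerivAt_const _ _)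
  exact this

theorem SQ_inv {lam a t : ℝ} (h : t ≠ a) : SQ (fun t => lam / (t - a)) t (-lam / (t - a) ^ 2) (2 * lam / (t - a) ^ 3) := by
  have := SQ.of_deriv (Θ := fun t : ℝ => lam / (t - a)) (Θ' := fun t => -lam / (t - a) ^ 2) (t := t) (b := 2 * lam / (t - a) ^ 3) ?_ ?_
  · exact this
  · filter_upwards [isOpen_ne.mem_nhds h] with y hy
    have hy' : y - a ≠ 0 := sub_ne_zero.2 hy
    refine ((hasDerivAt_const y lam).div ((hasDerivAt_id y).sub_const a) hy').congr_deriv ?_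
    simp
  · have hy' : t - a ≠ 0 := sub_ne_zero.2 h
    refine ((hasDerivAt_const t (-lam)).div (((hasDerivAt_id t).sub_const a).pow 2) (by simpa using hy')).congr_deriv ?_
    simp
    field_simp

theorem quad_bd {T : V →L[ℝ] V →L[ℝ] ℝ} {C : ℝ} (h : ‖T‖ ≤ C) (v : V) : |T v v| ≤ C * ‖v‖ ^ 2 := by
  have h1 := T.le_opNorm₂ v v
  rw [Real.norm_eq_abs] at h1
  have : ‖T‖ * ‖v‖ * ‖v‖ ≤ C * ‖v‖ * ‖v‖ := by gcongr
  nlinarith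

/-- the barrier function has positive Levi form -/
theorem barrier {A : V → V →L[ℝ] V} {L : ℝ} {E : Set V} {p : V} {R : ℝ} {Y : Fin 2 → V → ℝ} {D : Fin 2 → V → V →L[ℝ] ℝ}
    {Q : Fin 2 → V → V →L[ℝ] V →L[ℝ] ℝ} {C c : ℝ} (h : LD A L E p R Y D Q C c) :
    ∃ κ > 0, ∃ δ > 0, ∀ x ∈ ball p R, (∀ i, |Y i x| ≤ δ) → ∀ y, ‖x - y‖ ≤ 2 →
      ∃ DP QP, HasQuad (fun z => Y 0 z ^ 2 + Y 1 z ^ 2 + (-κ) * (Bf 0 (z - y) (z - y) + 0)) x DP QP ∧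
        ∀ w, w ≠ 0 → 0 < QP w w + QP (A x w) (A x w) + DP (NN A x w) := by
  have hL := h.nice.nonneg
  have hc := h.cpos
  have hC : 0 ≤ C := (norm_nonneg _).trans (h.Db p (mem_ball_self h.Rpos) 0)
  obtain ⟨κ, hκ⟩ : ∃ κ, κ = c / (4 * (2 + 10 * L ^ 2)) := ⟨_, rfl⟩
  obtain ⟨δ, hδ⟩ : ∃ δ, δ = c / (4 * (4 * C * (1 + 3 * L ^ 2) + 1)) := ⟨_, rfl⟩
  have hκ0 : 0 < κ := by rw [hκ]; positivity
  have hδ0 : 0 < δ := by rw [hδ]; positivity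
  have hκ1 : κ * (2 + 10 * L ^ 2) ≤ c / 4 := by rw [hκ]; field_simp; rfl
  have hδ1 : δ * (4 * C * (1 + 3 * L ^ 2)) ≤ c / 4 := by
    have : δ * (4 * C * (1 + 3 * L ^ 2) + 1) = c / 4 := by rw [hδ]; field_simp
    linarith
  refine ⟨κ, hκ0, δ, hδ0, fun x hx hY y hy => ?_⟩
  have q0 := (h.quad x hx 0).comp (SQ_sq (Y 0 x))
  have q1 := (h.quad x hx 1).comp (SQ_sq (Y 1 x))
  have q2 := (Bf_quad (0 : V →L[ℝ] V) y x 0).comp (SQ_mul (-κ) _)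
  refine ⟨_, _, (q0.add q1).add q2, fun w hw => ?_⟩
  have hw2 : 0 < ‖w‖ ^ 2 := by positivity
  have hlow := h.low x hx w
  have hAw : ‖A x w‖ ≤ L * ‖w‖ := (A x).le_of_opNorm_le (h.nice.bd x) w
  have hAw2 : ‖A x w‖ ^ 2 ≤ L ^ 2 * ‖w‖ ^ 2 := by rw [← mul_pow]; gcongr
  have hN := NN_le h.nice x w
  have hY1 : ∀ i, |Q i x w w + Q i x (A x w) (A x w) + D i x (NN A x w)| ≤ C * (1 + 3 * L ^ 2) * ‖w‖ ^ 2 := fun i => by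
    have a1 := quad_bd (h.Qb x hx i) w
    have a2 := quad_bd (h.Qb x hx i) (A x w)
    have a3 := (D i x).le_of_opNorm_le (h.Db x hx i) (NN A x w)
    rw [Real.norm_eq_abs] at a3
    have a4 : C * ‖NN A x w‖ ≤ C * (2 * L ^ 2 * ‖w‖ ^ 2) := by gcongr
    have a5 : C * ‖A x w‖ ^ 2 ≤ C * (L ^ 2 * ‖w‖ ^ 2) := by gcongr
    have := abs_add_three (Q i x w w) (Q i x (A x w) (A x w)) (D i x (NN A x w))
    nlinarith
  have hY2 : ∀ i, -(c / 16 * 1 * ‖w‖ ^ 2) * 1 ≤ Y i x * (Q i x w w + Q i x (A x w) (A x w) + D i x (NN A x w)) := fun i => by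
    have a1 := neg_abs_le (Y i x * (Q i x w w + Q i x (A x w) (A x w) + D i x (NN A x w)))
    rw [abs_mul] at a1
    have a2 : |Y i x| * |Q i x w w + Q i x (A x w) (A x w) + D i x (NN A x w)| ≤ δ * (C * (1 + 3 * L ^ 2) * ‖w‖ ^ 2) := by
      gcongr
      · exact hY i
      · exact hY1 i
    have a3 := mul_le_mul_of_nonneg_right hδ1 hw2.le
    nlinarith
  have hin : |inner ℝ (x - y) (NN A x w)| ≤ 2 * (2 * L ^ 2 * ‖w‖ ^ 2) := by
    have := abs_real_inner_le_norm (x - y) (NN A x w)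
    have : ‖x - y‖ * ‖NN A x w‖ ≤ 2 * (2 * L ^ 2 * ‖w‖ ^ 2) := by gcongr
    linarith
  have hin2 := (abs_le.1 hin).2
  have e1 := hY2 0
  have e2 := hY2 1
  have hB : ∀ v : V, Bf (0 : V →L[ℝ] V) v v = ‖v‖ ^ 2 := fun v => by simp [Bf_apply]
  have hB2 : Bf (0 : V →L[ℝ] V) (x - y) (NN A x w) = inner ℝ (x - y) (NN A x w) := by rw [Bf_apply]; simp only [ContinuousLinearMap.zero_apply, inner_zero_left, add_zero]
  simp only [ContinuousLinearMap.add_apply, ContinuousLinearMap.smul_apply, ContinuousLinearMap.smulRight_apply, smul_eq_mul, hB, hB2, zero_mul, add_zero]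
  have k1 : κ * (2 * ‖w‖ ^ 2 + 2 * ‖A x w‖ ^ 2 + 2 * inner ℝ (x - y) (NN A x w)) ≤ κ * ((2 + 10 * L ^ 2) * ‖w‖ ^ 2) := by
    gcongr
    linarith
  have k2 := mul_le_mul_of_nonneg_right hκ1 hw2.le
  have k3 : 0 < c * ‖w‖ ^ 2 := by positivity
  nlinarith

theorem upper_bound (hV : 2 < Module.finrank ℝ V) {A : V → V →L[ℝ] V} {L : ℝ} {E : Set V} {p : V} {R : ℝ} {Y : Fin 2 → V → ℝ} {D : Fin 2 → V → V →L[ℝ] ℝ}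
    {Q : Fin 2 → V → V →L[ℝ] V →L[ℝ] ℝ} {C c : ℝ} (h : LD A L E p R Y D Q C c) (hp : p ∈ E) (hO : IsOpen (ball p R \ E))
    {u : V → ℝ} (hu : PM A (ball p R \ E) u) : ∃ r1 > 0, ∃ M, ∀ y ∈ ball p r1 \ E, u y ≤ M := by
  obtain ⟨κ, hκ, δ, hδ, hbar⟩ := barrier h
  have hYc : ∀ i, ∀ x ∈ ball p R, ContinuousAt (Y i) x := fun i x hx => (h.hasF x hx i).continuousAt
  have hpb := mem_ball_self (x := p) h.Rpos
  have hYp : ∀ i, Y i p = 0 := (h.Ech p hpb).1 hp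
  have hYe : ∀ᶠ x in 𝓝 p, ∀ i, |Y i x| < δ := by
    rw [eventually_all]
    intro i
    exact (hYc i p hpb).abs.eventually_lt_const (by simpa [hYp] using hδ)
  obtain ⟨R1, hR1, hall⟩ := Metric.eventually_nhds_iff_ball.1 hYe
  obtain ⟨ρ, hρ⟩ : ∃ ρ, ρ = min (min (R / 2) (R1 / 2)) (1 / 2) := ⟨_, rfl⟩
  have hRp := h.Rpos
  have hρ0 : 0 < ρ := by rw [hρ]; positivity
  have hρR : ρ < R := by have : ρ ≤ R / 2 := by rw [hρ]; exact (min_le_left _ _).trans (min_le_left _ _)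
                         linarith
  have hρR1 : ρ < R1 := by have : ρ ≤ R1 / 2 := by rw [hρ]; exact (min_le_left _ _).trans (min_le_right _ _)
                           linarith
  have hρ1 : ρ ≤ 1 / 2 := by rw [hρ]; exact min_le_right _ _
  have hcb : closedBall p ρ ⊆ ball p R := closedBall_subset_ball hρR
  have hYcc : ∀ i, ContinuousOn (Y i) (closedBall p ρ) := fun i x hx => (hYc i x (hcb hx)).continuousWithinAt
  obtain ⟨M, hM⟩ : ∃ M, ∀ x ∈ sphere p ρ, κ * (ρ / 2) ^ 2 ≤ Y 0 x ^ 2 + Y 1 x ^ 2 → u x ≤ M := by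
    have hK : IsCompact (sphere p ρ ∩ {x | κ * (ρ / 2) ^ 2 ≤ Y 0 x ^ 2 + Y 1 x ^ 2}) := by
      have hcl : IsClosed (sphere p ρ ∩ (fun x => Y 0 x ^ 2 + Y 1 x ^ 2) ⁻¹' Ici (κ * (ρ / 2) ^ 2)) := by
        refine ContinuousOn.preimage_isClosed_of_isClosed ?_ isClosed_sphere isClosed_Ici
        exact ((((hYcc 0).pow 2).add ((hYcc 1).pow 2))).mono sphere_subset_closedBall
      exact (isCompact_sphere p ρ).of_isClosed_subset hcl inter_subset_left
    have hKO : sphere p ρ ∩ {x | κ * (ρ / 2) ^ 2 ≤ Y 0 x ^ 2 + Y 1 x ^ 2} ⊆ ball p R \ E := by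
      rintro x ⟨hx1, hx2⟩
      have hxb := hcb (sphere_subset_closedBall hx1)
      refine ⟨hxb, fun hxE => ?_⟩
      have hz := (h.Ech x hxb).1 hxE
      simp only [mem_setOf_eq, hz] at hx2
      have : 0 < κ * (ρ / 2) ^ 2 := by positivity
      linarith
    obtain ⟨M, hM⟩ := hK.bddAbove_image (hu.1.mono hKO)
    exact ⟨M, fun x hx1 hx2 => hM (mem_image_of_mem u ⟨hx1, hx2⟩)⟩
  refine ⟨ρ / 2, by positivity, M, fun y hy => ?_⟩
  have hyρ : ‖y - p‖ < ρ / 2 := by simpa [dist_eq_norm] using hy.1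
  obtain ⟨P, hP⟩ : ∃ P, P = (fun z => Y 0 z ^ 2 + Y 1 z ^ 2 + (-κ) * (Bf (0 : V →L[ℝ] V) (z - y) (z - y) + 0)) := ⟨_, rfl⟩
  have hPv : ∀ z, P z = Y 0 z ^ 2 + Y 1 z ^ 2 - κ * ‖z - y‖ ^ 2 := fun z => by
    have : Bf (0 : V →L[ℝ] V) (z - y) (z - y) = ‖z - y‖ ^ 2 := by
      rw [Bf_apply]; simp only [ContinuousLinearMap.zero_apply, inner_zero_left, add_zero, real_inner_self_eq_norm_sq]
    rw [hP]; simp only [this]; ring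
  have hPc : ∀ x ∈ ball p R, ContinuousAt P x := fun x hx => by
    have : P = fun z => Y 0 z ^ 2 + Y 1 z ^ 2 - κ * ‖z - y‖ ^ 2 := funext hPv
    rw [this]
    have a0 := hYc 0 x hx
    have a1 := hYc 1 x hx
    fun_prop
  have hPcc : ContinuousOn P (closedBall p ρ) := fun x hx => (hPc x (hcb hx)).continuousWithinAt
  have hybc : y ∈ closedBall p ρ := by rw [mem_closedBall, dist_eq_norm]; linarith
  have hyb := hcb hybc
  have hPy : 0 < P y := by
    rw [hPv]
    by_contra hcon
    apply hy.2
    rw [h.Ech y hyb]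
    simp at hcon
    have s0 := sq_nonneg (Y 0 y); have s1 := sq_nonneg (Y 1 y)
    intro i
    fin_cases i
    · exact pow_eq_zero_iff (two_ne_zero) |>.1 (by show Y 0 y ^ 2 = 0; linarith)
    · exact pow_eq_zero_iff (two_ne_zero) |>.1 (by show Y 1 y ^ 2 = 0; linarith)
  obtain ⟨a, ha⟩ : ∃ a, a = P y / 2 := ⟨_, rfl⟩
  have ha0 : 0 < a := by rw [ha]; linarith
  have hScomp : ∀ b, IsCompact (closedBall p ρ ∩ P ⁻¹' Ici b) := fun b =>
    (isCompact_closedBall p ρ).of_isClosed_subset (hPcc.preimage_isClosed_of_isClosed isClosed_closedBall isClosed_Ici) inter_subset_left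
  have hSO : ∀ b, 0 < b → closedBall p ρ ∩ P ⁻¹' Ici b ⊆ ball p R \ E := by
    rintro b hb x ⟨hx1, hx2⟩
    refine ⟨hcb hx1, fun hxE => ?_⟩
    have hz := (h.Ech x (hcb hx1)).1 hxE
    simp only [mem_preimage, mem_Ici, hPv, hz] at hx2
    have : 0 ≤ κ * ‖x - y‖ ^ 2 := by positivity
    linarith
  obtain ⟨B, hB⟩ := (hScomp a).bddAbove_image (hu.1.mono (hSO a ha0))
  have hBv : ∀ x ∈ closedBall p ρ, a ≤ P x → u x ≤ B := fun x h1 h2 => hB (mem_image_of_mem u ⟨h1, h2⟩)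
  have hlam : ∀ lam > 0, u y ≤ M + lam / a := by
    intro lam hlam
    obtain ⟨d, hd0, hda, hd⟩ : ∃ d, 0 < d ∧ d < a ∧ B - lam / d < u y - lam / a := by
      have t1 : Tendsto (fun d : ℝ => lam / d) (𝓝[>] 0) atTop := by
        simpa [div_eq_mul_inv] using tendsto_inv_nhdsGT_zero.const_mul_atTop hlam
      have t2 := t1.eventually (eventually_gt_atTop (B - (u y - lam / a)))
      have v : ∀ᶠ r in 𝓝[>] (0:ℝ), r ∈ Ioo 0 a := Ioo_mem_nhdsGT ha0
      obtain ⟨d, h1, h2⟩ := (t2.and v).exists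
      exact ⟨d, h2.1, h2.2, by linarith⟩
    have hSd : closedBall p ρ ∩ P ⁻¹' Ici (a + d) ⊆ ball p R \ E := hSO _ (by positivity)
    have hvc : ContinuousOn (fun x => u x - lam / (P x - a)) (closedBall p ρ ∩ P ⁻¹' Ici (a + d)) := by
      refine (hu.1.mono hSd).sub (continuousOn_const.div ((hPcc.mono inter_subset_left).sub continuousOn_const) ?_)
      rintro x ⟨_, hx2⟩
      have : a + d ≤ P x := hx2
      intro h0
      linarith
    have hPy2 : P y = 2 * a := by rw [ha]; ring
    have hyS : y ∈ closedBall p ρ ∩ P ⁻¹' Ici (a + d) := ⟨hybc, by show a + d ≤ P y; linarith⟩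
    obtain ⟨x, hxS, hxmax⟩ := (hScomp (a + d)).exists_isMaxOn ⟨y, hyS⟩ hvc
    have hx1 := hxS.1
    have hx2 : a + d ≤ P x := hxS.2
    have hymax : u y - lam / (P y - a) ≤ u x - lam / (P x - a) := hxmax hyS
    have e : P y - a = a := by rw [hPy2]; ring
    rw [e] at hymax
    rcases eq_or_lt_of_le hx2 with hPe | hPl
    · exfalso
      have b1 := hBv x hx1 (by linarith)
      have e2 : P x - a = d := by rw [← hPe]; ring
      rw [e2] at hymax
      linarith
    have hPpos : 0 < lam / (P x - a) := div_pos hlam (by linarith)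
    rcases eq_or_lt_of_le (mem_closedBall.1 hx1) with hse | hsl
    · have b1 := hM x (mem_sphere.2 hse) (by
        have p1 := hPv x
        have n1 : ρ / 2 ≤ ‖x - y‖ := by
          have := norm_sub_norm_le (x - p) (y - p)
          rw [dist_eq_norm] at hse
          rw [sub_sub_sub_cancel_right] at this
          linarith
        have : κ * (ρ / 2) ^ 2 ≤ κ * ‖x - y‖ ^ 2 := by gcongr
        linarith)
      linarith
    exfalso
    have hxb : x ∈ ball p R := hcb hx1
    obtain ⟨DP, QP, hq, hpos⟩ := hbar x hxb (fun i => (hall x (mem_ball.2 (by linarith [mem_closedBall.1 hx1])) i).le) y (by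
      have n1 : ‖x - p‖ ≤ ρ := by simpa [dist_eq_norm] using hx1
      have := norm_sub_le (x - p) (y - p)
      rw [sub_sub_sub_cancel_right] at this
      linarith)
    rw [← hP] at hq
    have hne : P x ≠ a := by intro h0; linarith
    have hq2 := hq.comp (SQ_inv (lam := lam) hne)
    obtain ⟨w, hw0, hw1, hw2⟩ := exists_ker hV DP (DP.comp (A x))
    have hv := visc h.nice hO (fun z hz => h.sq z hz.1) hu (hSd hxS) hq2 ?_ ?_ w
    · have := hpos w hw0
      simp only [ContinuousLinearMap.comp_apply] at hw2
      simp only [ContinuousLinearMap.add_apply, ContinuousLinearMap.smul_apply, ContinuousLinearMap.smulRight_apply, smul_eq_mul, hw1, hw2, mul_zero, add_zero] at hv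
      have hneg : -lam / (P x - a) ^ 2 < 0 := by
        apply div_neg_of_neg_of_pos (by linarith)
        have : 0 < P x - a := by linarith
        positivity
      nlinarith
    · have e1 : ∀ᶠ z in 𝓝 x, a < P z := (hPc x hxb).eventually_const_lt (by linarith)
      filter_upwards [e1, isOpen_ball.mem_nhds hxb] with z hz1 hz2
      have := hPc z hz2
      have hn : P z - a ≠ 0 := by intro h0; linarith
      exact continuousAt_const.div (this.sub continuousAt_const) hn
    · have e1 : ∀ᶠ z in 𝓝 x, a + d < P z := (hPc x hxb).eventually_const_lt hPl
      filter_upwards [e1, isOpen_ball.mem_nhds (mem_ball.2 hsl)] with z hz1 hz2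
      exact hxmax ⟨ball_subset_closedBall hz2, hz1.le⟩
  have hlim : Tendsto (fun lam : ℝ => M + lam / a) (𝓝[>] 0) (𝓝 M) := by
    have : Continuous (fun lam : ℝ => M + lam / a) := by fun_prop
    have := (this.tendsto 0).mono_left (nhdsWithin_le_nhds (s := Ioi 0))
    simpa using this
  exact ge_of_tendsto hlim (by filter_upwards [self_mem_nhdsWithin] with lam hl using hlam lam hl)

end P6c
end RS

namespace RS

section P7
variable {V : Type*} [NormedAddCommGroup V] [InnerProductSpace ℝ V] [FiniteDimensional ℝ V]

/-- existence of discs through points near `x`, meeting `E` in at most one point -/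
def DF (A : V → V →L[ℝ] V) (E : Set V) (p : V) (R : ℝ) (x w : V) (η : ℝ) : Prop :=
  ∃ r0 > 0, ∀ᶠ y in 𝓝[ball p R \ E] x, ∃ (k : ℂ → V) (ζ1 : ℂ), ζ1 ≠ 0 ∧ k 0 = y ∧ MapsTo k (ball 0 r0) (ball p R) ∧
    JH A k (ball 0 r0) ∧ (∀ τ ∈ ball (0:ℂ) r0, ∀ τ' ∈ ball (0:ℂ) r0,
      ‖k τ - k τ' - ((τ - τ').re • w + (τ - τ').im • A y w)‖ ≤ η * ‖τ - τ'‖) ∧ ∀ τ ∈ ball (0:ℂ) r0, τ ≠ ζ1 → k τ ∉ E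

theorem DF_O {A : V → V →L[ℝ] V} {L : ℝ} (hA : NiceJ A L) {E : Set V} {p : V} {R : ℝ} (hO : IsOpen (ball p R \ E))
    (hA2 : ∀ x ∈ ball p R, ∀ v, A x (A x v) = -v) {x : V} (hx : x ∈ ball p R \ E) (w : V) {η : ℝ} (hη : 0 < η) : DF A E p R x w η := by
  obtain ⟨r0, hr0, hk⟩ := disc_exists' hA hO (fun x hx => hA2 x hx.1) hx w hη
  refine ⟨r0, hr0, ?_⟩
  filter_upwards [nhdsWithin_le_nhds hk] with y hy
  obtain ⟨k, h1, h2, h3, h4⟩ := hy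
  exact ⟨k, 1, one_ne_zero, h1, fun τ hτ => (h2 hτ).1, h3, h4, fun τ hτ _ => (h2 hτ).2⟩

theorem generic_dir (hV : Module.finrank ℝ V = 4) {D0 D1 : V →L[ℝ] ℝ} {B : V →L[ℝ] V}
    (hinj : ∀ w, D0 w = 0 → D1 w = 0 → D0 (B w) = 0 → D1 (B w) = 0 → w = 0) (v : V) {η : ℝ} (hη : 0 < η) :
    ∃ w, ‖w - v‖ ≤ η ∧ D0 w * D1 (B w) - D1 w * D0 (B w) ≠ 0 := by
  let T : V →ₗ[ℝ] (ℝ × ℝ) × (ℝ × ℝ) := ((D0 : V →ₗ[ℝ] ℝ).prod (D1 : V →ₗ[ℝ] ℝ)).prod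
    (((D0.comp B : V →L[ℝ] ℝ) : V →ₗ[ℝ] ℝ).prod ((D1.comp B : V →L[ℝ] ℝ) : V →ₗ[ℝ] ℝ))
  have hTv : ∀ w, T w = ((D0 w, D1 w), (D0 (B w), D1 (B w))) := fun w => rfl
  have hTi : Function.Injective T := by
    rw [← LinearMap.ker_eq_bot, LinearMap.ker_eq_bot']
    intro w hw
    rw [hTv] at hw
    simp only [Prod.mk_eq_zero] at hw
    exact hinj w hw.1.1 hw.1.2 hw.2.1 hw.2.2
  have hTs : Function.Surjective T := (LinearMap.injective_iff_surjective_of_finrank_eq_finrank (by simp [hV])).1 hTi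
  obtain ⟨w0, hw0⟩ := hTs ((1, 0), (0, 1))
  rw [hTv] at hw0
  simp only [Prod.mk.injEq] at hw0
  obtain ⟨⟨e1, e2⟩, e3, e4⟩ := hw0
  obtain ⟨s, hs⟩ : ∃ s, s = η / (‖w0‖ + 1) := ⟨_, rfl⟩
  have hs0 : 0 < s := by rw [hs]; positivity
  have hsn : s * ‖w0‖ ≤ η := by
    have : s * (‖w0‖ + 1) = η := by rw [hs]; field_simp
    nlinarith
  by_contra hcon
  push Not at hcon
  have c0 := hcon v (by simp [hη.le])
  have c1 := hcon (v + s • w0) (by simpa [norm_smul, abs_of_pos hs0] using hsn)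
  have c2 := hcon (v + (-s) • w0) (by simpa [norm_smul, abs_of_pos hs0] using hsn)
  simp only [map_add, map_smul, smul_eq_mul, e1, e2, e3, e4] at c1 c2
  have : s ^ 2 = 0 := by linear_combination (1/2) * c1 + (1/2) * c2 - c0
  have : 0 < s ^ 2 := by positivity
  linarith

theorem T_lower {a b : Fin 2 → ℝ} (h : a 0 * b 1 - a 1 * b 0 ≠ 0) :
    ∃ m > 0, ∀ δ : ℂ, ∃ i, m * ‖δ‖ ≤ |δ.re * a i + δ.im * b i| := by
  let T : ℂ →ₗ[ℝ] (Fin 2 → ℝ) := LinearMap.pi fun i => a i • Complex.reLm + b i • Complex.imLm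
  have hTv : ∀ δ i, T δ i = δ.re * a i + δ.im * b i := fun δ i => by simp [T]; ring
  obtain ⟨K, hK, hT⟩ := LinearMap.exists_antilipschitzWith T (by
    rw [LinearMap.ker_eq_bot']
    intro δ hδ
    have e0 := congrFun hδ 0
    have e1 := congrFun hδ 1
    rw [hTv] at e0 e1
    simp at e0 e1
    have f1 : δ.re * (a 0 * b 1 - a 1 * b 0) = 0 := by linear_combination b 1 * e0 - b 0 * e1
    have f2 : δ.im * (a 0 * b 1 - a 1 * b 0) = 0 := by linear_combination a 0 * e1 - a 1 * e0
    apply Complex.ext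
    · simpa using (mul_eq_zero.1 f1).resolve_right h
    · simpa using (mul_eq_zero.1 f2).resolve_right h)
  have hKr : (0:ℝ) < K := hK
  refine ⟨1 / (2 * K), by positivity, fun δ => ?_⟩
  by_contra hcon
  push Not at hcon
  have h1 : ‖δ‖ ≤ K * ‖T δ‖ := by simpa using hT.le_mul_dist δ 0
  have h2 : ‖T δ‖ ≤ 1 / (2 * K) * ‖δ‖ := by
    rw [pi_norm_le_iff_of_nonneg (by positivity)]
    intro i
    rw [Real.norm_eq_abs, hTv]
    exact (hcon i).le
  have h3 : (K:ℝ) * (1 / (2 * K) * ‖δ‖) = ‖δ‖ / 2 := by field_simp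
  have h4 := mul_le_mul_of_nonneg_left h2 hKr.le
  have h5 : ‖δ‖ ≤ 0 := by linarith
  have h6 := hcon 0
  have : ‖δ‖ = 0 := le_antisymm h5 (norm_nonneg _)
  rw [this] at h6
  simp at h6
  exact absurd h6 (not_lt.2 (abs_nonneg _))

theorem DF_E (hV : Module.finrank ℝ V = 4) {A : V → V →L[ℝ] V} {L : ℝ} {E : Set V} {p : V} {R : ℝ} {Y : Fin 2 → V → ℝ} {D : Fin 2 → V → V →L[ℝ] ℝ}
    {Q : Fin 2 → V → V →L[ℝ] V →L[ℝ] ℝ} {C c : ℝ} (h : LD A L E p R Y D Q C c) {x : V} (hx : x ∈ ball p R)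
    (v : V) {η : ℝ} (hη : 0 < η) : ∃ w, ‖w - v‖ ≤ η ∧ DF A E p R x w η := by
  have hL := h.nice.nonneg
  have hC : 0 ≤ C := (norm_nonneg _).trans (h.Db p (mem_ball_self h.Rpos) 0)
  obtain ⟨w, hwv, hdet⟩ := generic_dir hV (D0 := D 0 x) (D1 := D 1 x) (B := A x) (fun w e1 e2 e3 e4 => by
    have := h.low x hx w
    rw [e1, e2, e3, e4] at this
    have hc := h.cpos
    by_contra hw
    have : 0 < ‖w‖ ^ 2 := by positivity
    have : 0 < c * ‖w‖ ^ 2 := by positivity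
    linarith) v hη
  refine ⟨w, hwv, ?_⟩
  obtain ⟨m, hm, hT⟩ := T_lower (a := fun i => D i x w) (b := fun i => D i x (A x w)) hdet
  obtain ⟨B, hB⟩ : ∃ B, B = 2 + (1 + L) * ‖w‖ := ⟨_, rfl⟩
  have hB0 : 0 < B := by rw [hB]; positivity
  obtain ⟨e1, he1⟩ : ∃ e1, e1 = min (min 1 η) (m / (2 * (B + 2 * C + 1))) := ⟨_, rfl⟩
  have he0 : 0 < e1 := by rw [he1]; positivity
  have he1' : e1 ≤ 1 := by rw [he1]; exact (min_le_left _ _).trans (min_le_left _ _)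
  have heη : e1 ≤ η := by rw [he1]; exact (min_le_left _ _).trans (min_le_right _ _)
  have hem : e1 * (B + 2 * C) < m := by
    have a1 : e1 ≤ m / (2 * (B + 2 * C + 1)) := by rw [he1]; exact min_le_right _ _
    rw [le_div_iff₀ (by positivity)] at a1
    nlinarith
  -- strict differentiability
  have hst : ∀ i, HasStrictFDerivAt (Y i) (D i x) x := fun i =>
    hasStrictFDerivAt_of_hasFDerivAt_of_continuousAt (by
      filter_upwards [isOpen_ball.mem_nhds hx] with z hz using h.hasF z hz i) (h.Dc x hx i)
  have hst2 : ∀ᶠ q : V × V in 𝓝 (x, x), ∀ i, ‖Y i q.1 - Y i q.2 - D i x (q.1 - q.2)‖ ≤ e1 * ‖q.1 - q.2‖ := by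
    rw [eventually_all]
    exact fun i => (hst i).isLittleO.def he0
  rw [nhds_prod_eq] at hst2
  obtain ⟨t, ht, htt⟩ := (eventually_prod_self_iff (r := fun a b => ∀ i, ‖Y i a - Y i b - D i x (a - b)‖ ≤ e1 * ‖a - b‖)).1 hst2
  obtain ⟨R1, hR1, hb1⟩ := Metric.mem_nhds_iff.1 ht
  have hU : IsOpen (ball x R1 ∩ ball p R) := isOpen_ball.inter isOpen_ball
  obtain ⟨r0, hr0, hk⟩ := disc_exists' h.nice hU (fun z hz => h.sq z hz.2) (x := x) ⟨mem_ball_self hR1, hx⟩ w he0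
  have hAc : ∀ᶠ y in 𝓝 x, ‖A y w - A x w‖ < e1 := by
    have : ContinuousAt (fun y => ‖A y w - A x w‖) x := by
      have := (h.nice.diff x).continuousAt
      fun_prop
    exact this.eventually_lt_const (by simpa using he0)
  refine ⟨r0, hr0, ?_⟩
  filter_upwards [nhdsWithin_le_nhds hk, nhdsWithin_le_nhds hAc, self_mem_nhdsWithin] with y hy hyA hyO
  obtain ⟨k, h1, h2, h3, h4⟩ := hy
  have huniq : ∀ τ ∈ ball (0:ℂ) r0, ∀ τ' ∈ ball (0:ℂ) r0, k τ ∈ E → k τ' ∈ E → τ = τ' := by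
    intro τ hτ τ' hτ' hE hE'
    obtain ⟨δ, hδ⟩ : ∃ δ, δ = τ - τ' := ⟨_, rfl⟩
    obtain ⟨i, hi⟩ := hT δ
    have a1 := h4 τ hτ τ' hτ'
    rw [← hδ] at a1
    obtain ⟨z, hz⟩ : ∃ z, z = k τ - k τ' := ⟨_, rfl⟩
    rw [← hz] at a1
    have hn := norm_nonneg δ
    have hre := Complex.abs_re_le_norm δ
    have him := Complex.abs_im_le_norm δ
    have a2 : ‖z - (δ.re • w + δ.im • A x w)‖ ≤ 2 * e1 * ‖δ‖ := by
      have e : z - (δ.re • w + δ.im • A x w) = (z - (δ.re • w + δ.im • A y w)) + δ.im • (A y w - A x w) := by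
        rw [smul_sub]; abel
      rw [e]
      refine (norm_add_le _ _).trans ?_
      rw [norm_smul, Real.norm_eq_abs]
      have : |δ.im| * ‖A y w - A x w‖ ≤ ‖δ‖ * e1 := by gcongr
      linarith
    have hAw : ‖A x w‖ ≤ L * ‖w‖ := (A x).le_of_opNorm_le (h.nice.bd x) w
    have a3 : ‖δ.re • w + δ.im • A x w‖ ≤ (1 + L) * ‖w‖ * ‖δ‖ := by
      refine (norm_add_le _ _).trans ?_
      rw [norm_smul, norm_smul, Real.norm_eq_abs, Real.norm_eq_abs]
      have b1 : |δ.re| * ‖w‖ ≤ ‖δ‖ * ‖w‖ := by gcongr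
      have b2 : |δ.im| * ‖A x w‖ ≤ ‖δ‖ * (L * ‖w‖) := by gcongr
      linarith
    have a4 : ‖z‖ ≤ B * ‖δ‖ := by
      have := norm_sub_norm_le z (δ.re • w + δ.im • A x w)
      have : 2 * e1 * ‖δ‖ ≤ 2 * ‖δ‖ := by nlinarith
      rw [hB]; linarith
    have hYE : ∀ τ ∈ ball (0:ℂ) r0, k τ ∈ E → Y i (k τ) = 0 := fun τ hτ hE => (h.Ech _ (h2 hτ).2).1 hE i
    have a5 := htt (k τ) (hb1 (h2 hτ).1) (k τ') (hb1 (h2 hτ').1) i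
    rw [hYE τ hτ hE, hYE τ' hτ' hE', ← hz] at a5
    simp only [sub_self, zero_sub, norm_neg, Real.norm_eq_abs] at a5
    have a6 := (D i x).le_of_opNorm_le (h.Db x hx i) (z - (δ.re • w + δ.im • A x w))
    rw [map_sub, Real.norm_eq_abs, map_add, map_smul, map_smul, smul_eq_mul, smul_eq_mul] at a6
    have a7 := abs_sub_abs_le_abs_sub (δ.re * D i x w + δ.im * D i x (A x w)) (D i x z)
    rw [abs_sub_comm] at a7
    have a8 : C * ‖z - (δ.re • w + δ.im • A x w)‖ ≤ C * (2 * e1 * ‖δ‖) := by gcongr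
    have a9 : e1 * ‖z‖ ≤ e1 * (B * ‖δ‖) := by gcongr
    have : m * ‖δ‖ ≤ (e1 * (B + 2 * C)) * ‖δ‖ := by linarith
    have hδ0 : ‖δ‖ = 0 := by
      by_contra hne
      have : 0 < ‖δ‖ := lt_of_le_of_ne hn (Ne.symm hne)
      nlinarith
    rw [norm_eq_zero, hδ, sub_eq_zero] at hδ0
    exact hδ0
  have hest : ∀ τ ∈ ball (0:ℂ) r0, ∀ τ' ∈ ball (0:ℂ) r0, ‖k τ - k τ' - ((τ - τ').re • w + (τ - τ').im • A y w)‖ ≤ η * ‖τ - τ'‖ := by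
    intro τ hτ τ' hτ'
    exact (h4 τ hτ τ' hτ').trans (by gcongr)
  by_cases hex : ∃ ζ1 ∈ ball (0:ℂ) r0, k ζ1 ∈ E
  · obtain ⟨ζ1, hζ, hζE⟩ := hex
    refine ⟨k, ζ1, ?_, h1, fun τ hτ => (h2 hτ).2, h3, hest, fun τ hτ hne hE => hne (huniq τ hτ ζ1 hζ hE hζE)⟩
    rintro rfl
    rw [h1] at hζE
    exact hyO.2 hζE
  · push Not at hex
    exact ⟨k, 1, one_ne_zero, h1, fun τ hτ => (h2 hτ).2, h3, hest, fun τ hτ _ => hex τ hτ⟩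

end P7
end RS

namespace RS

section P7b
variable {V : Type*} [NormedAddCommGroup V] [InnerProductSpace ℝ V] [FiniteDimensional ℝ V]

theorem tri_diff {T T' : V →L[ℝ] V →L[ℝ] V} {B B' B2 B2' : V →L[ℝ] V} {L d η : ℝ} (hL : 0 ≤ L) (hd : 0 ≤ d) (hη : 0 ≤ η)
    (hT' : ‖T'‖ ≤ L) (hTT : ‖T - T'‖ ≤ L * d) {a a' b b' : V} {Wa Wb : ℝ} 
    (ha : ‖a‖ ≤ Wa) (hb : ‖b‖ ≤ Wb) (ha' : ‖a'‖ ≤ Wa) {da db : ℝ} (haa : ‖a - a'‖ ≤ da) (hbb : ‖b - b'‖ ≤ db) :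
    ‖T a b - T' a' b'‖ ≤ L * d * Wa * Wb + L * da * Wb + L * Wa * db := by
  have e : T a b - T' a' b' = (T - T') a b + T' (a - a') b + T' a' (b - b') := by
    simp only [ContinuousLinearMap.sub_apply, map_sub]; abel
  rw [e]
  have hWa : 0 ≤ Wa := (norm_nonneg _).trans ha
  have hWb : 0 ≤ Wb := (norm_nonneg _).trans hb
  have hda : 0 ≤ da := (norm_nonneg _).trans haa
  refine (norm_add₃_le).trans ?_
  have h1 : ‖(T - T') a b‖ ≤ L * d * Wa * Wb := ((T - T').le_opNorm₂ a b).trans (by gcongr)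
  have h2 : ‖T' (a - a') b‖ ≤ L * da * Wb := (T'.le_opNorm₂ _ _).trans (by gcongr)
  have h3 : ‖T' a' (b - b')‖ ≤ L * Wa * db := (T'.le_opNorm₂ _ _).trans (by gcongr)
  linarith

theorem NN_diff {A : V → V →L[ℝ] V} {L : ℝ} (hA : NiceJ A L) {x y v w : V} {W η : ℝ} (hw : ‖w‖ ≤ W) (hv : ‖v‖ ≤ W) (hwv : ‖w - v‖ ≤ η) :
    ‖NN A y w - NN A x v‖ ≤ 4 * L ^ 2 * W ^ 2 * ‖y - x‖ + 4 * L ^ 2 * W * η := by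
  have hL := hA.nonneg
  have hη : 0 ≤ η := (norm_nonneg _).trans hwv
  have hW : 0 ≤ W := (norm_nonneg _).trans hw
  have hAv : ∀ (z v : V), ‖v‖ ≤ W → ‖A z v‖ ≤ L * W := fun z v h => ((A z).le_of_opNorm_le (hA.bd z) v).trans (by gcongr)
  have hAd : ‖A y w - A x v‖ ≤ L * ‖y - x‖ * W + L * η := by
    have e : A y w - A x v = (A y - A x) w + A x (w - v) := by
      simp only [ContinuousLinearMap.sub_apply, map_sub]; abel
    rw [e]
    refine (norm_add_le _ _).trans ?_
    have h1 : ‖(A y - A x) w‖ ≤ L * ‖y - x‖ * W := ((A y - A x).le_of_opNorm_le (hA.lip y x) w).trans (by gcongr)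
    have h2 : ‖A x (w - v)‖ ≤ L * η := ((A x).le_of_opNorm_le (hA.bd x) _).trans (by gcongr)
    linarith
  have h1 := tri_diff (B := 0) (B' := 0) (B2 := 0) (B2' := 0) hL (norm_nonneg (y - x)) hη (hA.bd1 x) (hA.lip1 y x) (hAv y w hw) hw (hAv x v hv) hAd hwv
  have h2 := tri_diff (B := 0) (B' := 0) (B2 := 0) (B2' := 0) hL (norm_nonneg (y - x)) hη (hA.bd1 x) (hA.lip1 y x) hw (hAv y w hw) hv hwv hAd
  unfold NN
  have e : fderiv ℝ A y (A y w) w - fderiv ℝ A y w (A y w) - (fderiv ℝ A x (A x v) v - fderiv ℝ A x v (A x v)) =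
    (fderiv ℝ A y (A y w) w - fderiv ℝ A x (A x v) v) - (fderiv ℝ A y w (A y w) - fderiv ℝ A x v (A x v)) := by abel
  rw [e]
  refine (norm_sub_le _ _).trans ?_
  refine (add_le_add h1 h2).trans (le_of_eq ?_)
  ring

/-- constants -/
noncomputable def K1 (L W : ℝ) : ℝ := L * W ^ 3 + L * W + L * ((1 + L) * W)
noncomputable def K2 (L W : ℝ) : ℝ := 4 * K1 L W + L ^ 2 * W ^ 2 + L ^ 2 * W
noncomputable def K3 (L W : ℝ) : ℝ := 3 + L + L * W
noncomputable def KK (L W : ℝ) : ℝ := K3 L W ^ 2 + 2 * K2 L W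

theorem mean_e {A : V → V →L[ℝ] V} {L : ℝ} (hA : NiceJ A L) {k g : ℂ → V} {R W η : ℝ} (hW : 0 ≤ W) (hη : 0 ≤ η)
    (hk : JH A k (ball 0 R)) (hk2 : ∀ τ ∈ ball (0:ℂ) R, ∀ v, A (k τ) (A (k τ) v) = -v)
    (hkl : ∀ τ ∈ ball (0:ℂ) R, ∀ τ' ∈ ball (0:ℂ) R, ‖k τ - k τ'‖ ≤ W * ‖τ - τ'‖)
    (hg : JH A g (ball 0 R)) (hg2 : ∀ τ ∈ ball (0:ℂ) R, ∀ v, A (g τ) (A (g τ) v) = -v)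
    (hgl : ∀ τ ∈ ball (0:ℂ) R, ∀ τ' ∈ ball (0:ℂ) R, ‖g τ - g τ'‖ ≤ W * ‖τ - τ'‖)
    {w v : V} (hw : ‖w‖ ≤ W) (hv : ‖v‖ ≤ W) (hwv : ‖w - v‖ ≤ η)
    (hkw : ∀ τ ∈ ball (0:ℂ) R, ‖k τ - k 0 - (τ.re • w + τ.im • A (k 0) w)‖ ≤ η * ‖τ‖)
    (hgv : ∀ τ ∈ ball (0:ℂ) R, ‖g τ - g 0 - (τ.re • v + τ.im • A (g 0) v)‖ ≤ η * ‖τ‖)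
    {r : ℝ} (hr : 0 < r) (hrR : r < R) (hrη : r ≤ η) :
    Real.circleAverage (fun τ => ‖k τ - g τ‖ ^ 2) 0 r ≤ ‖k 0 - g 0‖ ^ 2 + r ^ 2 * (KK L W * (η + ‖k 0 - g 0‖) ^ 2) := by
  have hL := hA.nonneg
  obtain ⟨e0, he0⟩ : ∃ e0, e0 = k 0 - g 0 := ⟨_, rfl⟩
  have hd0 := norm_nonneg e0
  have hsph : ∀ τ ∈ sphere (0:ℂ) |r|, τ ∈ ball (0:ℂ) R ∧ ‖τ‖ = r := fun τ hτ => by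
    rw [abs_of_pos hr, mem_sphere_zero_iff_norm] at hτ
    exact ⟨by rw [mem_ball_zero_iff, hτ]; exact hrR, hτ⟩
  have hki : CircleIntegrable k 0 r := circInt_of_cont fun τ hτ => (hk τ (hsph τ hτ).1).1.continuousAt
  have hgi : CircleIntegrable g 0 r := circInt_of_cont fun τ hτ => (hg τ (hsph τ hτ).1).1.continuousAt
  have m1 := lemM hA hk hk2 hW hkl hη hkw hr hrR
  have m2 := lemM hA hg hg2 hW hgl hη hgv hr hrR
  have m3 := NN_diff hA (x := g 0) (y := k 0) hw hv hwv
  rw [← he0] at m3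
  have hK1 : 0 ≤ K1 L W := by unfold K1; positivity
  have hb : ∀ z : V, ‖z‖ ≤ W → (L * W ^ 3 + L * W + L * ((1 + L) * ‖z‖)) * (r ^ 2 * (η + r)) ≤ K1 L W * (r ^ 2 * (2 * η)) := fun z hz => by
    unfold K1
    gcongr
    linarith
  have m4 : ‖Real.circleAverage (fun τ => k τ - g τ) 0 r - e0‖ ≤ r ^ 2 * (K2 L W * (η + ‖e0‖)) := by
    have e1 : Real.circleAverage (fun τ => k τ - g τ) 0 r = Real.circleAverage k 0 r - Real.circleAverage g 0 r := Real.circleAverage_fun_sub hki hgi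
    have e2 : Real.circleAverage k 0 r - Real.circleAverage g 0 r - e0 = (Real.circleAverage k 0 r - k 0 - (r ^ 2 / 4) • NN A (k 0) w)
      - (Real.circleAverage g 0 r - g 0 - (r ^ 2 / 4) • NN A (g 0) v) + (r ^ 2 / 4) • (NN A (k 0) w - NN A (g 0) v) := by
      rw [he0, smul_sub]; abel
    rw [e1, e2]
    refine (norm_add_le _ _).trans ?_
    have n1 := norm_sub_le (Real.circleAverage k 0 r - k 0 - (r ^ 2 / 4) • NN A (k 0) w) (Real.circleAverage g 0 r - g 0 - (r ^ 2 / 4) • NN A (g 0) v)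
    have n2 : ‖(r ^ 2 / 4) • (NN A (k 0) w - NN A (g 0) v)‖ ≤ r ^ 2 / 4 * (4 * L ^ 2 * W ^ 2 * ‖e0‖ + 4 * L ^ 2 * W * η) := by
      rw [norm_smul, Real.norm_eq_abs, abs_of_nonneg (by positivity)]
      gcongr
    have n3 := hb w hw
    have n4 := hb v hv
    have n5 : 0 ≤ r ^ 2 * (4 * K1 L W * ‖e0‖ + L ^ 2 * W ^ 2 * η + L ^ 2 * W * ‖e0‖) := by positivity
    unfold K2
    nlinarith
  have m5 : ∀ τ ∈ sphere (0:ℂ) |r|, ‖k τ - g τ - e0‖ ≤ r * (K3 L W * (η + ‖e0‖)) := fun τ hτ => by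
    obtain ⟨t1, t2⟩ := hsph τ hτ
    have a1 := hkw τ t1
    have a2 := hgv τ t1
    have hre := Complex.abs_re_le_norm τ
    have him := Complex.abs_im_le_norm τ
    rw [t2] at a1 a2 hre him
    have e : k τ - g τ - e0 = (k τ - k 0 - (τ.re • w + τ.im • A (k 0) w)) - (g τ - g 0 - (τ.re • v + τ.im • A (g 0) v))
      + τ.re • (w - v) + τ.im • ((A (k 0) - A (g 0)) w + A (g 0) (w - v)) := by
      rw [he0]
      simp only [ContinuousLinearMap.sub_apply, map_sub, smul_sub, smul_add]; abel
    rw [e]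
    have b1 : ‖τ.re • (w - v)‖ ≤ r * η := by
      rw [norm_smul, Real.norm_eq_abs]; gcongr
    have b2 : ‖(A (k 0) - A (g 0)) w‖ ≤ L * ‖e0‖ * W := by
      rw [he0]; exact ((A (k 0) - A (g 0)).le_of_opNorm_le (hA.lip _ _) w).trans (by gcongr)
    have b3 : ‖A (g 0) (w - v)‖ ≤ L * η := ((A (g 0)).le_of_opNorm_le (hA.bd _) _).trans (by gcongr)
    have b4 : ‖τ.im • ((A (k 0) - A (g 0)) w + A (g 0) (w - v))‖ ≤ r * (L * ‖e0‖ * W + L * η) := by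
      rw [norm_smul, Real.norm_eq_abs]
      have := norm_add_le ((A (k 0) - A (g 0)) w) (A (g 0) (w - v))
      gcongr
      linarith
    refine (norm_add_le _ _).trans ?_
    have c1 := norm_add_le ((k τ - k 0 - (τ.re • w + τ.im • A (k 0) w)) - (g τ - g 0 - (τ.re • v + τ.im • A (g 0) v))) (τ.re • (w - v))
    have c2 := norm_sub_le (k τ - k 0 - (τ.re • w + τ.im • A (k 0) w)) (g τ - g 0 - (τ.re • v + τ.im • A (g 0) v))
    unfold K3
    have n5 : 0 ≤ r * ((3 + L) * ‖e0‖ + L * W * η) := by positivity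
    nlinarith
  obtain ⟨B, hB⟩ : ∃ B, B = (r * (K3 L W * (η + ‖e0‖))) ^ 2 := ⟨_, rfl⟩
  let T : V →L[ℝ] ℝ := (2:ℝ) • innerSL ℝ e0
  have hTv : ∀ z, T z = 2 * inner ℝ e0 z := fun z => by simp [T]
  have hei : CircleIntegrable (fun τ => k τ - g τ) 0 r := hki.sub hgi
  have hTi : CircleIntegrable (fun τ => T (k τ - g τ)) 0 r := circInt_of_cont fun τ hτ =>
    T.continuous.continuousAt.comp ((hk τ (hsph τ hτ).1).1.continuousAt.sub (hg τ (hsph τ hτ).1).1.continuousAt)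
  have hni : CircleIntegrable (fun τ => ‖k τ - g τ‖ ^ 2) 0 r := circInt_of_cont fun τ hτ =>
    (((hk τ (hsph τ hτ).1).1.continuousAt.sub (hg τ (hsph τ hτ).1).1.continuousAt).norm).pow 2
  have hfin : Real.circleAverage (fun τ => ‖k τ - g τ‖ ^ 2 - T (k τ - g τ)) 0 r ≤ B - ‖e0‖ ^ 2 := by
    apply Real.circleAverage_mono_on_of_le_circle (hni.sub hTi)
    intro τ hτ
    have s1 := m5 τ hτ
    have s2 : ‖k τ - g τ - e0‖ ^ 2 ≤ B := by rw [hB]; gcongr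
    have s3 := norm_sub_sq_real (k τ - g τ) e0
    have s4 := real_inner_comm e0 (k τ - g τ)
    show ‖k τ - g τ‖ ^ 2 - T (k τ - g τ) ≤ _
    rw [hTv]
    linarith
  have hTm : Real.circleAverage (fun τ => T (k τ - g τ)) 0 r = T (Real.circleAverage (fun τ => k τ - g τ) 0 r) :=
    T.circleAverage_comp_comm hei
  rw [ca_sub' hni hTi, hTm, hTv] at hfin
  obtain ⟨me, hme⟩ : ∃ me, me = Real.circleAverage (fun τ => k τ - g τ) 0 r := ⟨_, rfl⟩
  rw [← hme] at hfin m4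
  have i1 : inner ℝ e0 me ≤ ‖e0‖ ^ 2 + ‖e0‖ * (r ^ 2 * (K2 L W * (η + ‖e0‖))) := by
    have : inner ℝ e0 me = inner ℝ e0 e0 + inner ℝ e0 (me - e0) := by rw [inner_sub_right]; ring
    rw [this, real_inner_self_eq_norm_sq]
    have := real_inner_le_norm e0 (me - e0)
    have : ‖e0‖ * ‖me - e0‖ ≤ ‖e0‖ * (r ^ 2 * (K2 L W * (η + ‖e0‖))) := by gcongr
    linarith
  rw [← he0]
  have hK2 : 0 ≤ K2 L W := by unfold K2; positivity
  have n6 : 0 ≤ r ^ 2 * (K2 L W * (η * (η + ‖e0‖))) := by positivity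
  rw [hB] at hfin
  unfold KK
  nlinarith

end P7b
end RS

namespace RS

section P7c
variable {V : Type*} [NormedAddCommGroup V] [InnerProductSpace ℝ V] [FiniteDimensional ℝ V]

theorem deriv_bd {g : ℂ → V} {σ Λ : ℝ} (hσ : 0 < σ) (hΛ : 0 ≤ Λ) (hd : DifferentiableAt ℝ g 0)
    (hl : ∀ τ ∈ ball (0:ℂ) σ, ∀ τ' ∈ ball (0:ℂ) σ, ‖g τ - g τ'‖ ≤ Λ * ‖τ - τ'‖) : ‖fderiv ℝ g 0 1‖ ≤ Λ := by
  have h2 : ‖fderiv ℝ g 0‖ ≤ Λ := by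
    apply hd.hasFDerivAt.le_of_lip' hΛ
    filter_upwards [ball_mem_nhds (0:ℂ) hσ] with τ hτ
    exact hl τ hτ 0 (mem_ball_self hσ)
  have h3 := (fderiv ℝ g 0).le_opNorm 1
  simp at h3
  exact h3.trans h2

/-- mean value inequality for u on a disc meeting E at most once -/
theorem sub_disc {A : V → V →L[ℝ] V} {E : Set V} {p : V} {R : ℝ} (hO : IsOpen (ball p R \ E)) {u : V → ℝ} (hu : PM A (ball p R \ E) u)
    {k : ℂ → V} {ζ1 : ℂ} {R1 M r : ℝ} (hζ1 : ζ1 ≠ 0) (hk : JH A k (ball 0 R1)) (hkm : MapsTo k (ball 0 R1) (ball p R))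
    (hkE : ∀ τ ∈ ball (0:ℂ) R1, τ ≠ ζ1 → k τ ∉ E) (hM : ∀ τ ∈ ball (0:ℂ) R1, τ ≠ ζ1 → u (k τ) ≤ M) (hr : 0 < r) (hrR : r < R1) (h1 : ‖ζ1‖ ≠ r) :
    u (k 0) ≤ Real.circleAverage (fun τ => u (k τ)) 0 r := by
  refine lemB (h := fun τ => u (k τ)) hr hrR ?_ hM ?_ hζ1 h1
  · intro z hz hne
    exact ContinuousAt.comp (g := u) (hu.1.continuousAt (hO.mem_nhds ⟨hkm hz, hkE z hz hne⟩)) (hk z hz).1.continuousAt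
  · intro z hz hne
    have hop : IsOpen (ball (0:ℂ) R1 ∩ {ζ1}ᶜ) := isOpen_ball.inter isOpen_compl_singleton
    obtain ⟨ρ0, hρ0, hb⟩ := Metric.isOpen_iff.1 hop z ⟨ball_subset_ball hrR.le hz, hne⟩
    have v : ∀ᶠ r in 𝓝[>] (0:ℝ), r ∈ Ioo 0 ρ0 := Ioo_mem_nhdsGT hρ0
    filter_upwards [v] with ρ hρ
    exact hu.2 k z ρ0 ρ (fun τ hτ => hk τ (hb hτ).1) (fun τ hτ => ⟨hkm (hb hτ).1, hkE τ (hb hτ).1 (hb hτ).2⟩) hρ.1 hρ.2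

set_option maxHeartbeats 1000000 in
theorem local_lemma {A : V → V →L[ℝ] V} {L : ℝ} (hA : NiceJ A L) {E : Set V} {p : V} {R : ℝ} (hO : IsOpen (ball p R \ E))
    (hA2 : ∀ x ∈ ball p R, ∀ v, A x (A x v) = -v) {u : V → ℝ} (hu : PM A (ball p R \ E) u) {x : V} {Λ : ℝ} (hΛ : 0 ≤ Λ)
    {f : ℂ → V} {ζ : ℂ} {σ : ℝ} (hσ : 0 < σ) (hf : JH A f (ball ζ σ)) (hfm : MapsTo f (ball ζ σ) (ball p R))
    (hfl : ∀ τ ∈ ball ζ σ, ∀ τ' ∈ ball ζ σ, ‖f τ - f τ'‖ ≤ Λ * ‖τ - τ'‖)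
    (hDF : ∀ v η, 0 < η → ∃ w, ‖w - v‖ ≤ η ∧ DF A E p R x w η) {G : ℂ → ℝ} {ε N m : ℝ} (hGc : Continuous G)
    (hG : ∀ ρ, Real.circleAverage G ζ ρ = G ζ - ε * ρ ^ 2) (hN : 0 ≤ N)
    {s : ℝ} (hs : 0 < s) (hmax : ∀ y ∈ ball x s, y ∈ ball p R \ E → ∀ ξ ∈ ball ζ s, u y ≤ m + G ξ + N * ‖y - f ξ‖ ^ 2)
    (happ : ∀ t < m + G ζ + N * ‖x - f ζ‖ ^ 2, ∃ᶠ y in 𝓝[ball p R \ E] x, t < u y) :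
    ε ≤ N * (KK L (1 + (1 + L) * (Λ + 1)) * ‖x - f ζ‖ ^ 2) := by
  have hL := hA.nonneg
  obtain ⟨W, hW⟩ : ∃ W, W = 1 + (1 + L) * (Λ + 1) := ⟨_, rfl⟩
  have hW0 : 0 ≤ W := by rw [hW]; positivity
  have hWΛ : Λ + 1 ≤ W := by rw [hW]; nlinarith
  rw [← hW]
  by_contra hcon
  push Not at hcon
  -- choose η
  have hψc : Continuous (fun q : ℝ × V => N * (KK L W * (q.1 + ‖q.2 - f ζ‖) ^ 2)) := by fun_prop
  obtain ⟨gap, hgap⟩ : ∃ gap, gap = (ε - N * (KK L W * ‖x - f ζ‖ ^ 2)) / 2 := ⟨_, rfl⟩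
  have hgap0 : 0 < gap := by rw [hgap]; linarith
  have hψe : ∀ᶠ q : ℝ × V in 𝓝 ((0:ℝ), x), N * (KK L W * (q.1 + ‖q.2 - f ζ‖) ^ 2) < ε - gap := by
    apply hψc.continuousAt.eventually_lt_const
    simp only [zero_add]
    linarith
  rw [nhds_prod_eq] at hψe
  obtain ⟨P1, hP1, P2, hP2, hPP⟩ := eventually_prod_iff.1 hψe
  have v : ∀ᶠ r in 𝓝[>] (0:ℝ), r ∈ Ioo (0:ℝ) 1 := Ioo_mem_nhdsGT one_pos
  obtain ⟨η, hηP, hη0, hη1⟩ := ((hP1.filter_mono nhdsWithin_le_nhds).and v).exists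
  -- the disc g
  have hg := hf.shift
  obtain ⟨g, hgd⟩ : ∃ g, g = fun τ => f (τ + ζ) := ⟨_, rfl⟩
  rw [← hgd] at hg
  have hgv : ∀ τ, g τ = f (τ + ζ) := fun τ => by rw [hgd]
  have hg0 : g 0 = f ζ := by rw [hgv, zero_add]
  have hsh : ∀ {t : ℝ}, ∀ τ ∈ ball (0:ℂ) t, τ + ζ ∈ ball ζ t := fun {t} τ hτ => by
    simpa [dist_eq_norm] using hτ
  have hgl : ∀ τ ∈ ball (0:ℂ) σ, ∀ τ' ∈ ball (0:ℂ) σ, ‖g τ - g τ'‖ ≤ Λ * ‖τ - τ'‖ := fun τ hτ τ' hτ' => by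
    rw [hgv, hgv]
    have := hfl (τ + ζ) (hsh τ hτ) (τ' + ζ) (hsh τ' hτ')
    rwa [add_sub_add_right_eq_sub] at this
  obtain ⟨vv, hvv⟩ : ∃ vv, vv = fderiv ℝ g 0 1 := ⟨_, rfl⟩
  have hvn : ‖vv‖ ≤ Λ := by rw [hvv]; exact deriv_bd hσ hΛ (hg 0 (mem_ball_self hσ)).1 hgl
  obtain ⟨R2, hR2, hgω⟩ := JH.omega hσ hg hη0
  rw [← hvv] at hgω
  obtain ⟨w, hwv, r0, hr0, hdisc⟩ := hDF vv η hη0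
  have hwn : ‖w‖ ≤ Λ + 1 := by
    have := norm_sub_norm_le w vv
    linarith
  -- radii
  obtain ⟨R1, hR1⟩ : ∃ R1, R1 = min (min (min r0 R2) σ) (min s (s / (2 * (W + 1)))) := ⟨_, rfl⟩
  have hR10 : 0 < R1 := by rw [hR1]; positivity
  have hR1r0 : R1 ≤ r0 := by rw [hR1]; exact (min_le_left _ _).trans ((min_le_left _ _).trans (min_le_left _ _))
  have hR1R2 : R1 ≤ R2 := by rw [hR1]; exact (min_le_left _ _).trans ((min_le_left _ _).trans (min_le_right _ _))
  have hR1σ : R1 ≤ σ := by rw [hR1]; exact (min_le_left _ _).trans (min_le_right _ _)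
  have hR1s : R1 ≤ s := by rw [hR1]; exact (min_le_right _ _).trans (min_le_left _ _)
  have hR1W : W * R1 ≤ s / 2 := by
    have : R1 ≤ s / (2 * (W + 1)) := by rw [hR1]; exact (min_le_right _ _).trans (min_le_right _ _)
    rw [le_div_iff₀ (by positivity)] at this
    nlinarith
  obtain ⟨r, hr⟩ : ∃ r, r = min (R1 / 2) η := ⟨_, rfl⟩
  have hrp : 0 < r := by rw [hr]; positivity
  have hrR1 : r < R1 := by
    have : r ≤ R1 / 2 := by rw [hr]; exact min_le_left _ _
    linarith
  have hrη : r ≤ η := by rw [hr]; exact min_le_right _ _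
  -- choose y
  obtain ⟨base, hbase⟩ : ∃ base, base = m + G ζ + N * ‖x - f ζ‖ ^ 2 := ⟨_, rfl⟩
  rw [← hbase] at happ
  have hyc : ∀ᶠ y in 𝓝 x, N * ‖y - f ζ‖ ^ 2 < N * ‖x - f ζ‖ ^ 2 + gap * r ^ 2 / 16 := by
    have : Continuous (fun y => N * ‖y - f ζ‖ ^ 2) := by fun_prop
    exact this.continuousAt.eventually_lt_const (lt_add_of_pos_right _ (by positivity))
  have hys : ∀ᶠ y in 𝓝 x, y ∈ ball x (s / 2) := ball_mem_nhds x (by positivity)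
  have hOm : ∀ᶠ y in 𝓝[ball p R \ E] x, y ∈ ball p R \ E := self_mem_nhdsWithin
  obtain ⟨y, hyu, hyd, hyO, hyP, hyn, hyb⟩ := ((happ (base - gap * r ^ 2 / 16) (by
    have : 0 < gap * r ^ 2 / 16 := by positivity
    linarith)).and_eventually (hdisc.and (hOm.and
      ((hP2.and (hyc.and hys)).filter_mono nhdsWithin_le_nhds)))).exists
  obtain ⟨k, ζ1, hζ1, hk0, hkm, hkJ, hka, hkE⟩ := hyd
  have hψ := hPP hηP hyP
  simp only at hψ
  have hbr0 : ball (0:ℂ) R1 ⊆ ball 0 r0 := ball_subset_ball hR1r0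
  have hbR2 : ball (0:ℂ) R1 ⊆ ball 0 R2 := ball_subset_ball hR1R2
  have hbσ : ball (0:ℂ) R1 ⊆ ball 0 σ := ball_subset_ball hR1σ
  have hbs : ball (0:ℂ) R1 ⊆ ball 0 s := ball_subset_ball hR1s
  have hkl : ∀ τ ∈ ball (0:ℂ) R1, ∀ τ' ∈ ball (0:ℂ) R1, ‖k τ - k τ'‖ ≤ W * ‖τ - τ'‖ := fun τ hτ τ' hτ' => by
    have a1 := hka τ (hbr0 hτ) τ' (hbr0 hτ')
    obtain ⟨δ, hδ⟩ : ∃ δ, δ = τ - τ' := ⟨_, rfl⟩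
    rw [← hδ] at a1 ⊢
    have hre := Complex.abs_re_le_norm δ
    have him := Complex.abs_im_le_norm δ
    have hAw : ‖A y w‖ ≤ L * (Λ + 1) := ((A y).le_of_opNorm_le (hA.bd y) w).trans (by gcongr)
    have a3 : ‖δ.re • w + δ.im • A y w‖ ≤ (1 + L) * (Λ + 1) * ‖δ‖ := by
      refine (norm_add_le _ _).trans ?_
      rw [norm_smul, norm_smul, Real.norm_eq_abs, Real.norm_eq_abs]
      have b1 : |δ.re| * ‖w‖ ≤ ‖δ‖ * (Λ + 1) := by gcongr
      have b2 : |δ.im| * ‖A y w‖ ≤ ‖δ‖ * (L * (Λ + 1)) := by gcongr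
      linarith
    have := norm_sub_norm_le (k τ - k τ') (δ.re • w + δ.im • A y w)
    have : η * ‖δ‖ ≤ 1 * ‖δ‖ := by gcongr
    rw [hW]; linarith
  have hkJ1 : JH A k (ball 0 R1) := fun τ hτ => hkJ τ (hbr0 hτ)
  have hkm1 : MapsTo k (ball 0 R1) (ball p R) := fun τ hτ => hkm (hbr0 hτ)
  have h0R1 : (0:ℂ) ∈ ball (0:ℂ) R1 := mem_ball_self hR10
  have hkx : ∀ τ ∈ ball (0:ℂ) R1, k τ ∈ ball x s := fun τ hτ => by
    have a1 := hkl τ hτ 0 h0R1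
    rw [hk0, sub_zero] at a1
    rw [mem_ball_zero_iff] at hτ
    have a2 : W * ‖τ‖ ≤ W * R1 := by gcongr
    rw [mem_ball, dist_eq_norm] at hyb ⊢
    have := norm_sub_le_norm_sub_add_norm_sub (k τ) y x
    linarith
  -- radius avoiding ζ1
  obtain ⟨ρ, hρ0, hρr, hrρ, hρζ⟩ : ∃ ρ, 0 < ρ ∧ ρ ≤ r ∧ r / 2 ≤ ρ ∧ ‖ζ1‖ ≠ ρ := by
    by_cases hc : ‖ζ1‖ = r
    · exact ⟨r / 2, by positivity, by linarith, le_rfl, by rw [hc]; intro h; linarith⟩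
    · exact ⟨r, hrp, le_rfl, by linarith, hc⟩
  have hkE1 : ∀ τ ∈ ball (0:ℂ) R1, τ ≠ ζ1 → k τ ∉ E := fun τ hτ => hkE τ (hbr0 hτ)
  have hsub := sub_disc hO hu (M := m + G ζ + N * (s + ‖x - f ζ‖) ^ 2) hζ1 hkJ1 hkm1 hkE1 (fun τ hτ hne => by
    have a1 := hmax (k τ) (hkx τ hτ) ⟨hkm1 hτ, hkE1 τ hτ hne⟩ ζ (mem_ball_self hs)
    have a2 := hkx τ hτ
    rw [mem_ball, dist_eq_norm] at a2
    have a3 : ‖k τ - f ζ‖ ≤ s + ‖x - f ζ‖ := by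
      have := norm_sub_le_norm_sub_add_norm_sub (k τ) x (f ζ)
      linarith
    have : N * ‖k τ - f ζ‖ ^ 2 ≤ N * (s + ‖x - f ζ‖) ^ 2 := by gcongr
    linarith) hρ0 (by linarith) hρζ
  rw [hk0] at hsub
  have hsph : ∀ τ ∈ sphere (0:ℂ) |ρ|, τ ∈ ball (0:ℂ) R1 ∧ τ ≠ ζ1 := fun τ hτ => by
    rw [abs_of_pos hρ0, mem_sphere_zero_iff_norm] at hτ
    exact ⟨by rw [mem_ball_zero_iff]; linarith, fun h => hρζ (by rw [← h, hτ])⟩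
  have hi1 : CircleIntegrable (fun τ => u (k τ)) 0 ρ := circInt_of_cont fun τ hτ => by
    obtain ⟨t1, t2⟩ := hsph τ hτ
    exact ContinuousAt.comp (g := u) (hu.1.continuousAt (hO.mem_nhds ⟨hkm1 t1, hkE1 τ t1 t2⟩)) (hkJ1 τ t1).1.continuousAt
  have hi2 : CircleIntegrable (fun τ => ‖k τ - g τ‖ ^ 2) 0 ρ := circInt_of_cont fun τ hτ => by
    obtain ⟨t1, t2⟩ := hsph τ hτ
    exact (((hkJ1 τ t1).1.continuousAt.sub (hg τ (hbσ t1)).1.continuousAt).norm).pow 2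
  have hi3 : CircleIntegrable (fun τ => m + G (τ + ζ)) 0 ρ := circInt_of_cont fun τ hτ => by
    have : Continuous fun τ => m + G (τ + ζ) := by fun_prop
    exact this.continuousAt
  have hi4 : CircleIntegrable (fun τ => N * ‖k τ - g τ‖ ^ 2) 0 ρ := circInt_of_cont fun τ hτ => by
    obtain ⟨t1, t2⟩ := hsph τ hτ
    exact continuousAt_const.mul ((((hkJ1 τ t1).1.continuousAt.sub (hg τ (hbσ t1)).1.continuousAt).norm).pow 2)
  have hmono : Real.circleAverage (fun τ => u (k τ)) 0 ρ ≤ Real.circleAverage (fun τ => (m + G (τ + ζ)) + N * ‖k τ - g τ‖ ^ 2) 0 ρ := by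
    apply Real.circleAverage_mono hi1 (hi3.add hi4)
    intro τ hτ
    obtain ⟨t1, t2⟩ := hsph τ hτ
    have := hmax (k τ) (hkx τ t1) ⟨hkm1 t1, hkE1 τ t1 t2⟩ (τ + ζ) (hsh τ (hbs t1))
    rw [← hgv] at this
    exact this
  have hGm : Real.circleAverage (fun τ => m + G (τ + ζ)) 0 ρ = m + (G ζ - ε * ρ ^ 2) := by
    rw [ca_add' (circleIntegrable_const m 0 ρ) (circInt_of_cont fun τ hτ => by
      have : Continuous fun τ => G (τ + ζ) := by fun_prop
      exact this.continuousAt), Real.circleAverage_const, ← hG ρ]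
    congr 1
    exact Real.circleAverage_map_add_const
  rw [ca_add' hi3 hi4, hGm, ca_mul'] at hmono
  have hme := mean_e hA hW0 hη0.le hkJ1 (fun τ hτ => hA2 _ (hkm1 hτ)) hkl (fun τ hτ => hg τ (hbσ hτ))
    (fun τ hτ => by rw [hgv]; exact hA2 _ (hfm (hsh τ (hbσ hτ))))
    (fun τ hτ τ' hτ' => (hgl τ (hbσ hτ) τ' (hbσ hτ')).trans (by gcongr; linarith)) (w := w) (v := vv) (by linarith) (by linarith) hwv
    (fun τ hτ => by
      have := hka τ (hbr0 hτ) 0 (hbr0 h0R1)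
      rw [sub_zero] at this
      rw [hk0] at this ⊢
      exact this) (fun τ hτ => hgω τ (hbR2 hτ)) hρ0 (by linarith) (by linarith)
  rw [hk0, hg0] at hme
  have hme2 := mul_le_mul_of_nonneg_left hme hN
  have hψ2 := mul_le_mul_of_nonneg_left hψ.le (sq_nonneg ρ)
  have hρ2 : r ^ 2 / 4 ≤ ρ ^ 2 := by
    have : (r / 2) ^ 2 ≤ ρ ^ 2 := by gcongr
    linarith
  have hgρ : gap * (r ^ 2 / 4) ≤ gap * ρ ^ 2 := by gcongr
  have : 0 < gap * r ^ 2 := by positivity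
  rw [hbase] at hyu
  linarith

end P7c
end RS

namespace RS

section P7d
variable {V : Type*} [NormedAddCommGroup V] [InnerProductSpace ℝ V] [FiniteDimensional ℝ V]

theorem doubling {w : V → ℝ} {X : Set V} (hX : IsCompact X) (hw : UpperSemicontinuousOn w X) {f : ℂ → V} {a : ℂ} {r : ℝ} (hr : 0 < r)
    (hf : ContinuousOn f (closedBall a r)) (hfX : MapsTo f (closedBall a r) X) {G : ℂ → ℝ} (hG : Continuous G)
    {δ : ℝ} (hδ : 0 < δ) (ha : G a + δ ≤ w (f a)) (hs : ∀ ζ ∈ sphere a r, w (f ζ) ≤ G ζ) :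
    ∃ ζs ∈ ball a r, ∀ κ > 0, ∀ s > 0, ∃ N ≥ 0, ∃ x ∈ X, ∃ ζ ∈ ball a r, ∃ m > 0, ζ ∈ ball ζs s ∧ x ∈ ball (f ζs) s ∧
      N * ‖x - f ζ‖ ^ 2 < κ ∧ w x = m + G ζ + N * ‖x - f ζ‖ ^ 2 ∧
      ∀ y ∈ X, ∀ ξ ∈ closedBall a r, w y ≤ m + G ξ + N * ‖y - f ξ‖ ^ 2 := by
  obtain ⟨K, hK⟩ : ∃ K, K = closedBall a r := ⟨_, rfl⟩
  rw [← hK] at hf hfX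
  have hKc : IsCompact K := by rw [hK]; exact isCompact_closedBall a r
  have haK : a ∈ K := by rw [hK]; exact mem_closedBall_self hr.le
  have hmaxE : ∀ j : ℕ, ∃ q : V × ℂ, q ∈ X ×ˢ K ∧ ∀ y ∈ X, ∀ ξ ∈ K,
      w y - G ξ - 2 ^ j * ‖y - f ξ‖ ^ 2 ≤ w q.1 - G q.2 - 2 ^ j * ‖q.1 - f q.2‖ ^ 2 := fun j => by
    have h1 : UpperSemicontinuousOn (fun q : V × ℂ => w q.1) (X ×ˢ K) := fun q hq c hc => by
      have := hw q.1 hq.1 c hc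
      exact (continuous_fst.continuousWithinAt.tendsto_nhdsWithin (s := X ×ˢ K) (t := X) fun z hz => hz.1).eventually this
    have h2 : ContinuousOn (fun q : V × ℂ => - G q.2 - 2 ^ j * ‖q.1 - f q.2‖ ^ 2) (X ×ˢ K) := by
      have h3 : ContinuousOn (fun q : V × ℂ => f q.2) (X ×ˢ K) := hf.comp continuousOn_snd fun z hz => hz.2
      have h4 : ContinuousOn (fun q : V × ℂ => G q.2) (X ×ˢ K) := (hG.comp continuous_snd).continuousOn
      have h5 : ContinuousOn (fun q : V × ℂ => q.1) (X ×ˢ K) := continuousOn_fst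
      exact h4.neg.sub (continuousOn_const.mul ((h5.sub h3).norm.pow 2))
    obtain ⟨q, hq, hm⟩ := (h1.add h2.upperSemicontinuousOn).exists_isMaxOn (s := X ×ˢ K) ⟨(f a, a), hfX haK, haK⟩ (hX.prod hKc)
    refine ⟨q, hq, fun y hy ξ hξ => ?_⟩
    have := hm (show (y, ξ) ∈ X ×ˢ K from ⟨hy, hξ⟩)
    simp only [mem_setOf_eq] at this
    linarith
  choose q hq hmax using hmaxE
  obtain ⟨m, hm⟩ : ∃ m : ℕ → ℝ, ∀ j, m j = w (q j).1 - G (q j).2 - 2 ^ j * ‖(q j).1 - f (q j).2‖ ^ 2 := ⟨_, fun j => rfl⟩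
  simp only [← hm] at hmax
  have hmδ : ∀ j, δ ≤ m j := fun j => by
    have := hmax j (f a) (hfX haK) a haK
    simp at this
    linarith
  have hmd : ∀ j, 2 ^ j * ‖(q (j+1)).1 - f (q (j+1)).2‖ ^ 2 ≤ m j - m (j+1) := fun j => by
    have h1 := hmax j _ (hq (j+1)).1 _ (hq (j+1)).2
    have h2 := hm (j+1)
    rw [pow_succ] at h2
    linarith
  have hma : Antitone m := antitone_nat_of_succ_le fun j => by
    have : 0 ≤ 2 ^ j * ‖(q (j+1)).1 - f (q (j+1)).2‖ ^ 2 := by positivity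
    have := hmd j
    linarith
  obtain ⟨l, hl⟩ : ∃ l, Tendsto m atTop (𝓝 l) := ⟨_, tendsto_atTop_ciInf hma ⟨δ, by rintro _ ⟨j, rfl⟩; exact hmδ j⟩⟩
  have hdiff : Tendsto (fun j => 2 * (m j - m (j+1))) atTop (𝓝 0) := by
    have := (hl.sub (hl.comp (tendsto_add_atTop_nat 1))).const_mul 2
    simpa using this
  have hNd : Tendsto (fun j => (2:ℝ) ^ (j+1) * ‖(q (j+1)).1 - f (q (j+1)).2‖ ^ 2) atTop (𝓝 0) := by
    refine squeeze_zero (fun j => by positivity) (fun j => ?_) hdiff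
    have := hmd j
    rw [pow_succ]; linarith
  have hd : Tendsto (fun j => ‖(q (j+1)).1 - f (q (j+1)).2‖) atTop (𝓝 0) := by
    have h1 : Tendsto (fun j => ‖(q (j+1)).1 - f (q (j+1)).2‖ ^ 2) atTop (𝓝 0) := by
      refine squeeze_zero (fun j => by positivity) (fun j => ?_) hNd
      have : (1:ℝ) ≤ 2 ^ (j+1) := one_le_pow₀ (by norm_num)
      nlinarith [sq_nonneg ‖(q (j+1)).1 - f (q (j+1)).2‖]
    have h2 := (Real.continuous_sqrt.tendsto 0).comp h1
    simpa [Function.comp_def, Real.sqrt_sq] using h2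
  obtain ⟨ζs, hζs, φ, hφ, hlim⟩ := hKc.tendsto_subseq (x := fun j => (q (j+1)).2) (fun j => (hq (j+1)).2)
  simp only [Function.comp_def] at hlim
  have hφt := hφ.tendsto_atTop
  have hflim : Tendsto (fun j => f (q (φ j + 1)).2) atTop (𝓝 (f ζs)) :=
    (hf ζs hζs).tendsto.comp (tendsto_nhdsWithin_iff.2 ⟨hlim, Eventually.of_forall fun j => (hq _).2⟩)
  have hxlim : Tendsto (fun j => (q (φ j + 1)).1) atTop (𝓝 (f ζs)) := by
    have h1 : Tendsto (fun j => (q (φ j + 1)).1 - f (q (φ j + 1)).2) atTop (𝓝 0) :=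
      tendsto_zero_iff_norm_tendsto_zero.2 (hd.comp hφt)
    have := h1.add hflim
    simpa using this
  have hxw : Tendsto (fun j => (q (φ j + 1)).1) atTop (𝓝[X] (f ζs)) :=
    tendsto_nhdsWithin_iff.2 ⟨hxlim, Eventually.of_forall fun j => (hq _).1⟩
  have hGl : Tendsto (fun j => G (q (φ j + 1)).2) atTop (𝓝 (G ζs)) := (hG.tendsto ζs).comp hlim
  have hwz : G ζs + δ ≤ w (f ζs) + δ / 2 := by
    refine le_of_tendsto (hGl.add_const δ) ?_
    filter_upwards [hxw.eventually (hw (f ζs) (hfX hζs) (w (f ζs) + δ / 2) (by linarith))] with j hj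
    have h1 := hmδ (φ j + 1)
    have h2 := hm (φ j + 1)
    have : 0 ≤ (2:ℝ) ^ (φ j + 1) * ‖(q (φ j + 1)).1 - f (q (φ j + 1)).2‖ ^ 2 := by positivity
    linarith
  have hζb : ζs ∈ ball a r := by
    rw [hK, mem_closedBall] at hζs
    rcases hζs.lt_or_eq with h | h
    · exact h
    · have := hs ζs h
      linarith
  refine ⟨ζs, hζb, fun κ hκ s hs => ?_⟩
  have e1 := (hNd.comp hφt).eventually_lt_const hκ
  have e2 := hlim.eventually (ball_mem_nhds ζs hs)
  have e3 := hxlim.eventually (ball_mem_nhds _ hs)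
  have e4 := hlim.eventually (isOpen_ball.mem_nhds hζb)
  obtain ⟨j, g1, g2, g3, g4⟩ := (e1.and (e2.and (e3.and e4))).exists
  refine ⟨2 ^ (φ j + 1), by positivity, (q (φ j + 1)).1, (hq _).1, (q (φ j + 1)).2, g4, m (φ j + 1), hδ.trans_le (hmδ _), g2, g3, g1, ?_, ?_⟩
  · rw [hm (φ j + 1)]; ring
  · intro y hy ξ hξ
    have := hmax (φ j + 1) y hy ξ (by rw [hK]; exact hξ)
    linarith

end P7d
end RS

namespace RS

section P7e

theorem finrank_Cn2 : Module.finrank ℝ (Cn 2) = 4 := by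
  rw [finrank_real_of_complex, finrank_euclideanSpace]; rfl

theorem sq_of_ACS {Ω : Set (Cn 2)} {J : Cn 2 → Cn 2 →L[ℝ] Cn 2} (hJ : IsACS Ω J) : ∀ x ∈ Ω, ∀ v, J x (J x v) = -v := fun x hx v => by
  have := congrArg (fun T => T v) (hJ.2 x hx)
  simpa using this

theorem open_diff {Ω E : Set (Cn 2)} (hΩ : IsOpen Ω) (hE : closure E ∩ Ω ⊆ E) : IsOpen (Ω \ E) := by
  have : Ω \ E = Ω \ closure E := by
    ext x
    exact ⟨fun h => ⟨h.1, fun h2 => h.2 (hE ⟨h2, h.1⟩)⟩, fun h => ⟨h.1, fun h2 => h.2 (subset_closure h2)⟩⟩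
  rw [this]
  exact hΩ.sdiff isClosed_closure

theorem PM_of_psh {Ω E : Set (Cn 2)} {J A : Cn 2 → Cn 2 →L[ℝ] Cn 2} (hJ : IsACS Ω J) (hO : IsOpen (Ω \ E))
    {u : Cn 2 → ℝ} (hucont : ContinuousOn u (Ω \ E)) (hupsh : JPshOnR J (Ω \ E) u) {p : Cn 2} {R : ℝ}
    (hb : ball p R ⊆ Ω) (hAJ : ∀ x ∈ ball p R, A x = J x) : PM A (ball p R \ E) u := by
  refine ⟨hucont.mono (diff_subset_diff_left hb), fun k z R1 ρ hk hm hρ hρR => ?_⟩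
  refine psh_mean hO (fun x hx => sq_of_ACS hJ x hx.1) hupsh hucont (k := k) (R := R1) (fun τ hτ => ?_) (fun τ hτ => ⟨hb (hm hτ).1, (hm hτ).2⟩) hρ hρR
  have := hk τ hτ
  rwa [hAJ _ (hm hτ).1] at this

theorem local_pack {Ω : Set (Cn 2)} (hΩ : IsOpen Ω) {J : Cn 2 → Cn 2 →L[ℝ] Cn 2} (hJ : IsACS Ω J)
    {E : Set (Cn 2)} (hEΩ : E ⊆ Ω) (hEc : closure E ∩ Ω ⊆ E) (hEsub : IsSmoothSubmanifold 2 E) (hEtr : TotallyReal J E)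
    {p : Cn 2} (hp : p ∈ Ω) :
    ∃ A L R, 0 < R ∧ NiceJ A L ∧ closedBall p R ⊆ Ω ∧ (∀ x ∈ ball p R, A x = J x) ∧ IsOpen (ball p R \ E) ∧
      ∀ x ∈ ball p R, ∀ v η, 0 < η → ∃ w, ‖w - v‖ ≤ η ∧ DF A E p R x w η := by
  have hO := open_diff hΩ hEc
  have hop : ∀ R, closedBall p R ⊆ Ω → IsOpen (ball p R \ E) := fun R hR => by
    have : ball p R \ E = ball p R ∩ (Ω \ E) := by
      ext x
      exact ⟨fun h => ⟨h.1, hR (ball_subset_closedBall h.1), h.2⟩, fun h => ⟨h.1, h.2.2⟩⟩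
    rw [this]
    exact isOpen_ball.inter hO
  by_cases hpE : p ∈ E
  · obtain ⟨A, L, R, Y, D, Q, C, c, h, hb, hAJ⟩ := LD_exists hΩ hJ hEΩ hEsub hEtr hpE
    exact ⟨A, L, R, h.Rpos, h.nice, hb, hAJ, hop R hb, fun x hx v η hη => DF_E finrank_Cn2 h hx v hη⟩
  · obtain ⟨A, L, R, hR, hA, hb, hAJ⟩ := localize hO (hJ.1.mono diff_subset) ⟨hp, hpE⟩
    have hb' : closedBall p R ⊆ Ω := fun x hx => (hb hx).1
    refine ⟨A, L, R, hR, hA, hb', hAJ, hop R hb', fun x hx v η hη => ⟨v, by simpa using hη.le, ?_⟩⟩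
    refine DF_O hA (hop R hb') (fun x hx v => ?_) ⟨hx, (hb (ball_subset_closedBall hx)).2⟩ v hη
    rw [hAJ x hx]
    exact sq_of_ACS hJ x (hb' (ball_subset_closedBall hx)) v

set_option maxHeartbeats 1000000 in
theorem key {Ω : Set (Cn 2)} (hΩ : IsOpen Ω) {J : Cn 2 → Cn 2 →L[ℝ] Cn 2} (hJ : IsACS Ω J)
    {E : Set (Cn 2)} (hEΩ : E ⊆ Ω) (hEc : closure E ∩ Ω ⊆ E) (hEsub : IsSmoothSubmanifold 2 E) (hEtr : TotallyReal J E)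
    {u : Cn 2 → ℝ} (hucont : ContinuousOn u (Ω \ E)) (hupsh : JPshOnR J (Ω \ E) u) {us : Cn 2 → EReal}
    (hstar1 : ∀ x ∈ Ω \ E, us x = (u x : EReal))
    (hstar2 : ∀ x ∈ E, us x = Filter.limsup (fun y => ((u y : ℝ) : EReal)) (𝓝[Ω \ E] x))
    (husc : UpperSemicontinuousOn us Ω) (htop : ∀ x ∈ Ω, us x < ⊤) {f : ℂ → Cn 2} (hf : JDisc J Ω f)
    {a : ℂ} {r : ℝ} (hr : 0 < r) (hab : closedBall a r ⊆ unitDisc) {q : ℂ → ℝ} (hq : Harm q)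
    (hsph : ∀ ζ ∈ sphere a r, us (f ζ) ≤ q ζ) : us (f a) ≤ q a := by
  by_contra hcon
  push Not at hcon
  have hO := open_diff hΩ hEc
  obtain ⟨K, hK⟩ : ∃ K, K = closedBall a r := ⟨_, rfl⟩
  have hKc : IsCompact K := by rw [hK]; exact isCompact_closedBall a r
  have haK : a ∈ K := by rw [hK]; exact mem_closedBall_self hr.le
  have hfc : ContinuousOn f K := fun z hz => (hf.2 z (hab (hK ▸ hz))).1.continuousAt.continuousWithinAt
  have hfΩ : MapsTo f K Ω := fun z hz => hf.1 (hab (hK ▸ hz))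
  obtain ⟨t, ht⟩ : ∃ t : ℝ, us (f a) = t := by
    refine ⟨(us (f a)).toReal, (EReal.coe_toReal (htop _ (hfΩ haK)).ne ?_).symm⟩
    exact ((EReal.bot_lt_coe _).trans hcon).ne'
  rw [ht, EReal.coe_lt_coe_iff] at hcon
  obtain ⟨δ, hδ⟩ : ∃ δ, δ = (t - q a) / 2 := ⟨_, rfl⟩
  have hδ0 : 0 < δ := by rw [hδ]; linarith
  obtain ⟨ε, hε⟩ : ∃ ε, ε = δ / r ^ 2 := ⟨_, rfl⟩
  have hε0 : 0 < ε := by rw [hε]; positivity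
  have hεr : ε * r ^ 2 = δ := by rw [hε]; field_simp
  obtain ⟨G, hGd⟩ : ∃ G : ℂ → ℝ, G = fun ζ => q ζ + (δ + (-ε) * ‖ζ - a‖ ^ 2) := ⟨_, rfl⟩
  have hGv : ∀ ζ, G ζ = q ζ + (δ + (-ε) * ‖ζ - a‖ ^ 2) := fun ζ => by rw [hGd]
  have hqc := hq.1
  have hGc : Continuous G := by rw [hGd]; fun_prop
  have hci : ∀ {h : ℂ → ℝ} {z : ℂ} {ρ : ℝ}, Continuous h → CircleIntegrable h z ρ := fun {h z ρ} hh => circInt_of_cont fun τ _ => hh.continuousAt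
  have hG : ∀ ζ ρ, Real.circleAverage G ζ ρ = G ζ - ε * ρ ^ 2 := fun ζ ρ => by
    rw [hGd, ca_add' (hci hqc) (hci (by fun_prop)), ca_add' (circleIntegrable_const _ _ _) (hci (by fun_prop)), ca_mul', ca_sq,
      Real.circleAverage_const, hq.2]
    ring
  have hGq : ∀ ζ ∈ K, q ζ ≤ G ζ := fun ζ hζ => by
    rw [hK, mem_closedBall, dist_eq_norm] at hζ
    have : ‖ζ - a‖ ^ 2 ≤ r ^ 2 := by gcongr
    rw [hGv]
    nlinarith
  obtain ⟨X, hXc, hKX, hXΩ⟩ := exists_compact_between (hKc.image_of_continuousOn hfc) hΩ (image_subset_iff.2 hfΩ)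
  obtain ⟨B, hB⟩ : ∃ B : ℝ, ∀ ζ ∈ K, -B ≤ q ζ := by
    obtain ⟨z, hz, hz'⟩ := hKc.exists_isMinOn ⟨a, haK⟩ hqc.continuousOn
    exact ⟨- q z, fun ζ hζ => by simpa using hz' hζ⟩
  obtain ⟨w, hw⟩ : ∃ w : Cn 2 → ℝ, w = fun x => (max (us x) ((-B : ℝ) : EReal)).toReal := ⟨_, rfl⟩
  have hwv : ∀ x ∈ Ω, (w x : EReal) = max (us x) ((-B : ℝ) : EReal) := fun x hx => by
    rw [hw]
    refine EReal.coe_toReal (max_lt (htop x hx) (EReal.coe_lt_top _)).ne ?_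
    exact ((EReal.bot_lt_coe (-B)).trans_le (le_max_right _ _)).ne'
  have hwusc : UpperSemicontinuousOn w X := fun x hx c hc => by
    have h1 : max (us x) ((-B : ℝ) : EReal) < (c : EReal) := by rw [← hwv x (hXΩ hx)]; exact_mod_cast hc
    obtain ⟨h2, h3⟩ := max_lt_iff.1 h1
    filter_upwards [(husc.mono hXΩ) x hx c h2, self_mem_nhdsWithin] with y hy hyX
    have h4 : (w y : EReal) < c := by rw [hwv y (hXΩ hyX)]; exact max_lt hy h3
    exact_mod_cast h4
  have hwa : G a + δ ≤ w (f a) := by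
    have h1 : (t : EReal) ≤ w (f a) := by rw [hwv _ (hfΩ haK), ht]; exact le_max_left _ _
    have h2 : t ≤ w (f a) := by exact_mod_cast h1
    have : G a = q a + δ := by rw [hGv]; simp
    linarith
  obtain ⟨ζs, hζs, hdb⟩ := doubling hXc hwusc hr (hK ▸ hfc) (fun z hz => interior_subset (hKX ⟨z, hK ▸ hz, rfl⟩)) hGc hδ0 hwa (fun ζ hζ => by
    have hζK : ζ ∈ K := by rw [hK]; exact sphere_subset_closedBall hζ
    have h1 : (w (f ζ) : EReal) ≤ q ζ := by
      rw [hwv _ (hfΩ hζK)]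
      exact max_le (hsph ζ hζ) (by exact_mod_cast hB ζ hζK)
    have h2 : w (f ζ) ≤ q ζ := by exact_mod_cast h1
    exact h2.trans (hGq ζ hζK))
  have hbK : ball a r ⊆ K := by rw [hK]; exact ball_subset_closedBall
  obtain ⟨A, L, R, hR, hA, hb, hAJ, hOb, hDF⟩ := local_pack hΩ hJ hEΩ hEc hEsub hEtr (hfΩ (hbK hζs))
  have hPM : PM A (ball (f ζs) R \ E) u := PM_of_psh hJ hO hucont hupsh (fun x hx => hb (ball_subset_closedBall hx)) hAJ
  have hA2 : ∀ x ∈ ball (f ζs) R, ∀ v, A x (A x v) = -v := fun x hx v => by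
    rw [hAJ x hx]; exact sq_of_ACS hJ x (hb (ball_subset_closedBall hx)) v
  have hev0 : ∀ᶠ z in 𝓝 ζs, z ∈ ball a r := isOpen_ball.mem_nhds hζs
  have hev : ∀ᶠ z in 𝓝 ζs, z ∈ ball a r ∧ f z ∈ ball (f ζs) R :=
    hev0.and
      ((hf.2 ζs (hab (ball_subset_closedBall hζs))).1.continuousAt.eventually (ball_mem_nhds _ hR))
  obtain ⟨σ0, hσ0, hσb⟩ := Metric.eventually_nhds_iff_ball.1 hev
  have hfJH : JH A f (ball ζs σ0) := fun τ hτ => by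
    obtain ⟨h1, h2⟩ := hσb τ hτ
    obtain ⟨h3, h4⟩ := hf.2 τ (hab (ball_subset_closedBall h1))
    refine ⟨h3, ?_⟩
    rw [hAJ _ h2]
    have := congrArg (fun T => T 1) h4
    simpa [JstdC] using this
  obtain ⟨R', hR', Λ, hΛ, hlip⟩ := locLip_of_JH hA isOpen_ball hfJH (fun τ hτ => hA2 _ (hσb τ hτ).2) ζs (mem_ball_self hσ0)
  obtain ⟨σ, hσ⟩ : ∃ σ, σ = min σ0 R' / 2 := ⟨_, rfl⟩
  have hσp : 0 < σ := by rw [hσ]; positivity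
  have hσσ0 : 2 * σ ≤ σ0 := by have := min_le_left σ0 R'; linarith
  have hσR' : 2 * σ ≤ R' := by have := min_le_right σ0 R'; linarith
  obtain ⟨s1, hs1, hs1X⟩ := Metric.isOpen_iff.1 isOpen_interior (f ζs) (hKX ⟨ζs, hbK hζs, rfl⟩)
  obtain ⟨κ, hκ⟩ : ∃ κ, κ = ε / (|KK L (1 + (1 + L) * (Λ + 1))| + 1) := ⟨_, rfl⟩
  have hκ0 : 0 < κ := by rw [hκ]; positivity
  obtain ⟨N, hN, x, hxX, ζ, hζb, m, hm, hζσ, hxs, hNd, hwx, hmax⟩ := hdb κ hκ0 (min (min σ s1) R) (by positivity)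
  have hxR : x ∈ ball (f ζs) R := ball_subset_ball (min_le_right _ _) hxs
  have hxs1 : x ∈ ball (f ζs) s1 := ball_subset_ball ((min_le_left _ _).trans (min_le_right _ _)) hxs
  have hζσ' : ζ ∈ ball ζs σ := ball_subset_ball ((min_le_left _ _).trans (min_le_left _ _)) hζσ
  have hbb : ball ζ σ ⊆ ball ζs (2 * σ) := ball_subset_ball' (by rw [mem_ball] at hζσ'; linarith)
  have hbσ0 : ball ζ σ ⊆ ball ζs σ0 := hbb.trans (ball_subset_ball hσσ0)
  have hbR' : ball ζ σ ⊆ ball ζs R' := hbb.trans (ball_subset_ball hσR')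
  obtain ⟨s2, hs2, hs2X⟩ := Metric.isOpen_iff.1 isOpen_interior x (hs1X hxs1)
  obtain ⟨s3, hs3, hs3b⟩ := Metric.isOpen_iff.1 isOpen_ball ζ hζb
  have hxΩ : x ∈ Ω := hXΩ hxX
  have hNn : 0 ≤ N * ‖x - f ζ‖ ^ 2 := by positivity
  have husx : us x = w x := by
    have h1 := hwv x hxΩ
    rcases max_choice (us x) ((-B : ℝ) : EReal) with h | h
    · rw [h1, h]
    · rw [h] at h1
      have h2 : w x = -B := by exact_mod_cast h1
      have h3 := hB ζ (hbK hζb)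
      have h4 := hGq ζ (hbK hζb)
      linarith
  have hfin := local_lemma (u := u) (x := x) (s := min s2 s3) (m := m) hA hOb hA2 hPM hΛ hσp (hfJH.mono hbσ0) (fun τ hτ => (hσb τ (hbσ0 hτ)).2)
    (fun τ hτ τ' hτ' => hlip τ (hbR' hτ) τ' (hbR' hτ')) (hDF x hxR) hGc (hG ζ) hN (by positivity)
    (fun y hy hyO ξ hξ => by
      have hyX : y ∈ X := interior_subset (hs2X (ball_subset_ball (min_le_left _ _) hy))
      refine le_trans ?_ (hmax y hyX ξ (ball_subset_closedBall (hs3b (ball_subset_ball (min_le_right _ _) hξ))))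
      have h1 : (u y : EReal) ≤ w y := by
        rw [hwv y (hXΩ hyX), ← hstar1 y ⟨hXΩ hyX, hyO.2⟩]
        exact le_max_left _ _
      exact_mod_cast h1)
    (fun T hT => by
      rw [← hwx] at hT
      have hT' : (T : EReal) < us x := by rw [husx]; exact_mod_cast hT
      by_cases hxE : x ∈ E
      · rw [hstar2 x hxE] at hT'
        have h1 := Filter.frequently_lt_of_lt_limsup (by isBoundedDefault) hT'
        have h2 : 𝓝[Ω \ E] x = 𝓝[ball (f ζs) R \ E] x := by
          have e1 : ball (f ζs) R \ E = (Ω \ E) ∩ ball (f ζs) R := by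
            ext y
            exact ⟨fun h => ⟨⟨hb (ball_subset_closedBall h.1), h.2⟩, h.1⟩, fun h => ⟨h.2, h.1.2⟩⟩
          rw [e1]
          exact nhdsWithin_restrict _ hxR isOpen_ball
        rw [h2] at h1
        exact h1.mono fun y hy => by exact_mod_cast hy
      · rw [hstar1 x ⟨hxΩ, hxE⟩] at hT'
        have hT'' : T < u x := by exact_mod_cast hT'
        have h1 : x ∈ ball (f ζs) R \ E := ⟨hxR, hxE⟩
        have : (𝓝[ball (f ζs) R \ E] x).NeBot := mem_closure_iff_nhdsWithin_neBot.1 (subset_closure h1)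
        exact ((hPM.1 x h1).tendsto.eventually_const_lt hT'').frequently)
  have h1 : N * (KK L (1 + (1 + L) * (Λ + 1)) * ‖x - f ζ‖ ^ 2) ≤ |KK L (1 + (1 + L) * (Λ + 1))| * (N * ‖x - f ζ‖ ^ 2) := by
    have := mul_le_mul_of_nonneg_right (le_abs_self (KK L (1 + (1 + L) * (Λ + 1)))) hNn
    linarith
  rw [hκ, lt_div_iff₀ (by positivity)] at hNd
  linarith

end P7e
end RS

namespace RS

section P8

theorem usc_approx {w : ℂ → ℝ} {K : Set ℂ} (hK : IsCompact K) (hne : K.Nonempty) (hw : UpperSemicontinuousOn w K) :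
    ∃ (ω : ℕ → ℂ → ℝ) (M : ℝ), (∀ k, Continuous (ω k)) ∧ (∀ k, ∀ z ∈ K, w z ≤ ω k z) ∧ (∀ k z, ω k z ≤ M) ∧
      ∀ z ∈ K, Tendsto (fun k => ω k z) atTop (𝓝 (w z)) := by
  have hex : ∀ (k : ℕ) (z : ℂ), ∃ y ∈ K, ∀ y' ∈ K, w y' - k * dist z y' ≤ w y - k * dist z y := fun k z => by
    have h2 : ContinuousOn (fun y : ℂ => - (k * dist z y)) K := by fun_prop
    obtain ⟨y, hy, hm⟩ := (hw.add h2.upperSemicontinuousOn).exists_isMaxOn hne hK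
    refine ⟨y, hy, fun y' hy' => ?_⟩
    have := hm hy'
    simp only [mem_setOf_eq] at this
    linarith
  choose Y hYK hY using hex
  obtain ⟨y0, hy0, hM⟩ := hw.exists_isMaxOn hne hK
  refine ⟨fun k z => w (Y k z) - k * dist z (Y k z), w y0, fun k => ?_, fun k z hz => ?_, fun k z => ?_, fun z hz => ?_⟩
  · refine LipschitzWith.continuous (K := (k : NNReal)) (LipschitzWith.of_le_add_mul _ fun z z' => ?_)
    have h1 := hY k z' _ (hYK k z)
    have h2 := dist_triangle z' z (Y k z)
    rw [dist_comm z' z] at h2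
    have h3 : (k:ℝ) * dist z' (Y k z) ≤ k * (dist z z' + dist z (Y k z)) := by gcongr
    simp only [NNReal.coe_natCast]
    linarith
  · have := hY k z z hz
    simpa using this
  · have := hM (hYK k z)
    simp only [mem_setOf_eq] at this
    have : 0 ≤ (k:ℝ) * dist z (Y k z) := by positivity
    linarith
  · have hYl : Tendsto (fun k => Y k z) atTop (𝓝 z) := by
      rw [tendsto_iff_dist_tendsto_zero]
      have h1 : Tendsto (fun k : ℕ => (w y0 - w z) / k) atTop (𝓝 0) := tendsto_const_div_atTop_nhds_zero_nat _
      refine squeeze_zero' (Eventually.of_forall fun k => dist_nonneg) ?_ h1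
      filter_upwards [eventually_gt_atTop 0] with k hk
      have hk' : (0:ℝ) < k := by exact_mod_cast hk
      have h2 := hY k z z hz
      have h3 := hM (hYK k z)
      simp only [mem_setOf_eq, dist_self, mul_zero, sub_zero] at h2 h3
      rw [le_div_iff₀ hk', dist_comm]
      linarith
    have hYw : Tendsto (fun k => Y k z) atTop (𝓝[K] z) := tendsto_nhdsWithin_iff.2 ⟨hYl, Eventually.of_forall fun k => hYK k z⟩
    rw [tendsto_order]
    refine ⟨fun c hc => Eventually.of_forall fun k => ?_, fun c hc => ?_⟩
    · have := hY k z z hz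
      simp at this
      linarith
    · filter_upwards [hYw.eventually (hw z hz c hc)] with k hk
      have : 0 ≤ (k:ℝ) * dist z (Y k z) := by positivity
      linarith

theorem mean_usc {w : ℂ → ℝ} {a : ℂ} {r : ℝ} (hr : 0 < r) (hw : UpperSemicontinuousOn w (sphere a r)) {b : ℝ} (hb : ∀ z ∈ sphere a r, b ≤ w z)
    {c : ℝ} (hc : ∀ q, Harm q → (∀ z ∈ sphere a r, w z ≤ q z) → c ≤ q a) :
    CircleIntegrable w a r ∧ c ≤ Real.circleAverage w a r := by
  obtain ⟨ω, M, hωc, hwω, hωM, hωt⟩ := usc_approx (isCompact_sphere a r) (NormedSpace.sphere_nonempty.2 hr.le) hw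
  have hmap : ∀ θ, circleMap a r θ ∈ sphere a r := fun θ => circleMap_mem_sphere a hr.le θ
  have hωm : ∀ k, Continuous (fun θ => ω k (circleMap a r θ)) := fun k => (hωc k).comp (continuous_circleMap a r)
  have hbd : ∀ k θ, ‖ω k (circleMap a r θ)‖ ≤ |M| + |b| := fun k θ => by
    have h1 := hb _ (hmap θ)
    have h2 := hwω k _ (hmap θ)
    have h3 := hωM k (circleMap a r θ)
    rw [Real.norm_eq_abs, abs_le]
    have := neg_abs_le b
    have := le_abs_self M
    have := abs_nonneg b
    have := abs_nonneg M
    constructor <;> linarith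
  have hlim : ∀ θ, Tendsto (fun k => ω k (circleMap a r θ)) atTop (𝓝 (w (circleMap a r θ))) := fun θ => hωt _ (hmap θ)
  have hsm : StronglyMeasurable (fun θ => w (circleMap a r θ)) :=
    stronglyMeasurable_of_tendsto atTop (fun k => (hωm k).stronglyMeasurable) (tendsto_pi_nhds.2 hlim)
  have hci : CircleIntegrable w a r := by
    unfold CircleIntegrable
    refine IntervalIntegrable.mono_fun (g := fun θ => w (circleMap a r θ)) (intervalIntegrable_const (c := |M| + |b|)) hsm.aestronglyMeasurable (Eventually.of_forall fun θ => ?_)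
    have := le_of_tendsto (hlim θ).norm (Eventually.of_forall fun k => hbd k θ)
    rw [Real.norm_of_nonneg (by positivity : 0 ≤ |M| + |b|)]
    exact this
  refine ⟨hci, ?_⟩
  have hinteg : Tendsto (fun k => Real.circleAverage (ω k) a r) atTop (𝓝 (Real.circleAverage w a r)) := by
    simp only [Real.circleAverage_def]
    refine Tendsto.const_smul ?_ _
    exact intervalIntegral.tendsto_integral_filter_of_dominated_convergence (fun _ => |M| + |b|)
      (Eventually.of_forall fun k => (hωm k).aestronglyMeasurable) (Eventually.of_forall fun k => Eventually.of_forall fun θ _ => hbd k θ)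
      intervalIntegrable_const (Eventually.of_forall fun θ _ => hlim θ)
  refine ge_of_tendsto hinteg (Eventually.of_forall fun k => ?_)
  refine _root_.le_of_forall_pos_le_add fun ε hε => ?_
  obtain ⟨q, hq, hqa⟩ := harm_approx hr (hωc k).continuousOn (half_pos hε)
  have hi : ∀ {h : ℂ → ℝ}, Continuous h → CircleIntegrable h a r := fun {h} hh => circInt_of_cont fun τ _ => hh.continuousAt
  have hconst : Harm (fun _ : ℂ => ε / 2) := ⟨continuous_const, fun z ρ => Real.circleAverage_const _ _ _⟩
  have h1 := hc _ (hq.add hconst) fun z hz => by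
    have := (abs_le.1 (hqa z hz)).1
    have := hwω k z hz
    linarith
  have h2 : Real.circleAverage q a r ≤ Real.circleAverage (fun z => ω k z + ε / 2) a r := by
    refine Real.circleAverage_mono (hi hq.1) (hi ((hωc k).add continuous_const)) fun z hz => ?_
    rw [abs_of_pos hr] at hz
    have := (abs_le.1 (hqa z hz)).2
    linarith
  rw [ca_add' (hi (hωc k)) (circleIntegrable_const _ _ _), Real.circleAverage_const, hq.2] at h2
  linarith

set_option maxHeartbeats 1000000 in
theorem mean_ereal {h : ℂ → EReal} {a : ℂ} {r : ℝ} (hr : 0 < r) (hh : UpperSemicontinuousOn h (sphere a r)) (htop : ∀ z ∈ sphere a r, h z < ⊤)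
    {h0 : EReal} (hc : ∀ q : ℂ → ℝ, Harm q → (∀ z ∈ sphere a r, h z ≤ q z) → h0 ≤ q a) :
    h0 ≤ (((2 * Real.pi)⁻¹ : ℝ) : EReal) *
      erealIntegral (volume.restrict (Set.Ioc (0 : ℝ) (2 * Real.pi)))
        (fun θ : ℝ => h (a + (r : ℂ) * Complex.exp ((θ : ℂ) * Complex.I))) := by
  obtain ⟨μ, hμ⟩ : ∃ μ, μ = (volume.restrict (Set.Ioc (0 : ℝ) (2 * Real.pi))) := ⟨_, rfl⟩
  have hsp : ∀ θ : ℝ, a + (r : ℂ) * Complex.exp ((θ : ℂ) * Complex.I) ∈ sphere a r := fun θ => circleMap_mem_sphere a hr.le θ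
  obtain ⟨w, hw⟩ : ∃ w : ℕ → ℂ → ℝ, w = fun (n : ℕ) z => (max (h z) ((-(n:ℝ) : ℝ) : EReal)).toReal := ⟨_, rfl⟩
  have hwv : ∀ n, ∀ z ∈ sphere a r, (w n z : EReal) = max (h z) ((-(n:ℝ) : ℝ) : EReal) := fun n z hz => by
    rw [hw]
    refine EReal.coe_toReal (max_lt (htop z hz) (EReal.coe_lt_top _)).ne ?_
    exact ((EReal.bot_lt_coe (-(n:ℝ))).trans_le (le_max_right _ _)).ne'
  have hwusc : ∀ n, UpperSemicontinuousOn (w n) (sphere a r) := fun n x hx c hc => by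
    have h1 : max (h x) ((-(n:ℝ) : ℝ) : EReal) < (c : EReal) := by rw [← hwv n x hx]; exact_mod_cast hc
    obtain ⟨h2, h3⟩ := max_lt_iff.1 h1
    filter_upwards [hh x hx c h2, self_mem_nhdsWithin] with y hy hyX
    have h4 : (w n y : EReal) < c := by rw [hwv n y hyX]; exact max_lt hy h3
    exact_mod_cast h4
  have hwb : ∀ n : ℕ, ∀ z ∈ sphere a r, -(n:ℝ) ≤ w n z := fun n z hz => by
    have : ((-(n:ℝ) : ℝ) : EReal) ≤ w n z := by rw [hwv n z hz]; exact le_max_right _ _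
    exact_mod_cast this
  obtain ⟨W, hW⟩ : ∃ W : ℕ → ℝ → ℝ, W = fun n (θ : ℝ) => w n (a + (r : ℂ) * Complex.exp ((θ : ℂ) * Complex.I)) := ⟨_, rfl⟩
  obtain ⟨H, hH⟩ : ∃ H : ℝ → EReal, H = fun (θ : ℝ) => h (a + (r : ℂ) * Complex.exp ((θ : ℂ) * Complex.I)) := ⟨_, rfl⟩
  rw [← hH, ← hμ]
  have hWH : ∀ n θ, (W n θ : EReal) = max (H θ) ((-(n:ℝ) : ℝ) : EReal) := fun n θ => by
    rw [hW, hH]; exact hwv n _ (hsp θ)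
  have hHtop : ∀ θ, H θ < ⊤ := fun θ => by rw [hH]; exact htop _ (hsp θ)
  refine EReal.ge_of_forall_gt_iff_ge.1 fun t ht => ?_
  have hmean : ∀ n, CircleIntegrable (w n) a r ∧ t ≤ Real.circleAverage (w n) a r := fun n =>
    mean_usc hr (hwusc n) (hwb n) fun q hq hqw => by
      have h1 : h0 ≤ q a := hc q hq fun z hz => by
        have h2 : h z ≤ w n z := by rw [hwv n z hz]; exact le_max_left _ _
        exact h2.trans (by exact_mod_cast hqw z hz)
      have h3 := ht.le.trans h1
      exact_mod_cast h3
  have hWi : ∀ n, Integrable (W n) μ := fun n => by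
    have := (hmean n).1
    unfold CircleIntegrable at this
    rw [intervalIntegrable_iff_integrableOn_Ioc_of_le Real.two_pi_pos.le] at this
    rw [hμ, hW]
    exact this
  have e1 : ∀ x : ℝ, erealPos (x : EReal) = ENNReal.ofReal x := fun x => by simp [erealPos]
  have e2 : ∀ x : ℝ, erealPos (-(x : EReal)) = ENNReal.ofReal (-x) := fun x => by rw [← EReal.coe_neg, e1]
  have hcase : ∀ θ, H θ = ⊥ ∨ ∃ x : ℝ, H θ = x := fun θ => by
    by_cases hb : H θ = ⊥
    · exact Or.inl hb
    · exact Or.inr ⟨(H θ).toReal, (EReal.coe_toReal (hHtop θ).ne hb).symm⟩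
  have hWbot : ∀ n θ, H θ = ⊥ → W n θ = -n := fun n θ hb => by
    have := hWH n θ
    rw [hb, max_eq_right bot_le] at this
    exact_mod_cast this
  have hWre : ∀ n θ (x : ℝ), H θ = x → W n θ = max x (-n) := fun n θ x hx => by
    have := hWH n θ
    rw [hx, ← EReal.coe_strictMono.monotone.map_max] at this
    exact_mod_cast this
  have hpos : ∀ n θ, erealPos (W n θ) = erealPos (H θ) := fun n θ => by
    rw [e1]
    rcases hcase θ with hb | ⟨x, hx⟩
    · rw [hWbot n θ hb, hb]
      simp [erealPos]
    · rw [hWre n θ x hx, hx, e1]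
      rcases le_total x (-n) with hl | hl
      · rw [max_eq_right hl, ENNReal.ofReal_of_nonpos (by simp), ENNReal.ofReal_of_nonpos (hl.trans (by simp))]
      · rw [max_eq_left hl]
  obtain ⟨Ip, hIp⟩ : ∃ Ip, Ip = ∫⁻ θ, erealPos (H θ) ∂μ := ⟨_, rfl⟩
  have hIpf : Ip ≠ ⊤ := by
    have h1 := (hWi 0).lintegral_lt_top
    rw [hIp]
    simp only [← hpos 0, e1]
    exact h1.ne
  have hlt : ∀ n, (t : EReal) ≤ (((2 * Real.pi)⁻¹ : ℝ) : EReal) * ((Ip : EReal) - ((∫⁻ θ, ENNReal.ofReal (-W n θ) ∂μ : ℝ≥0∞) : EReal)) := fun n => by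
    have h1 := erealIntegral_circle (hmean n).1
    have h2 : (t : EReal) ≤ (Real.circleAverage (w n) a r : ℝ) := by exact_mod_cast (hmean n).2
    rw [← h1, ← hμ] at h2
    have h3 : (fun θ : ℝ => (w n (a + (r : ℂ) * Complex.exp ((θ : ℂ) * Complex.I)) : EReal)) = fun θ => (W n θ : EReal) := by rw [hW]
    rw [h3] at h2
    unfold erealIntegral at h2
    simp only [hpos, e2] at h2
    rw [← hIp] at h2
    exact h2
  have hmct : Tendsto (fun n : ℕ => ∫⁻ θ, ENNReal.ofReal (-W n θ) ∂μ) atTop (𝓝 (∫⁻ θ, erealPos (-(H θ)) ∂μ)) := by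
    refine lintegral_tendsto_of_tendsto_of_monotone (fun n => (hWi n).aestronglyMeasurable.aemeasurable.neg.ennreal_ofReal)
      (Eventually.of_forall fun θ n n' hnn => ?_) (Eventually.of_forall fun θ => ?_)
    · apply ENNReal.ofReal_le_ofReal
      have h1 : (W n' θ : EReal) ≤ W n θ := by
        rw [hWH, hWH]
        refine max_le_max le_rfl ?_
        have : (-(n':ℝ)) ≤ -(n:ℝ) := by simpa using hnn
        exact_mod_cast this
      have h2 : W n' θ ≤ W n θ := by exact_mod_cast h1
      linarith
    · rcases hcase θ with hb | ⟨x, hx⟩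
      · simp only [hWbot _ θ hb, hb, neg_neg, EReal.neg_bot]
        have : erealPos ⊤ = ⊤ := by simp [erealPos]
        rw [this]
        exact ENNReal.tendsto_ofReal_atTop.comp tendsto_natCast_atTop_atTop
      · rw [hx, e2]
        refine tendsto_const_nhds.congr' ?_
        obtain ⟨n0, hn0⟩ := exists_nat_ge (-x)
        filter_upwards [eventually_ge_atTop n0] with n hn
        have : (n0:ℝ) ≤ n := by exact_mod_cast hn
        rw [hWre n θ x hx, max_eq_left (by linarith)]
  unfold erealIntegral
  rw [← hIp]
  refine ge_of_tendsto (x := atTop) (f := fun n : ℕ => (((2 * Real.pi)⁻¹ : ℝ) : EReal) * ((Ip : EReal) - ((∫⁻ θ, ENNReal.ofReal (-W n θ) ∂μ : ℝ≥0∞) : EReal))) ?_ (Eventually.of_forall hlt)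
  have hIpr : (Ip : EReal) = ((Ip.toReal : ℝ) : EReal) := (EReal.coe_ennreal_toReal hIpf).symm
  have t1 : Tendsto (fun n : ℕ => -((∫⁻ θ, ENNReal.ofReal (-W n θ) ∂μ : ℝ≥0∞) : EReal)) atTop (𝓝 (-((∫⁻ θ, erealPos (-(H θ)) ∂μ : ℝ≥0∞) : EReal))) :=
    (continuous_neg.tendsto _).comp ((continuous_coe_ennreal_ereal.tendsto _).comp hmct)
  have hc1 : ContinuousAt (fun p : EReal × EReal => p.1 + p.2) ((Ip : EReal), -((∫⁻ θ, erealPos (-(H θ)) ∂μ : ℝ≥0∞) : EReal)) := by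
    rw [hIpr]
    exact EReal.continuousAt_add (Or.inl (EReal.coe_ne_top _)) (Or.inl (EReal.coe_ne_bot _))
  have t2 := hc1.tendsto.comp ((tendsto_const_nhds (x := (Ip : EReal)) (f := (atTop : Filter ℕ))).prodMk_nhds t1)
  have hpi : (2 * Real.pi)⁻¹ ≠ 0 := by positivity
  have hpi' : (((2 * Real.pi)⁻¹ : ℝ) : EReal) ≠ 0 := by exact_mod_cast hpi
  have hc2 : ContinuousAt (fun p : EReal × EReal => p.1 * p.2) ((((2 * Real.pi)⁻¹ : ℝ) : EReal), (Ip : EReal) + -((∫⁻ θ, erealPos (-(H θ)) ∂μ : ℝ≥0∞) : EReal)) := by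
    refine EReal.continuousAt_mul (Or.inl ?_) (Or.inl ?_) (Or.inl (EReal.coe_ne_bot _)) (Or.inl (EReal.coe_ne_top _)) <;> exact hpi'
  have t3 := hc2.tendsto.comp ((tendsto_const_nhds (x := (((2 * Real.pi)⁻¹ : ℝ) : EReal)) (f := (atTop : Filter ℕ))).prodMk_nhds t2)
  exact t3

end P8
end RS

/-- **Removable singularities for plurisubharmonic functions** (Theorem 1.4.10): on a
4-dimensional almost complex manifold `(Ω,J)`, a continuous `J`-plurisubharmonic function on the
complement of a closed totally real 2-dimensional `C^∞` submanifold `E` extends (by its upper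
limit on `E`) to a `J`-plurisubharmonic function on all of `Ω`. -/
theorem removable_singularities_psh (Ω : Set (Cn 2)) (hΩ : IsOpen Ω)
    (J : Cn 2 → Cn 2 →L[ℝ] Cn 2) (hJ : IsACS Ω J)
    (E : Set (Cn 2)) (hEΩ : E ⊆ Ω) (hEclosed : closure E ∩ Ω ⊆ E)
    (hEsub : IsSmoothSubmanifold 2 E) (hEtotreal : TotallyReal J E)
    (u : Cn 2 → ℝ) (hucont : ContinuousOn u (Ω \ E)) (hupsh : JPshOnR J (Ω \ E) u)
    (ustar : Cn 2 → EReal)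
    (hstar1 : ∀ x ∈ Ω \ E, ustar x = (u x : EReal))
    (hstar2 : ∀ x ∈ E, ustar x = Filter.limsup (fun y => ((u y : ℝ) : EReal)) (𝓝[Ω \ E] x)) :
    JPshOn J Ω ustar := by
  have hO := RS.open_diff hΩ hEclosed
  have htop : ∀ x ∈ Ω, ustar x < ⊤ := fun x hx => by
    by_cases hxE : x ∈ E
    · obtain ⟨A, L, R, Y, D, Q, C, c, h, hb, hAJ⟩ := RS.LD_exists hΩ hJ hEΩ hEsub hEtotreal hxE
      have hb' : ball x R ⊆ Ω := ball_subset_closedBall.trans hb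
      have hOb : IsOpen (ball x R \ E) := by
        have : ball x R \ E = ball x R ∩ (Ω \ E) := by
          ext y
          exact ⟨fun h => ⟨h.1, hb' h.1, h.2⟩, fun h => ⟨h.1, h.2.2⟩⟩
        rw [this]
        exact isOpen_ball.inter hO
      obtain ⟨r1, hr1, M, hM⟩ := RS.upper_bound (by rw [RS.finrank_Cn2]; norm_num) h hxE hOb (RS.PM_of_psh hJ hO hucont hupsh hb' hAJ)
      rw [hstar2 x hxE]
      refine lt_of_le_of_lt (Filter.limsup_le_of_le (by isBoundedDefault) (a := ((M : ℝ) : EReal)) ?_) (EReal.coe_lt_top M)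
      filter_upwards [mem_nhdsWithin_of_mem_nhds (ball_mem_nhds x hr1), self_mem_nhdsWithin] with y hy hyO
      exact_mod_cast hM y ⟨hy, hyO.2⟩
    · rw [hstar1 x ⟨hx, hxE⟩]; exact EReal.coe_lt_top _
  have husc : UpperSemicontinuousOn ustar Ω := fun x hx c hc => by
    replace hc : ustar x < c := hc
    suffices hs : ∀ᶠ y in 𝓝 x, ustar y < c from nhdsWithin_le_nhds hs
    by_cases hxE : x ∈ E
    · rw [hstar2 x hxE] at hc
      obtain ⟨c', hc1, hc2⟩ := exists_between hc
      have h1 := Filter.eventually_lt_of_limsup_lt hc1 (by isBoundedDefault)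
      rw [eventually_nhdsWithin_iff] at h1
      filter_upwards [h1.eventually_nhds, hΩ.mem_nhds hx] with y hy hyΩ
      by_cases hyE : y ∈ E
      · rw [hstar2 y hyE]
        refine lt_of_le_of_lt (Filter.limsup_le_of_le (by isBoundedDefault) (a := c') ?_) hc2
        rw [eventually_nhdsWithin_iff]
        exact hy.mono fun z hz hzO => (hz hzO).le
      · rw [hstar1 y ⟨hyΩ, hyE⟩]
        exact (hy.self_of_nhds ⟨hyΩ, hyE⟩).trans hc2
    · rw [hstar1 x ⟨hx, hxE⟩] at hc
      have hm := hO.mem_nhds ⟨hx, hxE⟩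
      have h1 : ContinuousAt (fun y => (u y : EReal)) x := continuous_coe_real_ereal.continuousAt.comp (hucont.continuousAt hm)
      filter_upwards [h1.eventually_lt_const hc, hm] with y hy hyO
      rw [hstar1 y hyO]
      exact hy
  refine ⟨husc, fun f hf => ?_⟩
  have hfu : UpperSemicontinuousOn (fun ζ => ustar (f ζ)) unitDisc := fun ζ hζ c hc => by
    have h1 := husc (f ζ) (hf.1 hζ) c hc
    exact ((hf.2 ζ hζ).1.continuousAt.continuousWithinAt.tendsto_nhdsWithin hf.1).eventually h1
  refine ⟨hfu, fun a r hr hab => ?_⟩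
  have hsp : sphere a r ⊆ unitDisc := sphere_subset_closedBall.trans hab
  exact RS.mean_ereal (h := fun ζ => ustar (f ζ)) hr (hfu.mono hsp) (fun z hz => htop _ (hf.1 (hsp hz))) fun q hq hqs =>
    RS.key hΩ hJ hEΩ hEclosed hEsub hEtotreal hucont hupsh hstar1 hstar2 husc htop hf hr hab hq hqs
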